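/- Fix B > 0. There is a constant C, independent of μ ≥ 1, such that: if w ∈ C^∞(ℝ×ℝ³) satisfies w(t,x)=0 for t ≤ 2B and (□+μ²)w(t,x)=0 for |x| > t−B, then for all t ≥ 2B, (1+t)^{3/2} sup_x |w(t,x)| ≤ C Σ_{|α|≤5} Σ_{k∈ℤ} sup_{τ∈[2^{k−1},2^{k+1}]∩[2B,t]} 2^k ‖Γ^α (□+μ²)w(τ,·)‖_{L²(ℝ³)}. -/

import Mathlib

open MeasureTheory

noncomputable section

/-- The partial derivative in the `i`-th coordinate direction on `ℝⁿ`. -/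
def pd {n : ℕ} (i : Fin n) (u : (Fin n → ℝ) → ℝ) : (Fin n → ℝ) → ℝ :=
  fun z => fderiv ℝ u z (Pi.single i 1)

/-- Iterated application of a family of first-order operators along a list of indices. -/
def opIter {α γ : Type*} (F : α → γ → γ) : List α → γ → γ
  | [] => id
  | i :: L => fun u => F i (opIter F L u)

/-- The ten vector fields Γ on ℝ×ℝ³ (coordinates: `0 = t`, `1,2,3 = x`):
`∂_t, ∂_{x₁}, ∂_{x₂}, ∂_{x₃}`, the rotations `Ω_{jk} = x_j∂_k - x_k∂_j` (`1 ≤ j < k ≤ 3`)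
and the boosts `Ω_{0k} = x_k∂_t + t∂_k` (`k = 1,2,3`). -/
def GammaField (i : Fin 10) (u : (Fin 4 → ℝ) → ℝ) : (Fin 4 → ℝ) → ℝ :=
  if i.val = 0 then pd 0 u
  else if i.val = 1 then pd 1 u
  else if i.val = 2 then pd 2 u
  else if i.val = 3 then pd 3 u
  else if i.val = 4 then fun z => z 1 * pd 2 u z - z 2 * pd 1 u z
  else if i.val = 5 then fun z => z 1 * pd 3 u z - z 3 * pd 1 u z
  else if i.val = 6 then fun z => z 2 * pd 3 u z - z 3 * pd 2 u z
  else if i.val = 7 then fun z => z 1 * pd 0 u z + z 0 * pd 1 u z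
  else if i.val = 8 then fun z => z 2 * pd 0 u z + z 0 * pd 2 u z
  else fun z => z 3 * pd 0 u z + z 0 * pd 3 u z

/-- The spatial radius `r = |x|` of a space-time point. -/
def rad (z : Fin 4 → ℝ) : ℝ := Real.sqrt ((z 1)^2 + (z 2)^2 + (z 3)^2)

/-- The d'Alembertian `□ = ∂_t² - Δ` on ℝ×ℝ³. -/
def Box (u : (Fin 4 → ℝ) → ℝ) : (Fin 4 → ℝ) → ℝ :=
  fun z => pd 0 (pd 0 u) z - pd 1 (pd 1 u) z - pd 2 (pd 2 u) z - pd 3 (pd 3 u) z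

/-- The `L²` norm in `x ∈ ℝ³` at fixed time `t`. -/
def L2x (f : (Fin 4 → ℝ) → ℝ) (t : ℝ) : ℝ :=
  Real.sqrt (∫ x : Fin 3 → ℝ, (f (Fin.cons t x))^2)

/-- The dyadic sum `Σ_k sup_{τ ∈ [2^{k-1},2^{k+1}] ∩ [2B,t]} 2^k g(τ)`; for each `k ∈ ℤ` the
supremum is taken over the (possibly empty) intersection, and `sSup ∅ = 0` in `ℝ`. -/
def dyadic (g : ℝ → ℝ) (B t : ℝ) : ℝ :=
  ∑' k : ℤ, sSup ((fun τ => (2:ℝ)^k * g τ) ''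
    (Set.Icc ((2:ℝ)^(k-1)) ((2:ℝ)^(k+1)) ∩ Set.Icc (2*B) t))

/-! ### Calculus of coordinate derivatives -/

lemma smooth_pd {n : ℕ} {u : (Fin n → ℝ) → ℝ} (hu : ContDiff ℝ (⊤ : ℕ∞) u) (i : Fin n) :
    ContDiff ℝ (⊤ : ℕ∞) (pd i u) := by
  unfold pd
  exact (hu.fderiv_right (m := (⊤ : ℕ∞)) (by norm_cast)).clm_apply contDiff_const

lemma smooth_differentiable {n : ℕ} {u : (Fin n → ℝ) → ℝ} (hu : ContDiff ℝ (⊤ : ℕ∞) u) :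
    Differentiable ℝ u :=
  hu.differentiable (by norm_cast)

lemma smooth_coord {n : ℕ} (j : Fin n) :
    ContDiff ℝ (⊤ : ℕ∞) (fun z : Fin n → ℝ => z j) := contDiff_apply ℝ ℝ j

lemma pd_comm {n : ℕ} {u : (Fin n → ℝ) → ℝ} (hu : ContDiff ℝ (⊤ : ℕ∞) u) (i j : Fin n) :
    pd i (pd j u) = pd j (pd i u) := by
  have h2 : Differentiable ℝ (fderiv ℝ u) :=
    (hu.fderiv_right (m := (⊤ : ℕ∞)) (by norm_cast)).differentiable (by norm_cast)
  have key : ∀ (a b : Fin n) (z : Fin n → ℝ),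
      pd a (pd b u) z = fderiv ℝ (fderiv ℝ u) z (Pi.single a 1) (Pi.single b 1) := by
    intro a b z
    unfold pd
    rw [fderiv_clm_apply (h2 z) (differentiableAt_const _)]
    simp
  funext z
  rw [key, key]
  exact second_derivative_symmetric (fun y => (smooth_differentiable hu y).hasFDerivAt)
    (h2 z).hasFDerivAt _ _

lemma pd_add {n : ℕ} {u v : (Fin n → ℝ) → ℝ} (hu : Differentiable ℝ u) (hv : Differentiable ℝ v)
    (i : Fin n) : pd i (fun z => u z + v z) = fun z => pd i u z + pd i v z := by
  funext z; unfold pd; rw [fderiv_fun_add (hu z) (hv z)]; rfl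

lemma pd_sub {n : ℕ} {u v : (Fin n → ℝ) → ℝ} (hu : Differentiable ℝ u) (hv : Differentiable ℝ v)
    (i : Fin n) : pd i (fun z => u z - v z) = fun z => pd i u z - pd i v z := by
  funext z; unfold pd; rw [fderiv_fun_sub (hu z) (hv z)]; rfl

lemma pd_mul {n : ℕ} {u v : (Fin n → ℝ) → ℝ} (hu : Differentiable ℝ u) (hv : Differentiable ℝ v)
    (i : Fin n) : pd i (fun z => u z * v z) = fun z => pd i u z * v z + u z * pd i v z := by
  funext z; unfold pd; rw [fderiv_fun_mul (hu z) (hv z)]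
  simp; ring

lemma pd_const_mul {n : ℕ} {v : (Fin n → ℝ) → ℝ} (hv : Differentiable ℝ v)
    (a : ℝ) (i : Fin n) : pd i (fun z => a * v z) = fun z => a * pd i v z := by
  funext z; unfold pd; rw [fderiv_const_mul (hv z)]; rfl

lemma pd_coord {n : ℕ} (i j : Fin n) (z : Fin n → ℝ) :
    pd i (fun z : Fin n → ℝ => z j) z = if j = i then 1 else 0 := by
  unfold pd
  have : fderiv ℝ (fun z : Fin n → ℝ => z j) z
      = ContinuousLinearMap.proj (R := ℝ) (φ := fun _ : Fin n => ℝ) j :=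
    (ContinuousLinearMap.proj (R := ℝ) (φ := fun _ : Fin n => ℝ) j).hasFDerivAt.fderiv
  rw [this]
  simp [Pi.single_apply]

lemma pd_coord_mul {n : ℕ} {v : (Fin n → ℝ) → ℝ} (hv : Differentiable ℝ v) (i j : Fin n) :
    pd i (fun z => z j * v z) = fun z => (if j = i then v z else 0) + z j * pd i v z := by
  rw [pd_mul (smooth_differentiable (smooth_coord j)) hv]
  funext z
  rw [pd_coord]
  split_ifs <;> simp

/-- The first-order operator `a z_j ∂_k + b z_k ∂_j`. -/
def rotOp (a b : ℝ) (j k : Fin 4) (u : (Fin 4 → ℝ) → ℝ) : (Fin 4 → ℝ) → ℝ :=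
  fun z => a * (z j * pd k u z) + b * (z k * pd j u z)

lemma smooth_rotOp {u : (Fin 4 → ℝ) → ℝ} (hu : ContDiff ℝ (⊤ : ℕ∞) u) (a b : ℝ) (j k : Fin 4) :
    ContDiff ℝ (⊤ : ℕ∞) (rotOp a b j k u) :=
  (contDiff_const.mul ((smooth_coord j).mul (smooth_pd hu k))).add
    (contDiff_const.mul ((smooth_coord k).mul (smooth_pd hu j)))

lemma smooth_mul_pd {u : (Fin 4 → ℝ) → ℝ} (hu : ContDiff ℝ (⊤ : ℕ∞) u) (j k : Fin 4) :
    ContDiff ℝ (⊤ : ℕ∞) (fun z => z j * pd k u z) :=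
  (smooth_coord j).mul (smooth_pd hu k)

lemma pd_rotOp {u : (Fin 4 → ℝ) → ℝ} (hu : ContDiff ℝ (⊤ : ℕ∞) u) (a b : ℝ) (i j k : Fin 4)
    (z : Fin 4 → ℝ) :
    pd i (rotOp a b j k u) z = rotOp a b j k (pd i u) z +
      ((if j = i then a * pd k u z else 0) + (if k = i then b * pd j u z else 0)) := by
  unfold rotOp
  rw [pd_add (smooth_differentiable (contDiff_const.mul (smooth_mul_pd hu j k)))
    (smooth_differentiable (contDiff_const.mul (smooth_mul_pd hu k j))),
    pd_const_mul (smooth_differentiable (smooth_mul_pd hu j k)),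
    pd_const_mul (smooth_differentiable (smooth_mul_pd hu k j)),
    pd_coord_mul (smooth_differentiable (smooth_pd hu k)),
    pd_coord_mul (smooth_differentiable (smooth_pd hu j)), pd_comm hu i k, pd_comm hu i j]
  split_ifs <;> ring

lemma pd_pd_rotOp {u : (Fin 4 → ℝ) → ℝ} (hu : ContDiff ℝ (⊤ : ℕ∞) u) (a b : ℝ) (i j k : Fin 4)
    (z : Fin 4 → ℝ) :
    pd i (pd i (rotOp a b j k u)) z = rotOp a b j k (pd i (pd i u)) z +
      2 * ((if j = i then a * pd i (pd k u) z else 0) +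
        (if k = i then b * pd i (pd j u) z else 0)) := by
  have h : pd i (rotOp a b j k u) = fun z => rotOp a b j k (pd i u) z +
      (((if j = i then a else 0) * pd k u z) + ((if k = i then b else 0) * pd j u z)) := by
    funext z; rw [pd_rotOp hu]; split_ifs <;> ring
  have hk := smooth_pd hu k
  have hj := smooth_pd hu j
  rw [h, pd_add (smooth_differentiable (smooth_rotOp (smooth_pd hu i) a b j k))
    (smooth_differentiable ((contDiff_const.mul hk).add (contDiff_const.mul hj))),
    pd_add (smooth_differentiable (contDiff_const.mul hk))
      (smooth_differentiable (contDiff_const.mul hj)),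
    pd_const_mul (smooth_differentiable hk), pd_const_mul (smooth_differentiable hj)]
  simp only
  rw [pd_rotOp (smooth_pd hu i), pd_comm hu k i, pd_comm hu j i]
  split_ifs <;> ring

lemma smooth_Box {u : (Fin 4 → ℝ) → ℝ} (hu : ContDiff ℝ (⊤ : ℕ∞) u) :
    ContDiff ℝ (⊤ : ℕ∞) (Box u) :=
  (((smooth_pd (smooth_pd hu 0) 0).sub (smooth_pd (smooth_pd hu 1) 1)).sub
    (smooth_pd (smooth_pd hu 2) 2)).sub (smooth_pd (smooth_pd hu 3) 3)

lemma pd_Box {u : (Fin 4 → ℝ) → ℝ} (hu : ContDiff ℝ (⊤ : ℕ∞) u) (i : Fin 4) :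
    pd i (Box u) = Box (pd i u) := by
  have h := fun j : Fin 4 => smooth_pd (smooth_pd hu j) j
  have hc : ∀ j : Fin 4, pd i (pd j (pd j u)) = pd j (pd j (pd i u)) := fun j => by
    rw [pd_comm (smooth_pd hu j), pd_comm hu i j]
  unfold Box
  rw [pd_sub (smooth_differentiable (((h 0).sub (h 1)).sub (h 2))) (smooth_differentiable (h 3)),
    pd_sub (smooth_differentiable ((h 0).sub (h 1))) (smooth_differentiable (h 2)),
    pd_sub (smooth_differentiable (h 0)) (smooth_differentiable (h 1)), hc, hc, hc, hc]

lemma rotOp_Box {u : (Fin 4 → ℝ) → ℝ} (hu : ContDiff ℝ (⊤ : ℕ∞) u) (a b : ℝ) (j k : Fin 4) :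
    rotOp a b j k (Box u) = fun z =>
      rotOp a b j k (pd 0 (pd 0 u)) z - rotOp a b j k (pd 1 (pd 1 u)) z
        - rotOp a b j k (pd 2 (pd 2 u)) z - rotOp a b j k (pd 3 (pd 3 u)) z := by
  funext z
  unfold rotOp
  have h := fun i : Fin 4 => pd_Box hu i
  have hc : ∀ i l : Fin 4, pd i (pd l (pd l u)) = pd l (pd l (pd i u)) := fun i l => by
    rw [pd_comm (smooth_pd hu l), pd_comm hu i l]
  rw [h, h]
  simp only [hc k, hc j]
  unfold Box
  ring

lemma smooth_GammaField {u : (Fin 4 → ℝ) → ℝ} (hu : ContDiff ℝ (⊤ : ℕ∞) u) (i : Fin 10) :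
    ContDiff ℝ (⊤ : ℕ∞) (GammaField i u) := by
  unfold GammaField
  have h := smooth_pd hu
  have hz : ∀ j k : Fin 4, ContDiff ℝ (⊤ : ℕ∞) (fun z => z j * pd k u z) := smooth_mul_pd hu
  split_ifs
  · exact h 0
  · exact h 1
  · exact h 2
  · exact h 3
  · exact (hz 1 2).sub (hz 2 1)
  · exact (hz 1 3).sub (hz 3 1)
  · exact (hz 2 3).sub (hz 3 2)
  · exact (hz 1 0).add (hz 0 1)
  · exact (hz 2 0).add (hz 0 2)
  · exact (hz 3 0).add (hz 0 3)

lemma smooth_opIter {u : (Fin 4 → ℝ) → ℝ} (hu : ContDiff ℝ (⊤ : ℕ∞) u) (L : List (Fin 10)) :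
    ContDiff ℝ (⊤ : ℕ∞) (opIter GammaField L u) := by
  induction L with
  | nil => exact hu
  | cons i L ih => exact smooth_GammaField ih i

/-- The Klein–Gordon operator `□ + μ²`. -/
def KG (μ : ℝ) (u : (Fin 4 → ℝ) → ℝ) : (Fin 4 → ℝ) → ℝ := fun z => Box u z + μ ^ 2 * u z

lemma smooth_KG {u : (Fin 4 → ℝ) → ℝ} (hu : ContDiff ℝ (⊤ : ℕ∞) u) (μ : ℝ) :
    ContDiff ℝ (⊤ : ℕ∞) (KG μ u) := (smooth_Box hu).add (contDiff_const.mul hu)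

lemma GammaField_cases {P : (((Fin 4 → ℝ) → ℝ) → (Fin 4 → ℝ) → ℝ) → Prop}
    (hpd : ∀ i, P (pd i))
    (hrot : ∀ j k, j ≠ k → j ≠ 0 → k ≠ 0 → P (rotOp 1 (-1) j k))
    (hboost : ∀ k, k ≠ 0 → P (rotOp 1 1 k 0)) (i : Fin 10) : P (GammaField i) := by
  have e : ∀ j k, (fun (u : (Fin 4 → ℝ) → ℝ) (z : Fin 4 → ℝ) => z j * pd k u z - z k * pd j u z)
      = rotOp 1 (-1) j k := fun j k => by funext u z; unfold rotOp; ring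
  have e' : ∀ k, (fun (u : (Fin 4 → ℝ) → ℝ) (z : Fin 4 → ℝ) => z k * pd 0 u z + z 0 * pd k u z)
      = rotOp 1 1 k 0 := fun k => by funext u z; unfold rotOp; ring
  fin_cases i
  · exact hpd 0
  · exact hpd 1
  · exact hpd 2
  · exact hpd 3
  · have h := hrot 1 2 (by decide) (by decide) (by decide)
    rw [← e 1 2] at h
    exact h
  · have h := hrot 1 3 (by decide) (by decide) (by decide)
    rw [← e 1 3] at h
    exact h
  · have h := hrot 2 3 (by decide) (by decide) (by decide)
    rw [← e 2 3] at h
    exact h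
  · have h := hboost 1 (by decide)
    rw [← e' 1] at h
    exact h
  · have h := hboost 2 (by decide)
    rw [← e' 2] at h
    exact h
  · have h := hboost 3 (by decide)
    rw [← e' 3] at h
    exact h

lemma Box_rotOp_rotation {u : (Fin 4 → ℝ) → ℝ} (hu : ContDiff ℝ (⊤ : ℕ∞) u) {j k : Fin 4}
    (hjk : j ≠ k) (hj : j ≠ 0) (hk : k ≠ 0) :
    Box (rotOp 1 (-1) j k u) = rotOp 1 (-1) j k (Box u) := by
  rw [rotOp_Box hu]
  funext z
  unfold Box
  simp only [pd_pd_rotOp hu]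
  have := congrFun (pd_comm hu j k) z
  fin_cases j <;> fin_cases k <;> simp at hjk hj hk ⊢ <;> simp at this <;> linarith

lemma Box_rotOp_boost {u : (Fin 4 → ℝ) → ℝ} (hu : ContDiff ℝ (⊤ : ℕ∞) u) {k : Fin 4}
    (hk : k ≠ 0) :
    Box (rotOp 1 1 k 0 u) = rotOp 1 1 k 0 (Box u) := by
  rw [rotOp_Box hu]
  funext z
  unfold Box
  simp only [pd_pd_rotOp hu]
  have := congrFun (pd_comm hu k 0) z
  fin_cases k <;> simp at hk ⊢ <;> simp at this <;> linarith

lemma KG_of_Box_comm {P : ((Fin 4 → ℝ) → ℝ) → (Fin 4 → ℝ) → ℝ} {μ : ℝ} {u : (Fin 4 → ℝ) → ℝ}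
    (hB : Box (P u) = P (Box u))
    (hlin : P (KG μ u) = fun z => P (Box u) z + μ ^ 2 * P u z) :
    KG μ (P u) = P (KG μ u) := by
  rw [hlin]; unfold KG; rw [hB]

lemma pd_KG {u : (Fin 4 → ℝ) → ℝ} (hu : ContDiff ℝ (⊤ : ℕ∞) u) (μ : ℝ) (i : Fin 4) :
    pd i (KG μ u) = fun z => pd i (Box u) z + μ ^ 2 * pd i u z := by
  unfold KG
  rw [pd_add (smooth_differentiable (smooth_Box hu))
    (smooth_differentiable (contDiff_const.mul hu)), pd_const_mul (smooth_differentiable hu)]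

lemma rotOp_KG {u : (Fin 4 → ℝ) → ℝ} (hu : ContDiff ℝ (⊤ : ℕ∞) u) (μ a b : ℝ) (j k : Fin 4) :
    rotOp a b j k (KG μ u) = fun z => rotOp a b j k (Box u) z + μ ^ 2 * rotOp a b j k u z := by
  funext z
  unfold rotOp
  rw [pd_KG hu, pd_KG hu]
  ring

lemma KG_GammaField {u : (Fin 4 → ℝ) → ℝ} (hu : ContDiff ℝ (⊤ : ℕ∞) u) (μ : ℝ) (i : Fin 10) :
    KG μ (GammaField i u) = GammaField i (KG μ u) :=
  GammaField_cases (P := fun G => KG μ (G u) = G (KG μ u))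
    (fun i => KG_of_Box_comm (P := pd i) (pd_Box hu i).symm (pd_KG hu μ i))
    (fun _ _ h1 h2 h3 => KG_of_Box_comm (Box_rotOp_rotation hu h1 h2 h3) (rotOp_KG hu μ _ _ _ _))
    (fun _ h => KG_of_Box_comm (Box_rotOp_boost hu h) (rotOp_KG hu μ _ _ _ _)) i

lemma KG_opIter {u : (Fin 4 → ℝ) → ℝ} (hu : ContDiff ℝ (⊤ : ℕ∞) u) (μ : ℝ) (L : List (Fin 10)) :
    KG μ (opIter GammaField L u) = opIter GammaField L (KG μ u) := by
  induction L with
  | nil => rfl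
  | cons i L ih =>
    change KG μ (GammaField i (opIter GammaField L u)) = GammaField i (opIter GammaField L (KG μ u))
    rw [KG_GammaField (smooth_opIter hu L), ih]

lemma pd_eqOn_zero {n : ℕ} {u : (Fin n → ℝ) → ℝ} {U : Set (Fin n → ℝ)} (hU : IsOpen U)
    (h : ∀ z ∈ U, u z = 0) (i : Fin n) : ∀ z ∈ U, pd i u z = 0 := by
  intro z hz
  have : u =ᶠ[nhds z] fun _ => 0 := by
    filter_upwards [hU.mem_nhds hz] with y hy using h y hy
  unfold pd
  rw [this.fderiv_eq]; simp

lemma opIter_eqOn_zero {u : (Fin 4 → ℝ) → ℝ} {U : Set (Fin 4 → ℝ)} (hU : IsOpen U)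
    (h : ∀ z ∈ U, u z = 0) (L : List (Fin 10)) : ∀ z ∈ U, opIter GammaField L u z = 0 := by
  induction L with
  | nil => exact h
  | cons i L ih =>
    intro z hz
    change GammaField i (opIter GammaField L u) z = 0
    refine GammaField_cases (P := fun G => G (opIter GammaField L u) z = 0) ?_ ?_ ?_ i
    · exact fun i => pd_eqOn_zero hU ih i z hz
    all_goals intros; simp [rotOp, pd_eqOn_zero hU ih _ z hz]

/-! ### Functions supported in the translated light cone -/

/-- Vanishing for `t ≤ 2B` and outside the cone `|x| ≤ t - B`. -/
def ConeSupp (B : ℝ) (f : (Fin 4 → ℝ) → ℝ) : Prop :=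
  ∀ z : Fin 4 → ℝ, (z 0 ≤ 2 * B ∨ z 0 - B < rad z) → f z = 0

lemma continuous_rad : Continuous rad := by unfold rad; fun_prop

lemma eq_zero_of_time_le {f : (Fin 4 → ℝ) → ℝ} (hf : Continuous f) {a : ℝ}
    (h : ∀ z : Fin 4 → ℝ, z 0 < a → f z = 0) {z : Fin 4 → ℝ} (hz : z 0 ≤ a) : f z = 0 := by
  have h1 : z ∈ closure {z : Fin 4 → ℝ | z 0 < a} := by
    have := (isOpenMap_eval (X := fun _ : Fin 4 => ℝ) 0).preimage_closure_eq_closure_preimage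
      (continuous_apply 0) (Set.Iio a)
    rw [closure_Iio] at this
    have hz' : z ∈ Function.eval 0 ⁻¹' Set.Iic a := hz
    rw [this] at hz'
    exact hz'
  exact closure_minimal (t := {z | f z = 0}) h (isClosed_eq hf continuous_const) h1

lemma ConeSupp.of_open {B : ℝ} {f : (Fin 4 → ℝ) → ℝ} (hf : Continuous f)
    (h : ∀ z ∈ {z : Fin 4 → ℝ | z 0 < 2 * B ∨ z 0 - B < rad z}, f z = 0) : ConeSupp B f := by
  rintro z (hz | hz)
  · exact eq_zero_of_time_le hf (fun z hz => h z (Or.inl hz)) hz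
  · exact h z (Or.inr hz)

lemma isOpen_cone_compl (B : ℝ) : IsOpen {z : Fin 4 → ℝ | z 0 < 2 * B ∨ z 0 - B < rad z} :=
  (isOpen_lt (continuous_apply 0) continuous_const).union
    (isOpen_lt ((continuous_apply 0).sub continuous_const) continuous_rad)

lemma ConeSupp.pd {B : ℝ} {f : (Fin 4 → ℝ) → ℝ} (hf : ContDiff ℝ (⊤ : ℕ∞) f)
    (h : ConeSupp B f) (i : Fin 4) : ConeSupp B (pd i f) :=
  ConeSupp.of_open (smooth_pd hf i).continuous
    (pd_eqOn_zero (isOpen_cone_compl B) (fun z hz => h z (hz.imp le_of_lt id)) i)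

lemma ConeSupp.opIter {B : ℝ} {f : (Fin 4 → ℝ) → ℝ} (hf : ContDiff ℝ (⊤ : ℕ∞) f)
    (h : ConeSupp B f) (L : List (Fin 10)) : ConeSupp B (opIter GammaField L f) :=
  ConeSupp.of_open (smooth_opIter hf L).continuous
    (opIter_eqOn_zero (isOpen_cone_compl B) (fun z hz => h z (hz.imp le_of_lt id)) L)

lemma abs_coord_le_rad (z : Fin 4 → ℝ) (k : Fin 3) : |z k.succ| ≤ rad z := by
  unfold rad
  apply Real.abs_le_sqrt
  fin_cases k <;> simp <;> nlinarith [sq_nonneg (z 1), sq_nonneg (z 2), sq_nonneg (z 3)]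

lemma ConeSupp.eq_zero {B : ℝ} {f : (Fin 4 → ℝ) → ℝ} (h : ConeSupp B f) (hB : 0 < B)
    {z : Fin 4 → ℝ} {k : Fin 3} (hk : z 0 ≤ |z k.succ|) : f z = 0 :=
  h z (Or.inr (by linarith [abs_coord_le_rad z k]))

lemma continuous_cons_right (τ : ℝ) :
    Continuous (fun x : Fin 3 → ℝ => (Fin.cons τ x : Fin 4 → ℝ)) := by
  refine continuous_pi fun i => ?_
  refine Fin.cases ?_ (fun k => ?_) i
  · simpa using continuous_const
  · simpa using continuous_apply k

lemma ConeSupp.hasCompactSupport {B : ℝ} {f : (Fin 4 → ℝ) → ℝ} (h : ConeSupp B f) (hB : 0 < B)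
    (τ : ℝ) : HasCompactSupport (fun x : Fin 3 → ℝ => f (Fin.cons τ x)) := by
  refine HasCompactSupport.intro (isCompact_Icc (a := fun _ => -τ) (b := fun _ => τ)) ?_
  intro x hx
  by_contra hne
  apply hx
  have : ∀ k : Fin 3, |x k| < τ := by
    intro k
    by_contra hk
    exact hne (h.eq_zero hB (z := Fin.cons τ x) (k := k) (by simpa using not_lt.1 hk))
  exact ⟨fun k => (abs_le.1 (this k).le).1, fun k => (abs_le.1 (this k).le).2⟩

lemma ConeSupp.integrable_sq {B : ℝ} {f : (Fin 4 → ℝ) → ℝ} (h : ConeSupp B f) (hB : 0 < B)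
    (hf : Continuous f) (τ : ℝ) : Integrable (fun x : Fin 3 → ℝ => (f (Fin.cons τ x)) ^ 2) := by
  refine Continuous.integrable_of_hasCompactSupport
    ((hf.comp (continuous_cons_right τ)).pow 2) ?_
  exact (h.hasCompactSupport hB τ).comp_left (g := fun y : ℝ => y ^ 2) (by simp)

lemma L2x_sq {f : (Fin 4 → ℝ) → ℝ} (τ : ℝ) :
    L2x f τ ^ 2 = ∫ x : Fin 3 → ℝ, (f (Fin.cons τ x)) ^ 2 :=
  Real.sq_sqrt (integral_nonneg fun _ => sq_nonneg _)

lemma L2x_nonneg (f : (Fin 4 → ℝ) → ℝ) (τ : ℝ) : 0 ≤ L2x f τ := Real.sqrt_nonneg _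

lemma ConeSupp.lintegral_sq {B : ℝ} {f : (Fin 4 → ℝ) → ℝ} (h : ConeSupp B f) (hB : 0 < B)
    (hf : Continuous f) (τ : ℝ) :
    (∫⁻ x : Fin 3 → ℝ, ‖f (Fin.cons τ x)‖ₑ ^ (2 : ℝ)) ^ (1 / (2 : ℝ)) =
      ENNReal.ofReal (L2x f τ) := by
  have h1 : ∫⁻ x : Fin 3 → ℝ, ‖f (Fin.cons τ x)‖ₑ ^ (2 : ℝ) = ENNReal.ofReal (L2x f τ ^ 2) := by
    rw [L2x_sq, ofReal_integral_eq_lintegral_ofReal (h.integrable_sq hB hf τ)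
      (Filter.Eventually.of_forall fun _ => sq_nonneg _)]
    refine lintegral_congr fun x => ?_
    rw [← ofReal_norm, ENNReal.ofReal_rpow_of_nonneg (norm_nonneg _) (by norm_num)]
    congr 1
    rw [Real.norm_eq_abs]
    norm_cast
    exact sq_abs _
  rw [h1, ENNReal.ofReal_rpow_of_nonneg (sq_nonneg _) (by norm_num), ← Real.sqrt_eq_rpow,
    Real.sqrt_sq (L2x_nonneg f τ)]

lemma ConeSupp.L2x_le {B : ℝ} {f : (Fin 4 → ℝ) → ℝ} (h : ConeSupp B f) (hB : 0 < B)
    (hf : Continuous f) (t : ℝ) : ∃ K : ℝ, 0 ≤ K ∧ ∀ τ ∈ Set.Icc (2 * B) t, L2x f τ ≤ K := by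
  obtain ⟨M, hM⟩ := (isCompact_Icc (a := fun _ : Fin 4 => -t) (b := fun _ => t)).exists_bound_of_continuousOn
    hf.continuousOn
  set V : ℝ := ∫ _x in Set.Icc (fun _ : Fin 3 => -t) (fun _ => t), M ^ 2
  have hV : 0 ≤ V := integral_nonneg fun _ => sq_nonneg _
  refine ⟨Real.sqrt V, Real.sqrt_nonneg _, fun τ hτ => Real.sqrt_le_sqrt ?_⟩
  have hzero : ∀ x, x ∉ Set.Icc (fun _ : Fin 3 => -t) (fun _ => t) → f (Fin.cons τ x) ^ 2 = 0 := by
    intro x hx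
    by_contra hne
    apply hx
    have : ∀ k : Fin 3, |x k| < τ := by
      intro k
      by_contra hk
      exact hne (by rw [h.eq_zero hB (z := Fin.cons τ x) (k := k) (by simpa using not_lt.1 hk)]; simp)
    exact ⟨fun k => by linarith [(abs_le.1 (this k).le).1, hτ.2],
      fun k => by linarith [(abs_le.1 (this k).le).2, hτ.2]⟩
  rw [← setIntegral_eq_integral_of_forall_compl_eq_zero hzero]
  refine setIntegral_mono_on (h.integrable_sq hB hf τ).integrableOn
    (integrableOn_const (by exact (isCompact_Icc.measure_lt_top).ne)) measurableSet_Icc ?_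
  intro x hx
  have hz := hM (Fin.cons τ x) ?_
  · rw [← sq_abs]
    exact pow_le_pow_left₀ (abs_nonneg _) hz 2
  · have h0 : 0 < τ := by linarith [hτ.1]
    constructor
    · intro i
      refine Fin.cases ?_ (fun k => ?_) i
      · simp; linarith [hτ.2]
      · simpa using hx.1 k
    · intro i
      refine Fin.cases ?_ (fun k => ?_) i
      · simpa using hτ.2
      · simpa using hx.2 k

/-! ### Divergence identity in a time slab -/

lemma divergence_slab {V : Fin 4 → (Fin 4 → ℝ) → ℝ} (hV : ∀ i, ContDiff ℝ 1 (V i))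
    {a b R : ℝ} (hab : a ≤ b) (hR : 0 ≤ R)
    (hs : ∀ z : Fin 4 → ℝ, a ≤ z 0 → z 0 ≤ b → (∃ k : Fin 3, R ≤ |z k.succ|) → ∀ i, V i z = 0) :
    (∫ x : Fin 3 → ℝ, V 0 (Fin.cons b x)) - ∫ x : Fin 3 → ℝ, V 0 (Fin.cons a x) =
      ∫ z in Set.Icc (Fin.cons a (fun _ => -R) : Fin 4 → ℝ) (Fin.cons b (fun _ => R)),
        ∑ i, pd i (V i) z := by
  set p : Fin 4 → ℝ := Fin.cons a (fun _ => -R)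
  set q : Fin 4 → ℝ := Fin.cons b (fun _ => R)
  have hpq : p ≤ q := by
    intro i
    refine Fin.cases ?_ (fun k => ?_) i
    · simpa [p, q] using hab
    · simp [p, q]; linarith
  have hcont : Continuous (fun z => ∑ i, pd i (V i) z) := by
    unfold pd
    refine continuous_finsetSum _ fun i _ => ?_
    exact ((hV i).continuous_fderiv (by norm_num)).clm_apply continuous_const
  have key := integral_divergence_of_hasFDerivAt_off_countable' p q hpq V
    (fun i z => fderiv ℝ (V i) z) ∅ Set.countable_empty (fun i => (hV i).continuous.continuousOn)
    (fun z _ i => ((hV i).differentiable (by norm_num) z).hasFDerivAt)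
    (hcont.continuousOn.integrableOn_compact isCompact_Icc)
  have hface : ∀ (c : ℝ), a ≤ c → c ≤ b →
      ∫ x in Set.Icc (p ∘ (0 : Fin 4).succAbove) (q ∘ (0 : Fin 4).succAbove),
        V 0 ((0 : Fin 4).insertNth c x) = ∫ x : Fin 3 → ℝ, V 0 (Fin.cons c x) := by
    intro c hac hcb
    have e : ∀ x : Fin 3 → ℝ, (0 : Fin 4).insertNth c x = (Fin.cons c x : Fin 4 → ℝ) := by
      intro x; exact Fin.insertNth_zero' c x
    simp only [e]
    refine setIntegral_eq_integral_of_forall_compl_eq_zero fun x hx => ?_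
    by_contra hne
    apply hx
    have : ∀ k : Fin 3, |x k| < R := by
      intro k
      by_contra hk
      exact hne (hs (Fin.cons c x) (by simpa using hac) (by simpa using hcb)
        ⟨k, by simpa using not_lt.1 hk⟩ 0)
    refine ⟨fun k => ?_, fun k => ?_⟩
    · simpa [p] using (abs_le.1 (this k).le).1
    · simpa [q] using (abs_le.1 (this k).le).2
  have hside : ∀ (k : Fin 3) (c : ℝ), R ≤ |c| →
      ∫ x in Set.Icc (p ∘ (k.succ : Fin 4).succAbove) (q ∘ (k.succ : Fin 4).succAbove),
        V k.succ ((k.succ : Fin 4).insertNth c x) = 0 := by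
    intro k c hc
    refine setIntegral_eq_zero_of_forall_eq_zero fun x hx => ?_
    have h0 : (k.succ.insertNth c x : Fin 4 → ℝ) 0 = x 0 := by
      have := Fin.insertNth_apply_succAbove (α := fun _ => ℝ) k.succ c x 0
      rwa [Fin.succ_succAbove_zero] at this
    have h1 := hx.1 0
    have h2 := hx.2 0
    simp only [Function.comp_apply, Fin.succ_succAbove_zero] at h1 h2
    refine hs _ (by rw [h0]; simpa [p] using h1) (by rw [h0]; simpa [q] using h2)
      ⟨k, by rw [Fin.insertNth_apply_same]; exact hc⟩ _
  rw [Fin.sum_univ_succ] at key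
  have hp0 : p 0 = a := rfl
  have hq0 : q 0 = b := rfl
  rw [hp0, hq0, hface a le_rfl hab, hface b hab le_rfl, Finset.sum_eq_zero, add_zero] at key
  · exact key.symm
  · intro k _
    have hpk : p k.succ = -R := by simp [p]
    have hqk : q k.succ = R := by simp [q]
    rw [hside k (q k.succ) (by rw [hqk]; exact le_abs_self _),
      hside k (p k.succ) (by rw [hpk, abs_neg]; exact le_abs_self _), sub_zero]

/-! ### Energy identities -/

/-- Twice the energy density of the Klein–Gordon equation. -/
def eDens (μ : ℝ) (u : (Fin 4 → ℝ) → ℝ) : (Fin 4 → ℝ) → ℝ := fun z =>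
  pd 0 u z * pd 0 u z + pd 1 u z * pd 1 u z + pd 2 u z * pd 2 u z + pd 3 u z * pd 3 u z
    + μ ^ 2 * (u z * u z)

lemma smooth_eDens {u : (Fin 4 → ℝ) → ℝ} (hu : ContDiff ℝ (⊤ : ℕ∞) u) (μ : ℝ) :
    ContDiff ℝ (⊤ : ℕ∞) (eDens μ u) := by
  have h := fun i => (smooth_pd hu i).mul (smooth_pd hu i)
  exact ((((h 0).add (h 1)).add (h 2)).add (h 3)).add (contDiff_const.mul (hu.mul hu))

/-- The energy current of the Klein–Gordon equation with weight `ψ`. -/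
def eCurrent (μ : ℝ) (ψ u : (Fin 4 → ℝ) → ℝ) (i : Fin 4) : (Fin 4 → ℝ) → ℝ :=
  if i = 0 then fun z => ψ z * eDens μ u z else fun z => ψ z * (-2 * (pd 0 u z * pd i u z))

lemma smooth_eCurrent {ψ u : (Fin 4 → ℝ) → ℝ} (hψ : ContDiff ℝ (⊤ : ℕ∞) ψ)
    (hu : ContDiff ℝ (⊤ : ℕ∞) u) (μ : ℝ) (i : Fin 4) :
    ContDiff ℝ (⊤ : ℕ∞) (eCurrent μ ψ u i) := by
  unfold eCurrent
  split_ifs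
  · exact hψ.mul (smooth_eDens hu μ)
  · exact hψ.mul (contDiff_const.mul ((smooth_pd hu 0).mul (smooth_pd hu i)))

lemma eCurrent_eq_zero {ψ u : (Fin 4 → ℝ) → ℝ} {μ : ℝ} {z : Fin 4 → ℝ} (h : ψ z = 0)
    (i : Fin 4) : eCurrent μ ψ u i z = 0 := by
  unfold eCurrent; split_ifs <;> simp [h]

lemma pd_eDens {u : (Fin 4 → ℝ) → ℝ} (hu : ContDiff ℝ (⊤ : ℕ∞) u) (μ : ℝ) (i : Fin 4)
    (z : Fin 4 → ℝ) : pd i (eDens μ u) z =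
      2 * (pd 0 u z * pd i (pd 0 u) z + pd 1 u z * pd i (pd 1 u) z + pd 2 u z * pd i (pd 2 u) z
        + pd 3 u z * pd i (pd 3 u) z + μ ^ 2 * (u z * pd i u z)) := by
  have h := fun i => smooth_pd hu i
  have hh := fun i => (smooth_pd hu i).mul (smooth_pd hu i)
  have d := fun i => smooth_differentiable (h i)
  unfold eDens
  rw [pd_add (smooth_differentiable ((((hh 0).add (hh 1)).add (hh 2)).add (hh 3)))
      (smooth_differentiable (contDiff_const.mul (hu.mul hu))),
    pd_add (smooth_differentiable (((hh 0).add (hh 1)).add (hh 2)))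
      (smooth_differentiable (hh 3)),
    pd_add (smooth_differentiable ((hh 0).add (hh 1))) (smooth_differentiable (hh 2)),
    pd_add (smooth_differentiable (hh 0)) (smooth_differentiable (hh 1)),
    pd_mul (d 0) (d 0), pd_mul (d 1) (d 1), pd_mul (d 2) (d 2), pd_mul (d 3) (d 3),
    pd_const_mul (smooth_differentiable (hu.mul hu)),
    pd_mul (smooth_differentiable hu) (smooth_differentiable hu)]
  ring

lemma sum_pd_eCurrent {ψ u : (Fin 4 → ℝ) → ℝ} (hψ : ContDiff ℝ (⊤ : ℕ∞) ψ)
    (hu : ContDiff ℝ (⊤ : ℕ∞) u) (μ : ℝ) (z : Fin 4 → ℝ) :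
    ∑ i, pd i (eCurrent μ ψ u i) z = 2 * (ψ z * (pd 0 u z * KG μ u z)) +
      (pd 0 ψ z * eDens μ u z -
        2 * pd 0 u z * (pd 1 ψ z * pd 1 u z + pd 2 ψ z * pd 2 u z + pd 3 ψ z * pd 3 u z)) := by
  have dψ := smooth_differentiable hψ
  have d := fun i => smooth_differentiable (smooth_pd hu i)
  have e0 : pd 0 (eCurrent μ ψ u 0) z = pd 0 ψ z * eDens μ u z + ψ z * pd 0 (eDens μ u) z := by
    unfold eCurrent
    rw [if_pos rfl, pd_mul dψ (smooth_differentiable (smooth_eDens hu μ))]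
  have ek : ∀ i : Fin 4, i ≠ 0 → pd i (eCurrent μ ψ u i) z =
      pd i ψ z * (-2 * (pd 0 u z * pd i u z)) +
        ψ z * (-2 * (pd 0 (pd i u) z * pd i u z + pd 0 u z * pd i (pd i u) z)) := by
    intro i hi
    unfold eCurrent
    have hm := (smooth_pd hu 0).mul (smooth_pd hu i)
    rw [if_neg hi, pd_mul dψ (smooth_differentiable (contDiff_const.mul hm)),
      pd_const_mul (smooth_differentiable hm), pd_mul (d 0) (d i), pd_comm hu i 0]
  rw [Fin.sum_univ_four, e0, ek 1 (by decide), ek 2 (by decide), ek 3 (by decide), pd_eDens hu]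
  unfold KG Box
  ring

/-- The function `(T-t)² - |x-x₀|²` attached to a backward light cone. -/
def coneFn (p : Fin 4 → ℝ) : (Fin 4 → ℝ) → ℝ := fun z =>
  (p 0 - z 0) ^ 2 - ((z 1 - p 1) ^ 2 + (z 2 - p 2) ^ 2 + (z 3 - p 3) ^ 2)

lemma smooth_coneFn (p : Fin 4 → ℝ) : ContDiff ℝ (⊤ : ℕ∞) (coneFn p) := by
  have h := fun i : Fin 4 => smooth_coord (n := 4) i
  exact ((contDiff_const.sub (h 0)).pow 2).sub
    (((((h 1).sub contDiff_const).pow 2).add (((h 2).sub contDiff_const).pow 2)).add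
      (((h 3).sub contDiff_const).pow 2))

lemma pd_coneFn (p : Fin 4 → ℝ) (i : Fin 4) (z : Fin 4 → ℝ) :
    pd i (coneFn p) z = (if i = 0 then -2 else 2) * (p i - z i) := by
  have h := fun i : Fin 4 => (hasFDerivAt_apply (𝕜 := ℝ) i z)
  have := ((((h 0).const_sub (p 0)).pow 2).sub
    (((((h 1).sub_const (p 1)).pow 2).add (((h 2).sub_const (p 2)).pow 2)).add
      (((h 3).sub_const (p 3)).pow 2)))
  have hc : pd i (coneFn p) z = _ := congrArg (fun L => L (Pi.single i 1)) this.fderiv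
  rw [hc]
  fin_cases i <;> simp <;> ring

lemma pd_comp_real {φ : ℝ → ℝ} {q : (Fin 4 → ℝ) → ℝ} (hφ : Differentiable ℝ φ)
    (hq : Differentiable ℝ q) (i : Fin 4) (z : Fin 4 → ℝ) :
    pd i (fun z => φ (q z)) z = deriv φ (q z) * pd i q z := by
  change fderiv ℝ (φ ∘ q) z (Pi.single i 1) = deriv φ (q z) * fderiv ℝ q z (Pi.single i 1)
  rw [((hφ (q z)).hasDerivAt.comp_hasFDerivAt z (hq z).hasFDerivAt).fderiv]
  simp

lemma timelike_pairing {d v1 v2 v3 a g1 g2 g3 m : ℝ} (hd : 0 ≤ d)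
    (hv : v1 ^ 2 + v2 ^ 2 + v3 ^ 2 ≤ d ^ 2) (hm : 0 ≤ m) :
    0 ≤ d * (a * a + g1 * g1 + g2 * g2 + g3 * g3 + m)
      + 2 * a * (v1 * g1 + v2 * g2 + v3 * g3) := by
  have h1 : |v1 * g1 + v2 * g2 + v3 * g3| ≤ d * Real.sqrt (g1 ^ 2 + g2 ^ 2 + g3 ^ 2) := by
    apply abs_le_of_sq_le_sq _ (by positivity)
    rw [mul_pow, Real.sq_sqrt (by positivity)]
    nlinarith [sq_nonneg (v1 * g2 - v2 * g1), sq_nonneg (v1 * g3 - v3 * g1),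
      sq_nonneg (v2 * g3 - v3 * g2), mul_le_mul_of_nonneg_right hv
        (show 0 ≤ g1 ^ 2 + g2 ^ 2 + g3 ^ 2 by positivity)]
  set G := Real.sqrt (g1 ^ 2 + g2 ^ 2 + g3 ^ 2)
  have hG : G ^ 2 = g1 ^ 2 + g2 ^ 2 + g3 ^ 2 := Real.sq_sqrt (by positivity)
  have h2 : |a * (v1 * g1 + v2 * g2 + v3 * g3)| ≤ |a| * (d * G) := by
    rw [abs_mul]; exact mul_le_mul_of_nonneg_left h1 (abs_nonneg _)
  have h3 := (abs_le.1 h2).1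
  have h4 : 0 ≤ d * (|a| - G) ^ 2 := by positivity
  have h5 : |a| ^ 2 = a ^ 2 := sq_abs a
  have h6 : 0 ≤ d * m := by positivity
  nlinarith

lemma deriv_expNegInvGlue_nonneg (x : ℝ) : 0 ≤ deriv expNegInvGlue x :=
  expNegInvGlue.monotone.deriv_nonneg

/-- Finite propagation speed in a backward light cone. -/
lemma eq_zero_of_backward_cone {μ : ℝ} (hμ : 1 ≤ μ) {w : (Fin 4 → ℝ) → ℝ}
    (hw : ContDiff ℝ (⊤ : ℕ∞) w) {a : ℝ} (h0 : ∀ z : Fin 4 → ℝ, z 0 ≤ a → w z = 0)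
    {p : Fin 4 → ℝ} {b : ℝ} (hab : a ≤ b) (hb : b < p 0)
    (hF : ∀ z : Fin 4 → ℝ, z 0 ≤ b → 0 < coneFn p z → KG μ w z = 0) :
    w (Fin.cons b (fun k => p k.succ)) = 0 := by
  set ψ : (Fin 4 → ℝ) → ℝ := fun z => expNegInvGlue (coneFn p z) with hψdef
  have hφ : Differentiable ℝ expNegInvGlue :=
    (expNegInvGlue.contDiff (n := 1)).differentiable (by norm_num)
  have hψ : ContDiff ℝ (⊤ : ℕ∞) ψ := expNegInvGlue.contDiff.comp (smooth_coneFn p)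
  have hψ0 : ∀ z, 0 ≤ ψ z := fun z => expNegInvGlue.nonneg _
  set M : ℝ := |p 1| + |p 2| + |p 3| with hM
  set R : ℝ := M + (p 0 - a) with hRdef
  have hM1 : |p 1| ≤ M := by rw [hM]; linarith [abs_nonneg (p 2), abs_nonneg (p 3)]
  have hM2 : |p 2| ≤ M := by rw [hM]; linarith [abs_nonneg (p 1), abs_nonneg (p 3)]
  have hM3 : |p 3| ≤ M := by rw [hM]; linarith [abs_nonneg (p 2), abs_nonneg (p 1)]
  have hR : 0 ≤ R := by have := abs_nonneg (p 1); linarith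
  have hs : ∀ z : Fin 4 → ℝ, a ≤ z 0 → z 0 ≤ b → (∃ k : Fin 3, R ≤ |z k.succ|) →
      ∀ i, eCurrent μ ψ w i z = 0 := by
    rintro z ha hb' ⟨k, hk⟩ i
    refine eCurrent_eq_zero ?_ i
    refine expNegInvGlue.zero_of_nonpos ?_
    have hbig : (p 0 - z 0) ^ 2 ≤ (z k.succ - p k.succ) ^ 2 := by
      rw [sq_le_sq, abs_of_nonneg (by linarith : (0:ℝ) ≤ p 0 - z 0)]
      have h1 : |p k.succ| ≤ M := by fin_cases k <;> assumption
      have h2 := abs_sub_abs_le_abs_sub (z k.succ) (p k.succ)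
      linarith
    unfold coneFn
    fin_cases k <;> simp at hbig <;>
      nlinarith [sq_nonneg (z 1 - p 1), sq_nonneg (z 2 - p 2), sq_nonneg (z 3 - p 3)]
  have hdiv := divergence_slab (V := eCurrent μ ψ w)
    (fun i => (smooth_eCurrent hψ hw μ i).of_le (by norm_cast)) hab hR hs
  have hle : ∫ z in Set.Icc (Fin.cons a (fun _ => -R) : Fin 4 → ℝ) (Fin.cons b (fun _ => R)),
        ∑ i, pd i (eCurrent μ ψ w i) z ≤ 0 := by
    refine setIntegral_nonpos measurableSet_Icc fun z hz => ?_
    have hzb : z 0 ≤ b := by simpa using hz.2 0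
    rw [sum_pd_eCurrent hψ hw, hψdef]
    simp only
    rw [pd_comp_real hφ (smooth_differentiable (smooth_coneFn p)),
      pd_comp_real hφ (smooth_differentiable (smooth_coneFn p)),
      pd_comp_real hφ (smooth_differentiable (smooth_coneFn p)),
      pd_comp_real hφ (smooth_differentiable (smooth_coneFn p)),
      pd_coneFn, pd_coneFn, pd_coneFn, pd_coneFn]
    have hfirst : expNegInvGlue (coneFn p z) * (pd 0 w z * KG μ w z) = 0 := by
      rcases le_or_gt (coneFn p z) 0 with h | h
      · rw [expNegInvGlue.zero_of_nonpos h, zero_mul]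
      · rw [hF z hzb h]; ring
    rw [hfirst]
    set D := deriv expNegInvGlue (coneFn p z) with hD
    have hD0 : 0 ≤ D := deriv_expNegInvGlue_nonneg _
    rcases lt_or_ge (coneFn p z) 0 with h | h
    · have : D = 0 := by
        have he : expNegInvGlue =ᶠ[nhds (coneFn p z)] fun _ => 0 := by
          filter_upwards [Iio_mem_nhds h] with y hy
          exact expNegInvGlue.zero_of_nonpos (le_of_lt hy)
        rw [hD, he.deriv_eq]; simp
      rw [this]; simp
    · have hcone : (p 1 - z 1) ^ 2 + (p 2 - z 2) ^ 2 + (p 3 - z 3) ^ 2 ≤ (p 0 - z 0) ^ 2 := by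
        unfold coneFn at h; nlinarith
      have := timelike_pairing (a := pd 0 w z) (g1 := pd 1 w z) (g2 := pd 2 w z)
        (g3 := pd 3 w z) (m := μ ^ 2 * (w z * w z)) (by linarith : (0:ℝ) ≤ p 0 - z 0) hcone
        (mul_nonneg (sq_nonneg _) (mul_self_nonneg _))
      have h2 := mul_nonneg hD0 this
      unfold eDens
      simp
      nlinarith
  have hzero_a : ∫ x : Fin 3 → ℝ, eCurrent μ ψ w 0 (Fin.cons a x) = 0 := by
    have : ∀ z : Fin 4 → ℝ, z 0 ≤ a → eCurrent μ ψ w 0 z = 0 := by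
      intro z hz
      have hpd : ∀ i, pd i w z = 0 := fun i =>
        eq_zero_of_time_le (smooth_pd hw i).continuous
          (pd_eqOn_zero (isOpen_lt (continuous_apply 0) continuous_const)
            (fun z hz => h0 z (le_of_lt hz)) i) hz
      simp [eCurrent, eDens, hpd, h0 z hz]
    simp [this]
  have hc : Continuous (fun x : Fin 3 → ℝ => eCurrent μ ψ w 0 (Fin.cons b x)) :=
    (smooth_eCurrent hψ hw μ 0).continuous.comp (continuous_cons_right b)
  have hed : ∀ z, μ ^ 2 * (w z * w z) ≤ eDens μ w z := fun z => by
    unfold eDens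
    nlinarith [mul_self_nonneg (pd 0 w z), mul_self_nonneg (pd 1 w z), mul_self_nonneg (pd 2 w z),
      mul_self_nonneg (pd 3 w z)]
  have hnn : 0 ≤ fun x : Fin 3 → ℝ => eCurrent μ ψ w 0 (Fin.cons b x) := by
    intro x
    simp only [eCurrent, if_true]
    exact mul_nonneg (hψ0 _) (le_trans (mul_nonneg (sq_nonneg _) (mul_self_nonneg _)) (hed _))
  have hint : Integrable (fun x : Fin 3 → ℝ => eCurrent μ ψ w 0 (Fin.cons b x)) := by
    refine hc.integrable_of_hasCompactSupport
      (HasCompactSupport.intro (isCompact_Icc (a := fun _ => -R) (b := fun _ => R)) ?_)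
    intro x hx
    by_contra hne
    apply hx
    have : ∀ k : Fin 3, |x k| < R := by
      intro k
      by_contra hk
      exact hne (hs (Fin.cons b x) (by simpa using hab) (by simp)
        ⟨k, by simpa using not_lt.1 hk⟩ 0)
    exact ⟨fun k => (abs_le.1 (this k).le).1, fun k => (abs_le.1 (this k).le).2⟩
  have hI : ∫ x : Fin 3 → ℝ, eCurrent μ ψ w 0 (Fin.cons b x) = 0 :=
    le_antisymm (by linarith) (integral_nonneg hnn)
  have hall := (Continuous.ae_eq_iff_eq volume hc continuous_zero).1
    ((integral_eq_zero_iff_of_nonneg hnn hint).1 hI)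
  have hpt := congrFun hall (fun k => p k.succ)
  set z : Fin 4 → ℝ := Fin.cons b (fun k => p k.succ) with hz
  have hq : 0 < coneFn p z := by
    have : coneFn p z = (p 0 - b) ^ 2 := by
      simp only [coneFn, hz]
      have e1 : (Fin.cons b (fun k : Fin 3 => p k.succ) : Fin 4 → ℝ) 1 = p 1 := rfl
      have e2 : (Fin.cons b (fun k : Fin 3 => p k.succ) : Fin 4 → ℝ) 2 = p 2 := rfl
      have e3 : (Fin.cons b (fun k : Fin 3 => p k.succ) : Fin 4 → ℝ) 3 = p 3 := rfl
      rw [e1, e2, e3]; simp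
    rw [this]; have : 0 < p 0 - b := by linarith
    positivity
  have hψz : 0 < ψ z := expNegInvGlue.pos_of_pos hq
  have hprod : ψ z * eDens μ w z = 0 := by simpa [eCurrent] using hpt
  have he : eDens μ w z = 0 := (mul_eq_zero.1 hprod).resolve_left hψz.ne'
  have h1 := hed z
  rw [he] at h1
  have hμ2 : (1:ℝ) ≤ μ ^ 2 := by nlinarith
  have h2 : w z * w z ≤ 0 := by
    nlinarith [mul_le_mul_of_nonneg_right hμ2 (mul_self_nonneg (w z))]
  exact mul_self_eq_zero.1 (le_antisymm h2 (mul_self_nonneg _))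

lemma coneSupp_of_KG {μ B : ℝ} (hμ : 1 ≤ μ) {w : (Fin 4 → ℝ) → ℝ}
    (hw : ContDiff ℝ (⊤ : ℕ∞) w) (h0 : ∀ z : Fin 4 → ℝ, z 0 ≤ 2 * B → w z = 0)
    (hF : ∀ z : Fin 4 → ℝ, rad z > z 0 - B → KG μ w z = 0) : ConeSupp B w := by
  rintro z (hz | hz)
  · exact h0 z hz
  rcases le_or_gt (z 0) (2 * B) with hz0 | hz0
  · exact h0 z hz0
  set δ := (rad z - z 0 + B) / 2 with hδ
  have hδ0 : 0 < δ := by rw [hδ]; linarith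
  set p : Fin 4 → ℝ := Fin.cons (z 0 + δ) (fun k => z k.succ) with hp
  have hp0 : p 0 = z 0 + δ := rfl
  have hp1 : p 1 = z 1 := rfl
  have hp2 : p 2 = z 2 := rfl
  have hp3 : p 3 = z 3 := rfl
  have hzz : (Fin.cons (z 0) (fun k : Fin 3 => p k.succ) : Fin 4 → ℝ) = z := by
    ext i; refine Fin.cases ?_ (fun k => ?_) i <;> simp [hp]
  rw [← hzz]
  refine eq_zero_of_backward_cone hμ hw h0 hz0.le (by rw [hp0]; linarith) ?_
  intro z' hz' hc
  apply hF
  unfold coneFn at hc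
  rw [hp0, hp1, hp2, hp3] at hc
  have hr : rad z ^ 2 = z 1 ^ 2 + z 2 ^ 2 + z 3 ^ 2 := Real.sq_sqrt (by positivity)
  have hr' : rad z' ^ 2 = z' 1 ^ 2 + z' 2 ^ 2 + z' 3 ^ 2 := Real.sq_sqrt (by positivity)
  have hn : 0 ≤ rad z := Real.sqrt_nonneg _
  have hn' : 0 ≤ rad z' := Real.sqrt_nonneg _
  have hcs : z 1 * z' 1 + z 2 * z' 2 + z 3 * z' 3 ≤ rad z * rad z' := by
    refine le_trans (le_abs_self _) (abs_le_of_sq_le_sq ?_ (by positivity))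
    rw [mul_pow, hr, hr']
    nlinarith [sq_nonneg (z 1 * z' 2 - z 2 * z' 1), sq_nonneg (z 1 * z' 3 - z 3 * z' 1),
      sq_nonneg (z 2 * z' 3 - z 3 * z' 2)]
  have hd : rad z - rad z' < z 0 + δ - z' 0 := by
    refine lt_of_abs_lt (abs_lt_of_sq_lt_sq ?_ (by linarith))
    nlinarith
  linarith

lemma coneSupp_KG {μ B : ℝ} {w : (Fin 4 → ℝ) → ℝ}
    (hw : ContDiff ℝ (⊤ : ℕ∞) w) (h : ConeSupp B w) : ConeSupp B (KG μ w) := by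
  intro z hz
  have hp := fun i => ((h.pd hw i).pd (smooth_pd hw i) i) z hz
  simp [KG, Box, hp, h z hz]

lemma lintegral_fin_cons {n : ℕ} {G : (Fin (n + 1) → ℝ) → ENNReal} (hG : Measurable G) :
    ∫⁻ z, G z = ∫⁻ a : ℝ, ∫⁻ v : Fin n → ℝ, G (Fin.cons a v) := by
  have e := (volume_preserving_piFinSuccAbove (fun _ : Fin (n + 1) => ℝ) 0).symm
  rw [← e.lintegral_comp hG, Measure.volume_eq_prod]
  have hc : ∀ (a : ℝ) (v : Fin n → ℝ),
      (MeasurableEquiv.piFinSuccAbove (fun _ : Fin (n + 1) => ℝ) 0).symm (a, v) = Fin.cons a v :=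
    fun a v => Fin.insertNth_zero' a v
  simp only [← hc]
  exact lintegral_prod (μ := (volume : Measure ℝ)) (ν := (volume : Measure (Fin n → ℝ)))
    _ ((hG.comp e.measurable).aemeasurable)

lemma ConeSupp.lintegral_mul_le {B : ℝ} (hB : 0 < B) {f g : (Fin 4 → ℝ) → ℝ}
    (hf : ConeSupp B f) (hg : ConeSupp B g) (hfc : Continuous f) (hgc : Continuous g) (τ : ℝ) :
    ∫⁻ x : Fin 3 → ℝ, ‖f (Fin.cons τ x) * g (Fin.cons τ x)‖ₑ ≤
      ENNReal.ofReal (L2x f τ) * ENNReal.ofReal (L2x g τ) := by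
  have hm : ∀ {f : (Fin 4 → ℝ) → ℝ}, Continuous f →
      AEMeasurable (fun x : Fin 3 → ℝ => ‖f (Fin.cons τ x)‖ₑ) volume := fun hf =>
    (hf.comp (continuous_cons_right τ)).enorm.measurable.aemeasurable
  rw [← hf.lintegral_sq hB hfc, ← hg.lintegral_sq hB hgc]
  have := ENNReal.lintegral_mul_le_Lp_mul_Lq (volume : Measure (Fin 3 → ℝ))
    (Real.HolderConjugate.two_two) (hm hfc) (hm hgc)
  simpa [enorm_mul] using this

/-- The energy inequality. -/
lemma L2x_le_of_lintegral_KG {μ B : ℝ} (hμ : 1 ≤ μ) (hB : 0 < B) {u : (Fin 4 → ℝ) → ℝ}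
    (hu : ContDiff ℝ (⊤ : ℕ∞) u) (h : ConeSupp B u) {t K : ℝ} (hK : 0 ≤ K)
    (hint : ∫⁻ τ in Set.Icc (2 * B) t, ENNReal.ofReal (L2x (KG μ u) τ) ≤ ENNReal.ofReal K)
    {s : ℝ} (hs : s ∈ Set.Icc (2 * B) t) : L2x u s ≤ 2 * K := by
  have hsm := smooth_pd hu
  have hF := smooth_KG hu μ
  have hFs : ConeSupp B (KG μ u) := coneSupp_KG hu h
  have hus := fun i => h.pd hu i
  have hmain : ∀ S : ℝ, 0 ≤ S → (∀ τ ∈ Set.Icc (2 * B) t, L2x (pd 0 u) τ ≤ S) →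
      ∀ s ∈ Set.Icc (2 * B) t, ∫ x : Fin 3 → ℝ, eDens μ u (Fin.cons s x) ≤ 2 * (S * K) := by
    intro S hS0 hS s hs
    have hone : ContDiff ℝ (⊤ : ℕ∞) (fun _ : Fin 4 → ℝ => (1:ℝ)) := contDiff_const
    have hdiv := divergence_slab (V := eCurrent μ (fun _ => 1) u)
      (fun i => (smooth_eCurrent hone hu μ i).of_le (by norm_cast)) (a := 2 * B) (b := s)
      (R := s) hs.1 (by linarith [hs.1]) ?_
    · have hz : ∀ x : Fin 3 → ℝ, eCurrent μ (fun _ => 1) u 0 (Fin.cons (2 * B) x) = 0 := by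
        intro x
        have hx : ((Fin.cons (2 * B) x : Fin 4 → ℝ) 0 ≤ 2 * B ∨
          (Fin.cons (2 * B) x : Fin 4 → ℝ) 0 - B < rad (Fin.cons (2 * B) x)) := Or.inl (by simp)
        have := fun i => hus i _ hx
        simp [eCurrent, eDens, this, h _ hx]
      have hd : ∀ z, ∑ i, pd i (eCurrent μ (fun _ => 1) u i) z = 2 * (pd 0 u z * KG μ u z) := by
        intro z
        rw [sum_pd_eCurrent hone hu]
        have : ∀ i, pd i (fun _ : Fin 4 → ℝ => (1:ℝ)) z = 0 := fun i => by simp [pd]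
        simp [this]
      have h0 : ∀ z, eCurrent μ (fun _ => 1) u 0 z = eDens μ u z := fun z => by simp [eCurrent]
      simp only [hz, hd] at hdiv
      simp only [h0, integral_zero, sub_zero] at hdiv
      rw [hdiv]
      set A := Set.Icc (Fin.cons (2 * B) (fun _ => -s) : Fin 4 → ℝ) (Fin.cons s (fun _ => s))
      set g : (Fin 4 → ℝ) → ℝ := fun z => pd 0 u z * KG μ u z with hg
      have hgc : Continuous g := (hsm 0).continuous.mul hF.continuous
      rw [integral_const_mul]
      refine mul_le_mul_of_nonneg_left ?_ (by norm_num)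
      refine le_trans (le_abs_self _) ?_
      rw [← Real.norm_eq_abs, ← ENNReal.ofReal_le_ofReal_iff (by positivity), ofReal_norm]
      refine le_trans (enorm_integral_le_lintegral_enorm _) ?_
      have hAs : A ⊆ {z | z 0 ∈ Set.Icc (2 * B) t} := by
        intro z hz
        exact ⟨by simpa using hz.1 0, le_trans (by simpa using hz.2 0) hs.2⟩
      refine le_trans (lintegral_mono_set hAs) ?_
      have hmS : MeasurableSet {z : Fin 4 → ℝ | z 0 ∈ Set.Icc (2 * B) t} :=
        measurable_pi_apply 0 measurableSet_Icc
      rw [← lintegral_indicator hmS, lintegral_fin_cons (hgc.enorm.measurable.indicator hmS)]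
      have hin : ∀ a : ℝ, ∫⁻ v : Fin 3 → ℝ,
          ({z : Fin 4 → ℝ | z 0 ∈ Set.Icc (2 * B) t}.indicator (fun z => ‖g z‖ₑ)) (Fin.cons a v)
          ≤ (Set.Icc (2 * B) t).indicator
            (fun τ => ENNReal.ofReal S * ENNReal.ofReal (L2x (KG μ u) τ)) a := by
        intro a
        by_cases ha : a ∈ Set.Icc (2 * B) t
        · rw [Set.indicator_of_mem ha]
          have : ∀ v : Fin 3 → ℝ, ({z : Fin 4 → ℝ | z 0 ∈ Set.Icc (2 * B) t}.indicator
              (fun z => ‖g z‖ₑ)) (Fin.cons a v) = ‖g (Fin.cons a v)‖ₑ := fun v =>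
            Set.indicator_of_mem (by simpa using ha) _
          simp only [this]
          refine le_trans (ConeSupp.lintegral_mul_le hB (hus 0) hFs (hsm 0).continuous
            hF.continuous a) ?_
          gcongr
          exact hS a ha
        · rw [Set.indicator_of_notMem ha]
          have : ∀ v : Fin 3 → ℝ, ({z : Fin 4 → ℝ | z 0 ∈ Set.Icc (2 * B) t}.indicator
              (fun z => ‖g z‖ₑ)) (Fin.cons a v) = 0 := fun v =>
            Set.indicator_of_notMem (by simpa using ha) _
          simp only [this, lintegral_zero, le_refl]
      refine le_trans (lintegral_mono hin) ?_
      rw [lintegral_indicator measurableSet_Icc, lintegral_const_mul' _ _ ENNReal.ofReal_ne_top,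
        ENNReal.ofReal_mul hS0]
      gcongr
    · rintro z hz0 hz1 ⟨k, hk⟩ i
      have hzz : z 0 ≤ |z k.succ| := le_trans hz1 hk
      have hp := fun i => (hus i).eq_zero hB hzz
      unfold eCurrent eDens
      split_ifs <;> simp [hp, h.eq_zero hB hzz]
  have hedI : ∀ s, ∀ f : (Fin 4 → ℝ) → ℝ, ConeSupp B f → Continuous f →
      (∀ z, f z ^ 2 ≤ eDens μ u z) → L2x f s ^ 2 ≤ ∫ x : Fin 3 → ℝ, eDens μ u (Fin.cons s x) := by
    intro s f hf hfc hle
    rw [L2x_sq]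
    refine integral_mono (hf.integrable_sq hB hfc s) ?_ fun x => hle _
    have hi := fun i => (hus i).integrable_sq hB (hsm i).continuous s
    have := ((((hi 0).add (hi 1)).add (hi 2)).add (hi 3)).add
      ((h.integrable_sq hB hu.continuous s).const_mul (μ ^ 2))
    refine this.congr (Filter.Eventually.of_forall fun x => ?_)
    simp [eDens]; ring
  have hμ2 : (1:ℝ) ≤ μ ^ 2 := by nlinarith
  have hle0 : ∀ z, pd 0 u z ^ 2 ≤ eDens μ u z := fun z => by
    unfold eDens
    nlinarith [mul_self_nonneg (pd 1 u z), mul_self_nonneg (pd 2 u z), mul_self_nonneg (pd 3 u z),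
      mul_nonneg (sq_nonneg μ) (mul_self_nonneg (u z))]
  have hle1 : ∀ z, u z ^ 2 ≤ eDens μ u z := fun z => by
    unfold eDens
    nlinarith [mul_self_nonneg (pd 1 u z), mul_self_nonneg (pd 2 u z), mul_self_nonneg (pd 3 u z),
      mul_self_nonneg (pd 0 u z), mul_le_mul_of_nonneg_right hμ2 (mul_self_nonneg (u z))]
  obtain ⟨K0, hK0, hbd⟩ := (hus 0).L2x_le hB (hsm 0).continuous t
  set S := sSup (L2x (pd 0 u) '' Set.Icc (2 * B) t) with hSdef
  have hba : BddAbove (L2x (pd 0 u) '' Set.Icc (2 * B) t) :=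
    ⟨K0, by rintro _ ⟨τ, hτ, rfl⟩; exact hbd τ hτ⟩
  have hSle : ∀ τ ∈ Set.Icc (2 * B) t, L2x (pd 0 u) τ ≤ S := fun τ hτ =>
    le_csSup hba ⟨τ, hτ, rfl⟩
  have hS0 : 0 ≤ S := le_trans (L2x_nonneg _ s) (hSle s hs)
  have hE := hmain S hS0 hSle
  have hS2 : S ≤ Real.sqrt (2 * (S * K)) := by
    refine csSup_le ⟨_, s, hs, rfl⟩ ?_
    rintro _ ⟨τ, hτ, rfl⟩
    exact Real.le_sqrt_of_sq_le
      ((hedI τ _ (hus 0) (hsm 0).continuous hle0).trans (hE τ hτ))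
  have hS3 : S ^ 2 ≤ 2 * (S * K) := by
    have := pow_le_pow_left₀ hS0 hS2 2
    rwa [Real.sq_sqrt (by positivity)] at this
  have hS4 : S ≤ 2 * K := by
    rcases hS0.eq_or_lt with h0 | h0
    · rw [← h0]; positivity
    · nlinarith
  have h5 := (hedI s _ h hu.continuous hle1).trans (hE s hs)
  exact abs_le_of_sq_le_sq' (by nlinarith) (by positivity) |>.2

/-! ### The dyadic sum -/

lemma lintegral_one_sub_div_rpow {t : ℝ} (ht : 0 < t) :
    ∫⁻ τ in Set.Ioo 0 t, ENNReal.ofReal ((1 - τ / t) ^ (-(3:ℝ) / 4)) = ENNReal.ofReal (4 * t) := by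
  set f : ℝ → ℝ := fun τ => -(4 * t) * (1 - τ / t) ^ ((1:ℝ) / 4) with hf
  have hc : ContinuousOn f (Set.Icc 0 t) := by
    apply Continuous.continuousOn
    exact continuous_const.mul ((by fun_prop : Continuous fun τ : ℝ => 1 - τ / t).rpow_const
      (fun _ => Or.inr (by norm_num)))
  have hpos : ∀ τ ∈ Set.Ioo 0 t, 0 < 1 - τ / t := fun τ hτ => by
    rw [sub_pos, div_lt_one ht]; exact hτ.2
  have hd : ∀ τ ∈ Set.Ioo 0 t, HasDerivAt f ((1 - τ / t) ^ (-(3:ℝ) / 4)) τ := by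
    intro τ hτ
    have h1 : HasDerivAt (fun τ : ℝ => 1 - τ / t) (-(1 / t)) τ := by
      simpa using ((hasDerivAt_id τ).div_const t).const_sub 1
    have h2 := (h1.rpow_const (p := (1:ℝ) / 4) (Or.inl (hpos τ hτ).ne')).const_mul (-(4 * t))
    refine h2.congr_deriv ?_
    rw [show (1:ℝ) / 4 - 1 = -3 / 4 by norm_num]
    generalize (1 - τ / t) ^ (-(3:ℝ) / 4) = A
    field_simp
  have hn : ∀ τ ∈ Set.Ioo 0 t, 0 ≤ (1 - τ / t) ^ (-(3:ℝ) / 4) := fun τ hτ =>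
    Real.rpow_nonneg (hpos τ hτ).le _
  have hi : IntegrableOn (fun τ => (1 - τ / t) ^ (-(3:ℝ) / 4)) (Set.Ioc 0 t) :=
    intervalIntegral.integrableOn_deriv_of_nonneg hc hd hn
  have hI := intervalIntegral.integral_eq_sub_of_hasDerivAt_of_le ht.le hc hd
    ((intervalIntegrable_iff_integrableOn_Ioc_of_le ht.le).2 hi)
  rw [intervalIntegral.integral_of_le ht.le] at hI
  rw [← ofReal_integral_eq_lintegral_ofReal (hi.mono_set Set.Ioo_subset_Ioc_self)
    ((ae_restrict_iff' measurableSet_Ioo).2 (Filter.Eventually.of_forall hn)),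
    ← integral_Ioc_eq_integral_Ioo, hI]
  congr 1
  simp [hf, ht.ne']

lemma one_sub_div_rpow_le_two {t τ : ℝ} (ht : 0 < t) (h : 2 * τ ≤ t) :
    (1 - τ / t) ^ (-(3:ℝ) / 4) ≤ 2 := by
  have h1 : 1 / 2 ≤ 1 - τ / t := by
    have : τ / t ≤ 1 / 2 := by rw [div_le_div_iff₀ ht (by norm_num)]; linarith
    linarith
  calc (1 - τ / t) ^ (-(3:ℝ) / 4) ≤ (1 / 2) ^ (-(3:ℝ) / 4) :=
        Real.rpow_le_rpow_of_nonpos (by norm_num) h1 (by norm_num)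
    _ = 2 ^ ((3:ℝ) / 4) := by
        rw [one_div, Real.inv_rpow (by norm_num), ← Real.rpow_neg (by norm_num)]; norm_num
    _ ≤ 2 ^ (1:ℝ) := Real.rpow_le_rpow_of_exponent_le (by norm_num) (by norm_num)
    _ = 2 := by norm_num

lemma lintegral_weight_dyadic {t q : ℝ} (ht : 0 < t) (hq : 0 < q) :
    ∫⁻ τ in Set.Ico q (2 * q) ∩ Set.Ioo 0 t, ENNReal.ofReal ((1 - τ / t) ^ (-(3:ℝ) / 4)) ≤
      ENNReal.ofReal (16 * q) := by
  rcases le_or_gt (4 * q) t with h | h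
  · calc _ ≤ ∫⁻ τ in Set.Ico q (2 * q) ∩ Set.Ioo 0 t, ENNReal.ofReal 2 := by
          refine setLIntegral_mono measurable_const fun τ hτ => ?_
          exact ENNReal.ofReal_le_ofReal
            (one_sub_div_rpow_le_two ht (by linarith [hτ.1.2]))
      _ ≤ ∫⁻ τ in Set.Ico q (2 * q), ENNReal.ofReal 2 := lintegral_mono_set Set.inter_subset_left
      _ = ENNReal.ofReal (2 * q) := by
          rw [setLIntegral_const, Real.volume_Ico, ← ENNReal.ofReal_mul (by norm_num)]
          congr 1; ring
      _ ≤ _ := ENNReal.ofReal_le_ofReal (by linarith)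
  · refine (lintegral_mono_set Set.inter_subset_right).trans ?_
    rw [lintegral_one_sub_div_rpow ht]
    exact ENNReal.ofReal_le_ofReal (by linarith)

lemma lintegral_weight_inv_sq {t σ : ℝ} (hσ : 0 < σ) :
    ∫⁻ τ in Set.Ioo σ t, ENNReal.ofReal (τ⁻¹ ^ 2 * (1 - τ / t) ^ (-(3:ℝ) / 4)) ≤
      ENNReal.ofReal (18 / σ) := by
  rcases le_or_gt t σ with h | h
  · rw [Set.Ioo_eq_empty (by linarith)]; simp
  have ht : 0 < t := hσ.trans h
  have hsub : Set.Ioo σ t ⊆ Set.Ioi σ ∩ Set.Iic (t / 2) ∪ Set.Ioo (t / 2) t := by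
    intro τ hτ
    rcases le_or_gt τ (t / 2) with h | h
    · exact Or.inl ⟨hτ.1, h⟩
    · exact Or.inr ⟨h, hτ.2⟩
  have hinv : ∫⁻ τ in Set.Ioi σ, ENNReal.ofReal (τ⁻¹ ^ 2) = ENNReal.ofReal (1 / σ) := by
    have hp : ∀ τ ∈ Set.Ioi σ, τ ^ (-2:ℝ) = τ⁻¹ ^ 2 := by
      intro τ hτ
      have : 0 < τ := hσ.trans hτ
      rw [Real.rpow_neg this.le, inv_pow]; norm_cast
    have hi := (integrableOn_Ioi_rpow_of_lt (a := -2) (by norm_num) hσ)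
    have hI := integral_Ioi_rpow_of_lt (a := -2) (by norm_num) hσ
    rw [setIntegral_congr_fun measurableSet_Ioi hp] at hI
    rw [← ofReal_integral_eq_lintegral_ofReal (hi.congr_fun hp measurableSet_Ioi)
      (Filter.Eventually.of_forall fun _ => sq_nonneg _), hI]
    congr 1
    norm_num
    rw [Real.rpow_neg_one]
  calc _ ≤ ∫⁻ τ in Set.Ioi σ ∩ Set.Iic (t / 2) ∪ Set.Ioo (t / 2) t,
        ENNReal.ofReal (τ⁻¹ ^ 2 * (1 - τ / t) ^ (-(3:ℝ) / 4)) := lintegral_mono_set hsub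
    _ ≤ (∫⁻ τ in Set.Ioi σ ∩ Set.Iic (t / 2),
        ENNReal.ofReal (τ⁻¹ ^ 2 * (1 - τ / t) ^ (-(3:ℝ) / 4))) + ∫⁻ τ in Set.Ioo (t / 2) t,
        ENNReal.ofReal (τ⁻¹ ^ 2 * (1 - τ / t) ^ (-(3:ℝ) / 4)) := lintegral_union_le _ _ _
    _ ≤ (∫⁻ τ in Set.Ioi σ ∩ Set.Iic (t / 2), ENNReal.ofReal 2 * ENNReal.ofReal (τ⁻¹ ^ 2)) +
        ∫⁻ τ in Set.Ioo (t / 2) t,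
          ENNReal.ofReal (4 / t ^ 2) * ENNReal.ofReal ((1 - τ / t) ^ (-(3:ℝ) / 4)) := by
        refine add_le_add ?_ ?_
        · refine setLIntegral_mono (by fun_prop) fun τ hτ => ?_
          rw [← ENNReal.ofReal_mul (by norm_num), mul_comm]
          refine ENNReal.ofReal_le_ofReal (mul_le_mul_of_nonneg_right
            (one_sub_div_rpow_le_two ht ?_) (sq_nonneg _))
          have : τ ≤ t / 2 := hτ.2
          linarith
        · refine setLIntegral_mono (by fun_prop) fun τ hτ => ?_
          rw [← ENNReal.ofReal_mul (by positivity)]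
          have h1 : 0 ≤ 1 - τ / t := by
            rw [sub_nonneg, div_le_one ht]; exact hτ.2.le
          refine ENNReal.ofReal_le_ofReal (mul_le_mul_of_nonneg_right ?_ (Real.rpow_nonneg h1 _))
          have h2 : τ⁻¹ ≤ (t / 2)⁻¹ := inv_anti₀ (by linarith) hτ.1.le
          have h3 : 0 ≤ τ⁻¹ := inv_nonneg.2 (by linarith [hτ.1])
          calc τ⁻¹ ^ 2 ≤ (t / 2)⁻¹ ^ 2 := pow_le_pow_left₀ h3 h2 2
            _ = 4 / t ^ 2 := by field_simp; norm_num
    _ ≤ ENNReal.ofReal 2 * ENNReal.ofReal (1 / σ) +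
        ENNReal.ofReal (4 / t ^ 2) * ENNReal.ofReal (4 * t) := by
        rw [lintegral_const_mul' _ _ ENNReal.ofReal_ne_top,
          lintegral_const_mul' _ _ ENNReal.ofReal_ne_top, ← hinv, ← lintegral_one_sub_div_rpow ht]
        gcongr
        · exact Set.inter_subset_left
        · linarith
    _ ≤ _ := by
        rw [← ENNReal.ofReal_mul (by positivity), ← ENNReal.ofReal_mul (by positivity),
          ← ENNReal.ofReal_add (by positivity) (by positivity)]
        refine ENNReal.ofReal_le_ofReal ?_
        have h1 : 4 / t ^ 2 * (4 * t) = 16 / t := by field_simp; norm_num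
        have h2 : 16 / t ≤ 16 / σ := div_le_div_of_nonneg_left (by norm_num) hσ h.le
        rw [h1]
        calc 2 * (1 / σ) + 16 / t ≤ 2 * (1 / σ) + 16 / σ := by linarith
          _ = 18 / σ := by ring

lemma dyadic_term_nonneg {g : ℝ → ℝ} (hg : ∀ τ, 0 ≤ g τ) (B t : ℝ) (k : ℤ) :
    0 ≤ sSup ((fun τ => (2:ℝ) ^ k * g τ) ''
      (Set.Icc ((2:ℝ) ^ (k - 1)) ((2:ℝ) ^ (k + 1)) ∩ Set.Icc (2 * B) t)) := by
  apply Real.sSup_nonneg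
  rintro _ ⟨τ, _, rfl⟩
  exact mul_nonneg (by positivity) (hg τ)

lemma dyadic_nonneg {g : ℝ → ℝ} (hg : ∀ τ, 0 ≤ g τ) (B t : ℝ) : 0 ≤ dyadic g B t :=
  tsum_nonneg fun k => dyadic_term_nonneg hg B t k

lemma dyadic_summable (g : ℝ → ℝ) {B : ℝ} (hB : 0 < B) (t : ℝ) :
    Summable fun k : ℤ => sSup ((fun τ => (2:ℝ) ^ k * g τ) ''
      (Set.Icc ((2:ℝ) ^ (k - 1)) ((2:ℝ) ^ (k + 1)) ∩ Set.Icc (2 * B) t)) := by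
  obtain ⟨n, hn⟩ := pow_unbounded_of_one_lt t (by norm_num : (1:ℝ) < 2)
  obtain ⟨m, hm⟩ := pow_unbounded_of_one_lt ((2 * B)⁻¹) (by norm_num : (1:ℝ) < 2)
  refine summable_of_hasFiniteSupport ((Set.finite_Icc (-(m:ℤ) - 1) (n + 1)).subset ?_)
  intro k hk
  rw [Function.mem_support] at hk
  have hne : (Set.Icc ((2:ℝ) ^ (k - 1)) ((2:ℝ) ^ (k + 1)) ∩ Set.Icc (2 * B) t).Nonempty := by
    by_contra h
    rw [Set.not_nonempty_iff_eq_empty] at h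
    exact hk (by rw [h]; simp)
  obtain ⟨τ, h1, h2⟩ := hne
  constructor
  · have h3 : (2:ℝ) ^ (-(m:ℤ)) < 2 ^ (k + 1) := by
      refine lt_of_lt_of_le ?_ (h2.1.trans h1.2)
      rw [zpow_neg, zpow_natCast]
      exact inv_lt_of_inv_lt₀ (by positivity) hm
    have := (zpow_lt_zpow_iff_right₀ (by norm_num : (1:ℝ) < 2)).1 h3
    omega
  · have h3 : (2:ℝ) ^ (k - 1) < 2 ^ (n:ℤ) := by
      rw [zpow_natCast]
      exact lt_of_le_of_lt (h1.1.trans h2.2) hn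
    have := (zpow_lt_zpow_iff_right₀ (by norm_num : (1:ℝ) < 2)).1 h3
    omega

/-- The dyadic sum controls a time integral with an integrable singularity at the endpoint. -/
lemma lintegral_weight_le_dyadic {g : ℝ → ℝ} (hg : ∀ τ, 0 ≤ g τ) {B t K : ℝ} (hB : 0 < B)
    (hK : ∀ τ ∈ Set.Icc (2 * B) t, g τ ≤ K) :
    ∫⁻ τ in Set.Ioo (2 * B) t, ENNReal.ofReal ((1 - τ / t) ^ (-(3:ℝ) / 4)) * ENNReal.ofReal (g τ) ≤
      ENNReal.ofReal (16 * dyadic g B t) := by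
  rcases le_or_gt t (2 * B) with h | h
  · rw [Set.Ioo_eq_empty (by linarith)]; simp
  have ht : 0 < t := by linarith
  set S : ℤ → ℝ := fun k => sSup ((fun τ => (2:ℝ) ^ k * g τ) ''
      (Set.Icc ((2:ℝ) ^ (k - 1)) ((2:ℝ) ^ (k + 1)) ∩ Set.Icc (2 * B) t)) with hS
  have hS0 : ∀ k, 0 ≤ S k := dyadic_term_nonneg hg B t
  have hba : ∀ k : ℤ, BddAbove ((fun τ => (2:ℝ) ^ k * g τ) ''
      (Set.Icc ((2:ℝ) ^ (k - 1)) ((2:ℝ) ^ (k + 1)) ∩ Set.Icc (2 * B) t)) := by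
    intro k
    refine ⟨(2:ℝ) ^ k * K, ?_⟩
    rintro _ ⟨τ, hτ, rfl⟩
    exact mul_le_mul_of_nonneg_left (hK τ hτ.2) (by positivity)
  set J : ℤ → Set ℝ := fun k => Set.Ico ((2:ℝ) ^ k) (2 * (2:ℝ) ^ k) ∩ Set.Ioo (2 * B) t with hJ
  have hcov : Set.Ioo (2 * B) t ⊆ ⋃ k, J k := by
    intro τ hτ
    obtain ⟨k, hk⟩ := exists_mem_Ico_zpow (x := τ) (y := 2) (by linarith [hτ.1]) (by norm_num)
    refine Set.mem_iUnion.2 ⟨k, ⟨hk.1, ?_⟩, hτ⟩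
    have := hk.2
    rw [zpow_add_one₀ (by norm_num)] at this
    linarith
  have hterm : ∀ k, ∫⁻ τ in J k, ENNReal.ofReal ((1 - τ / t) ^ (-(3:ℝ) / 4)) *
      ENNReal.ofReal (g τ) ≤ ENNReal.ofReal (16 * S k) := by
    intro k
    have hq : (0:ℝ) < 2 ^ k := by positivity
    calc _ ≤ ∫⁻ τ in J k, ENNReal.ofReal ((1 - τ / t) ^ (-(3:ℝ) / 4)) *
          ENNReal.ofReal (S k / 2 ^ k) := by
          refine setLIntegral_mono (by fun_prop) fun τ hτ => ?_
          gcongr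
          rw [le_div_iff₀ hq, mul_comm]
          refine le_csSup (hba k) ⟨τ, ⟨⟨?_, ?_⟩, hτ.2.1.le, hτ.2.2.le⟩, rfl⟩
          · refine le_trans ?_ hτ.1.1
            exact zpow_le_zpow_right₀ (by norm_num) (by omega)
          · rw [zpow_add_one₀ (by norm_num)]
            linarith [hτ.1.2]
      _ = (∫⁻ τ in J k, ENNReal.ofReal ((1 - τ / t) ^ (-(3:ℝ) / 4))) *
          ENNReal.ofReal (S k / 2 ^ k) := lintegral_mul_const' _ _ ENNReal.ofReal_ne_top
      _ ≤ ENNReal.ofReal (16 * 2 ^ k) * ENNReal.ofReal (S k / 2 ^ k) := by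
          gcongr
          refine le_trans (lintegral_mono_set ?_) (lintegral_weight_dyadic ht hq)
          exact Set.inter_subset_inter_right _ (Set.Ioo_subset_Ioo_left (by linarith))
      _ = _ := by
          rw [← ENNReal.ofReal_mul (by positivity)]
          congr 1
          field_simp
  calc _ ≤ ∫⁻ τ in ⋃ k, J k, ENNReal.ofReal ((1 - τ / t) ^ (-(3:ℝ) / 4)) * ENNReal.ofReal (g τ) :=
        lintegral_mono_set hcov
    _ ≤ ∑' k, ∫⁻ τ in J k, ENNReal.ofReal ((1 - τ / t) ^ (-(3:ℝ) / 4)) * ENNReal.ofReal (g τ) :=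
        lintegral_iUnion_le _ _
    _ ≤ ∑' k, ENNReal.ofReal (16 * S k) := ENNReal.tsum_le_tsum hterm
    _ = ENNReal.ofReal (∑' k, 16 * S k) := (ENNReal.ofReal_tsum_of_nonneg
        (fun k => by have := hS0 k; positivity) ((dyadic_summable g hB t).mul_left 16)).symm
    _ = _ := by rw [tsum_mul_left]; rfl

lemma lintegral_le_dyadic {g : ℝ → ℝ} (hg : ∀ τ, 0 ≤ g τ) {B t K : ℝ} (hB : 0 < B)
    (hK : ∀ τ ∈ Set.Icc (2 * B) t, g τ ≤ K) :
    ∫⁻ τ in Set.Icc (2 * B) t, ENNReal.ofReal (g τ) ≤ ENNReal.ofReal (16 * dyadic g B t) := by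
  rw [← restrict_Ioo_eq_restrict_Icc]
  refine le_trans (setLIntegral_mono_ae' measurableSet_Ioo
    (Filter.Eventually.of_forall fun τ hτ => ?_)) (lintegral_weight_le_dyadic hg hB hK)
  have ht : 0 < t := by linarith [hτ.1, hτ.2]
  have h1 : 0 < 1 - τ / t := by rw [sub_pos, div_lt_one ht]; exact hτ.2
  have h2 : 1 - τ / t ≤ 1 := by
    have : 0 ≤ τ / t := div_nonneg (by linarith [hτ.1]) ht.le
    linarith
  have : 1 ≤ ENNReal.ofReal ((1 - τ / t) ^ (-(3:ℝ) / 4)) := by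
    rw [ENNReal.one_le_ofReal]
    exact Real.one_le_rpow_of_pos_of_le_one_of_nonpos h1 h2 (by norm_num)
  calc ENNReal.ofReal (g τ) = 1 * ENNReal.ofReal (g τ) := (one_mul _).symm
    _ ≤ _ := by gcongr

/-! ### The Klein–Gordon equation along rays -/

/-- The boost `Ω_{0k}`, as an index of `GammaField`. -/
def boostIdx : Fin 3 → Fin 10 := ![7, 8, 9]

lemma GammaField_boost (k : Fin 3) (u : (Fin 4 → ℝ) → ℝ) :
    GammaField (boostIdx k) u = rotOp 1 1 k.succ 0 u := by
  funext z
  fin_cases k <;> simp [boostIdx, GammaField, rotOp]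

/-- `ΣΩ_{0k}² - ΣΩ_{jk}²`, the Laplacian of hyperbolic space. -/
def hyperLap (u : (Fin 4 → ℝ) → ℝ) : (Fin 4 → ℝ) → ℝ := fun z =>
  (GammaField 7 (GammaField 7 u) z + GammaField 8 (GammaField 8 u) z
    + GammaField 9 (GammaField 9 u) z)
  - (GammaField 4 (GammaField 4 u) z + GammaField 5 (GammaField 5 u) z
    + GammaField 6 (GammaField 6 u) z)

lemma hyperLap_eq {u : (Fin 4 → ℝ) → ℝ} (hu : ContDiff ℝ (⊤ : ℕ∞) u) (z : Fin 4 → ℝ) :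
    (∑ i, z i * ∑ j, z j * pd i (pd j u) z) + 3 * ∑ i, z i * pd i u z =
      (z 0 ^ 2 - (z 1 ^ 2 + z 2 ^ 2 + z 3 ^ 2)) * Box u z + hyperLap u z := by
  have e4 : ∀ u, GammaField 4 u = rotOp 1 (-1) 1 2 u := fun u => by
    funext z; simp [GammaField, rotOp]; ring
  have e5 : ∀ u, GammaField 5 u = rotOp 1 (-1) 1 3 u := fun u => by
    funext z; simp [GammaField, rotOp]; ring
  have e6 : ∀ u, GammaField 6 u = rotOp 1 (-1) 2 3 u := fun u => by
    funext z; simp [GammaField, rotOp]; ring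
  have e7 : ∀ u, GammaField 7 u = rotOp 1 1 1 0 u := fun u => by
    funext z; simp [GammaField, rotOp]
  have e8 : ∀ u, GammaField 8 u = rotOp 1 1 2 0 u := fun u => by
    funext z; simp [GammaField, rotOp]
  have e9 : ∀ u, GammaField 9 u = rotOp 1 1 3 0 u := fun u => by
    funext z; simp [GammaField, rotOp]
  have hr : ∀ (a b : ℝ) (j k : Fin 4), rotOp a b j k (rotOp a b j k u) z =
      a * (z j * pd k (rotOp a b j k u) z) + b * (z k * pd j (rotOp a b j k u) z) :=
    fun a b j k => rfl
  unfold hyperLap Box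
  rw [e4, e4, e5, e5, e6, e6, e7, e7, e8, e8, e9, e9]
  simp only [hr, pd_rotOp hu]
  simp only [Fin.sum_univ_four]
  simp [rotOp]
  rw [pd_comm hu 1 0, pd_comm hu 2 0, pd_comm hu 3 0, pd_comm hu 2 1, pd_comm hu 3 1,
    pd_comm hu 3 2]
  ring

/-- The point `(s, s y)`. -/
def ray (y : Fin 3 → ℝ) (s : ℝ) : Fin 4 → ℝ := s • (Fin.cons 1 y)

lemma ray_zero (y : Fin 3 → ℝ) (s : ℝ) : ray y s 0 = s := by simp [ray]

lemma ray_succ (y : Fin 3 → ℝ) (s : ℝ) (k : Fin 3) : ray y s k.succ = s * y k := by simp [ray]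

lemma fderiv_eq_sum_pd (u : (Fin 4 → ℝ) → ℝ) (z v : Fin 4 → ℝ) :
    fderiv ℝ u z v = ∑ i, v i * pd i u z := by
  have hv : v = ∑ i, v i • (Pi.single i (1:ℝ) : Fin 4 → ℝ) := by
    ext j; simp [Finset.sum_apply, Pi.single_apply]
  conv_lhs => rw [hv]
  rw [map_sum]
  simp only [map_smul, smul_eq_mul]
  rfl

lemma hasDerivAt_ray {u : (Fin 4 → ℝ) → ℝ} (hu : ContDiff ℝ (⊤ : ℕ∞) u) (y : Fin 3 → ℝ)
    (s : ℝ) : HasDerivAt (fun s => u (ray y s))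
      (∑ i, (Fin.cons 1 y : Fin 4 → ℝ) i * pd i u (ray y s)) s := by
  have h1 : HasDerivAt (fun s : ℝ => ray y s) (Fin.cons 1 y) s :=
    ((hasDerivAt_id s).smul_const (Fin.cons 1 y : Fin 4 → ℝ)).congr_deriv (one_smul _ _)
  have h2 := (smooth_differentiable hu (ray y s)).hasFDerivAt.comp_hasDerivAt s h1
  rw [fderiv_eq_sum_pd] at h2
  exact h2

/-- `(Δ_H + 3/4) u`. -/
def hyperTerm (u : (Fin 4 → ℝ) → ℝ) : (Fin 4 → ℝ) → ℝ := fun z => hyperLap u z + 3 / 4 * u z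

lemma smooth_hyperTerm {u : (Fin 4 → ℝ) → ℝ} (hu : ContDiff ℝ (⊤ : ℕ∞) u) :
    ContDiff ℝ (⊤ : ℕ∞) (hyperTerm u) := by
  have h := fun i => smooth_GammaField (smooth_GammaField hu i) i
  exact ((((h 7).add (h 8)).add (h 9)).sub (((h 4).add (h 5)).add (h 6))).add
    (contDiff_const.mul hu)

lemma coneSupp_hyperTerm {B : ℝ} {u : (Fin 4 → ℝ) → ℝ} (hu : ContDiff ℝ (⊤ : ℕ∞) u)
    (h : ConeSupp B u) : ConeSupp B (hyperTerm u) := by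
  intro z hz
  have hh : ∀ i, GammaField i (GammaField i u) z = 0 := fun i => h.opIter hu [i, i] z hz
  simp [hyperTerm, hyperLap, hh, h z hz]

lemma continuous_ray (y : Fin 3 → ℝ) : Continuous (ray y) := by
  unfold ray; fun_prop

lemma rad_ray (y : Fin 3 → ℝ) {s : ℝ} (hs : 0 ≤ s) :
    rad (ray y s) = s * Real.sqrt (y 0 ^ 2 + y 1 ^ 2 + y 2 ^ 2) := by
  have h1 : ray y s 1 = s * y 0 := ray_succ y s 0
  have h2 : ray y s 2 = s * y 1 := ray_succ y s 1
  have h3 : ray y s 3 = s * y 2 := ray_succ y s 2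
  unfold rad
  rw [h1, h2, h3, ← Real.sqrt_sq hs, ← Real.sqrt_mul (sq_nonneg _), Real.sqrt_sq hs]
  congr 1; ring

lemma ConeSupp.ray_eq_zero {B c : ℝ} {f : (Fin 4 → ℝ) → ℝ} (h : ConeSupp B f) (hB : 0 < B)
    {y : Fin 3 → ℝ} (hc : 0 < c) (hcy : c ^ 2 = 1 - (y 0 ^ 2 + y 1 ^ 2 + y 2 ^ 2)) {s : ℝ}
    (hs : s < B / c ^ 2) : f (ray y s) = 0 := by
  rcases le_or_gt s 0 with h0 | h0
  · exact h _ (Or.inl (by rw [ray_zero]; linarith))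
  · refine h _ (Or.inr ?_)
    rw [rad_ray y h0.le, ray_zero]
    set m := Real.sqrt (y 0 ^ 2 + y 1 ^ 2 + y 2 ^ 2)
    have hm : m ^ 2 = y 0 ^ 2 + y 1 ^ 2 + y 2 ^ 2 := Real.sq_sqrt (by positivity)
    have hm0 : 0 ≤ m := Real.sqrt_nonneg _
    rw [lt_div_iff₀ (by positivity), hcy, ← hm] at hs
    have hm1 : m ≤ 1 := by nlinarith
    nlinarith [mul_nonneg h0.le hm0, mul_nonneg (mul_nonneg h0.le hm0) (sub_nonneg.2 hm1)]

lemma ray_bound {μ B t c : ℝ} (hμ : 1 ≤ μ) (hB : 0 < B) {w : (Fin 4 → ℝ) → ℝ}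
    (hw : ContDiff ℝ (⊤ : ℕ∞) w) (h : ConeSupp B w) {y : Fin 3 → ℝ} (hc : 0 < c)
    (hcy : c ^ 2 = 1 - (y 0 ^ 2 + y 1 ^ 2 + y 2 ^ 2)) (ht : 2 * B ≤ t) :
    ENNReal.ofReal (t ^ ((3:ℝ) / 2) * |w (ray y t)|) ≤
      (∫⁻ s in Set.Ioo (B / c ^ 2) t, ENNReal.ofReal (s ^ ((3:ℝ) / 2) * c) * ‖KG μ w (ray y s)‖ₑ)
      + ENNReal.ofReal (1 / c ^ 2) * ∫⁻ s in Set.Ioo (B / c ^ 2) t,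
        ENNReal.ofReal (s ^ ((3:ℝ) / 2) * s⁻¹ ^ 2 * c) * ‖hyperTerm w (ray y s)‖ₑ := by
  set Y : Fin 4 → ℝ := Fin.cons 1 y with hY
  set D : ((Fin 4 → ℝ) → ℝ) → (Fin 4 → ℝ) → ℝ := fun u z => ∑ i, Y i * pd i u z with hD
  have hDs : ∀ {u : (Fin 4 → ℝ) → ℝ}, ContDiff ℝ (⊤ : ℕ∞) u → ContDiff ℝ (⊤ : ℕ∞) (D u) :=
    fun hu => ContDiff.sum fun i _ => contDiff_const.mul (smooth_pd hu i)
  have hDc : ∀ {u : (Fin 4 → ℝ) → ℝ}, ContDiff ℝ (⊤ : ℕ∞) u → ConeSupp B u → ConeSupp B (D u) :=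
    fun hu h z hz => Finset.sum_eq_zero fun i _ => by rw [(h.pd hu i) z hz, mul_zero]
  have hder : ∀ {u : (Fin 4 → ℝ) → ℝ}, ContDiff ℝ (⊤ : ℕ∞) u → ∀ s,
      HasDerivAt (fun s => u (ray y s)) (D u (ray y s)) s := fun hu s => hasDerivAt_ray hu y s
  set ω := c * μ with hω
  have hω0 : 0 < ω := by positivity
  have hcω : c ≤ ω := by rw [hω]; nlinarith
  set W : ℝ → ℝ := fun s => w (ray y s) with hW
  set W1 : ℝ → ℝ := fun s => D w (ray y s) with hW1
  set W2 : ℝ → ℝ := fun s => D (D w) (ray y s) with hW2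
  -- the radial ordinary differential equation
  have hode : ∀ s, 0 < s → W2 s + 3 / s * W1 s + 3 / 4 * s⁻¹ ^ 2 * W s + ω ^ 2 * W s =
      c ^ 2 * KG μ w (ray y s) + s⁻¹ ^ 2 * hyperTerm w (ray y s) := by
    intro s hs
    have hz : ∀ i, ray y s i = s * Y i := fun i => by simp [ray, hY]
    have hH := hyperLap_eq hw (ray y s)
    have hDD : W2 s = ∑ i, Y i * ∑ j, Y j * pd i (pd j w) (ray y s) := by
      have : ∀ i, pd i (D w) = fun z => ∑ j, Y j * pd i (pd j w) z := by
        intro i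
        have hp := fun j => smooth_differentiable (smooth_pd hw j)
        have hq := fun j => (hp j).const_mul (Y j)
        have hq1 : Differentiable ℝ fun z => Y 0 * pd 0 w z + Y 1 * pd 1 w z := (hq 0).add (hq 1)
        have hq2 : Differentiable ℝ fun z => Y 0 * pd 0 w z + Y 1 * pd 1 w z + Y 2 * pd 2 w z :=
          hq1.add (hq 2)
        have e : D w = fun z => ((Y 0 * pd 0 w z + Y 1 * pd 1 w z) + Y 2 * pd 2 w z)
            + Y 3 * pd 3 w z := by funext z; simp only [hD, Fin.sum_univ_four]
        rw [e, pd_add hq2 (hq 3), pd_add hq1 (hq 2), pd_add (hq 0) (hq 1), pd_const_mul (hp 0),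
          pd_const_mul (hp 1), pd_const_mul (hp 2), pd_const_mul (hp 3)]
        funext z; simp only [Fin.sum_univ_four]
      simp only [hW2]
      change ∑ i, Y i * pd i (D w) (ray y s) = _
      simp only [this]
    have hc2 : ray y s 0 ^ 2 - (ray y s 1 ^ 2 + ray y s 2 ^ 2 + ray y s 3 ^ 2) = s ^ 2 * c ^ 2 := by
      have h1 : ray y s 1 = s * y 0 := ray_succ y s 0
      have h2 : ray y s 2 = s * y 1 := ray_succ y s 1
      have h3 : ray y s 3 = s * y 2 := ray_succ y s 2
      rw [ray_zero, h1, h2, h3, hcy]; ring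
    have hL1 : ∑ i, ray y s i * ∑ j, ray y s j * pd i (pd j w) (ray y s) = s ^ 2 * W2 s := by
      rw [hDD, Finset.mul_sum]
      refine Finset.sum_congr rfl fun i _ => ?_
      rw [hz i, Finset.mul_sum, Finset.mul_sum, Finset.mul_sum]
      refine Finset.sum_congr rfl fun j _ => ?_
      rw [hz j]; ring
    have hL2 : ∑ i, ray y s i * pd i w (ray y s) = s * W1 s := by
      simp only [hW1, hD]
      rw [Finset.mul_sum]
      exact Finset.sum_congr rfl fun i _ => by rw [hz i]; ring
    rw [hc2, hL1, hL2] at hH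
    unfold hyperTerm KG
    have hs2 : s ^ 2 ≠ 0 := by positivity
    have hHL : hyperLap w (ray y s) = s ^ 2 * W2 s + 3 * (s * W1 s) - s ^ 2 * c ^ 2 * Box w (ray y s) := by
      linarith
    rw [hHL, hω]
    simp only [hW]
    field_simp
    ring
  set G : ℝ → ℝ := fun s => s ^ ((3:ℝ) / 2) *
    (c ^ 2 * KG μ w (ray y s) + s⁻¹ ^ 2 * hyperTerm w (ray y s)) with hG
  set p : ℝ → ℝ := fun s => s ^ ((3:ℝ) / 2) *
    ((W1 s + 3 / 2 * s⁻¹ * W s) * Real.sin (ω * (t - s)) + ω * W s * Real.cos (ω * (t - s))) with hp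
  have hpd : ∀ s, 0 < s → HasDerivAt p (G s * Real.sin (ω * (t - s))) s := by
    intro s hs
    have hd0 : HasDerivAt (fun s : ℝ => s ^ ((3:ℝ) / 2)) (3 / 2 * s⁻¹ * s ^ ((3:ℝ) / 2)) s := by
      refine (Real.hasDerivAt_rpow_const (p := (3:ℝ) / 2) (Or.inl hs.ne')).congr_deriv ?_
      rw [Real.rpow_sub_one hs.ne']; ring
    have hdi : HasDerivAt (fun s : ℝ => s⁻¹) (-(s⁻¹ ^ 2)) s := by
      refine (hasDerivAt_inv hs.ne').congr_deriv ?_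
      rw [inv_pow]
    have harg : HasDerivAt (fun s : ℝ => ω * (t - s)) (-ω) s := by
      simpa using ((hasDerivAt_id s).const_sub t).const_mul ω
    have hWd : HasDerivAt W (W1 s) s := hder hw s
    have hW1d : HasDerivAt W1 (W2 s) s := hder (hDs hw) s
    have h1 := (hW1d.add ((hdi.const_mul (3 / 2)).mul hWd)).mul harg.sin
    have h2 := (hWd.const_mul ω).mul harg.cos
    have h3 := hd0.mul (h1.add h2)
    refine h3.congr_deriv ?_
    simp only [hG]
    rw [← hode s hs]
    simp only [Pi.add_apply, Pi.mul_apply]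
    have e3 : 3 / s = 3 * s⁻¹ := by ring
    rw [e3]
    ring
  have hGc : ContinuousOn G (Set.Icc (2 * B) t) := by
    have hne : ∀ s ∈ Set.Icc (2 * B) t, s ≠ 0 := fun s hs => by
      have := hs.1; intro h0; rw [h0] at this; linarith
    have c1 : Continuous fun s => KG μ w (ray y s) := (smooth_KG hw μ).continuous.comp (continuous_ray y)
    have c2 : Continuous fun s => hyperTerm w (ray y s) :=
      (smooth_hyperTerm hw).continuous.comp (continuous_ray y)
    refine ContinuousOn.mul (fun s hs => (Real.continuousAt_rpow_const _ _
      (Or.inl (hne s hs))).continuousWithinAt) ?_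
    exact (c1.continuousOn.const_smul (c ^ 2)).add
      (((continuousOn_id.inv₀ hne).pow 2).mul c2.continuousOn)
  have hGi : IntervalIntegrable (fun s => G s * Real.sin (ω * (t - s))) volume (2 * B) t := by
    apply ContinuousOn.intervalIntegrable
    rw [Set.uIcc_of_le ht]
    exact hGc.mul (by fun_prop : Continuous fun s => Real.sin (ω * (t - s))).continuousOn
  have hFTC := intervalIntegral.integral_eq_sub_of_hasDerivAt (f := p) (a := 2 * B) (b := t)
    (f' := fun s => G s * Real.sin (ω * (t - s)))
    (fun s hs => hpd s (by rw [Set.uIcc_of_le ht] at hs; linarith [hs.1])) hGi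
  have hpt : p t = ω * (t ^ ((3:ℝ) / 2) * w (ray y t)) := by simp [hp, hW]; ring
  have hpB : p (2 * B) = 0 := by
    have hz : (ray y (2 * B) 0 ≤ 2 * B ∨ ray y (2 * B) 0 - B < rad (ray y (2 * B))) :=
      Or.inl (by rw [ray_zero])
    simp [hp, hW, hW1, h _ hz, hDc hw h _ hz]
  rw [hpt, hpB, sub_zero, intervalIntegral.integral_of_le ht] at hFTC
  have ht0 : 0 < t := by linarith
  -- passage to absolute values
  have hkey : ENNReal.ofReal c * ENNReal.ofReal (t ^ ((3:ℝ) / 2) * |w (ray y t)|) ≤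
      ∫⁻ s in Set.Ioc (2 * B) t, ‖G s‖ₑ := by
    calc ENNReal.ofReal c * ENNReal.ofReal (t ^ ((3:ℝ) / 2) * |w (ray y t)|)
        ≤ ENNReal.ofReal ω * ENNReal.ofReal (t ^ ((3:ℝ) / 2) * |w (ray y t)|) := by gcongr
      _ = ‖ω * (t ^ ((3:ℝ) / 2) * w (ray y t))‖ₑ := by
          rw [← ENNReal.ofReal_mul hω0.le, ← ofReal_norm, Real.norm_eq_abs, abs_mul ω, abs_mul (t ^ _),
            abs_of_pos hω0, abs_of_pos (Real.rpow_pos_of_pos ht0 _)]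
      _ ≤ ∫⁻ s in Set.Ioc (2 * B) t, ‖G s * Real.sin (ω * (t - s))‖ₑ := by
          rw [← hFTC]; exact enorm_integral_le_lintegral_enorm _
      _ ≤ _ := by
          refine lintegral_mono fun s => ?_
          rw [← ofReal_norm, ← ofReal_norm]
          refine ENNReal.ofReal_le_ofReal ?_
          rw [norm_mul]
          exact mul_le_of_le_one_right (norm_nonneg _) (Real.abs_sin_le_one _)
  have hGle : ∀ s ∈ Set.Ioc (2 * B) t, ‖G s‖ₑ ≤ ENNReal.ofReal c *
      ((ENNReal.ofReal (s ^ ((3:ℝ) / 2) * c) * ‖KG μ w (ray y s)‖ₑ) + ENNReal.ofReal (1 / c ^ 2) *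
        (ENNReal.ofReal (s ^ ((3:ℝ) / 2) * s⁻¹ ^ 2 * c) * ‖hyperTerm w (ray y s)‖ₑ)) := by
    intro s hs
    have hs0 : 0 < s := by linarith [hs.1]
    have hsp : 0 < s ^ ((3:ℝ) / 2) := Real.rpow_pos_of_pos hs0 _
    simp only [← ofReal_norm, Real.norm_eq_abs]
    rw [← ENNReal.ofReal_mul (by positivity), ← ENNReal.ofReal_mul (by positivity),
      ← ENNReal.ofReal_mul (by positivity), ← ENNReal.ofReal_add (by positivity) (by positivity),
      ← ENNReal.ofReal_mul (by positivity)]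
    refine ENNReal.ofReal_le_ofReal ?_
    simp only [hG]
    rw [abs_mul, abs_of_pos hsp]
    have h1 := abs_add_le (c ^ 2 * KG μ w (ray y s)) (s⁻¹ ^ 2 * hyperTerm w (ray y s))
    rw [abs_mul, abs_mul, abs_of_pos (by positivity : 0 < c ^ 2),
      abs_of_pos (by positivity : 0 < s⁻¹ ^ 2)] at h1
    refine (mul_le_mul_of_nonneg_left h1 hsp.le).trans (le_of_eq ?_)
    field_simp
  set I1 : ℝ → ENNReal := fun s => ENNReal.ofReal (s ^ ((3:ℝ) / 2) * c) * ‖KG μ w (ray y s)‖ₑ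
    with hI1
  set I2 : ℝ → ENNReal := fun s =>
    ENNReal.ofReal (s ^ ((3:ℝ) / 2) * s⁻¹ ^ 2 * c) * ‖hyperTerm w (ray y s)‖ₑ with hI2
  have hm1 : Measurable I1 := by
    have hr : Measurable fun s : ℝ => ENNReal.ofReal (s ^ ((3:ℝ) / 2) * c) := by fun_prop
    exact hr.mul ((smooth_KG hw μ).continuous.comp (continuous_ray y)).enorm.measurable
  have hin : ∀ s ∈ Set.Ioo (2 * B) t, ‖G s‖ₑ ≤ (Set.Ico (B / c ^ 2) t).indicator
      (fun s => ENNReal.ofReal c * (I1 s + ENNReal.ofReal (1 / c ^ 2) * I2 s)) s := by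
    intro s hs
    by_cases hsB : B / c ^ 2 ≤ s
    · rw [Set.indicator_of_mem (Set.mem_Ico.2 ⟨hsB, hs.2⟩)]
      exact hGle s ⟨hs.1, hs.2.le⟩
    · have hlt := not_le.1 hsB
      have z1 := (coneSupp_KG (μ := μ) hw h).ray_eq_zero hB hc hcy hlt
      have z2 := (coneSupp_hyperTerm hw h).ray_eq_zero hB hc hcy hlt
      simp [hG, z1, z2]
  have hfin : ENNReal.ofReal c * ENNReal.ofReal (t ^ ((3:ℝ) / 2) * |w (ray y t)|) ≤
      ENNReal.ofReal c * ((∫⁻ s in Set.Ioo (B / c ^ 2) t, I1 s) +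
        ENNReal.ofReal (1 / c ^ 2) * ∫⁻ s in Set.Ioo (B / c ^ 2) t, I2 s) := by
    refine hkey.trans ?_
    rw [← restrict_Ioo_eq_restrict_Ioc]
    refine (setLIntegral_mono_ae' measurableSet_Ioo
      (Filter.Eventually.of_forall hin)).trans ?_
    refine (setLIntegral_le_lintegral _ _).trans ?_
    rw [lintegral_indicator measurableSet_Ico, ← restrict_Ioo_eq_restrict_Ico,
      lintegral_const_mul' _ _ ENNReal.ofReal_ne_top, lintegral_add_left hm1,
      lintegral_const_mul' _ _ ENNReal.ofReal_ne_top]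
  have hc0 : ENNReal.ofReal c ≠ 0 := by simpa using hc
  exact (ENNReal.mul_le_mul_iff_right hc0 ENNReal.ofReal_ne_top).1 hfin

/-! ### A Sobolev inequality on hyperboloids -/

/-- The square of the Euclidean norm on `ℝ³`. -/
def nsq (x : Fin 3 → ℝ) : ℝ := x 0 ^ 2 + x 1 ^ 2 + x 2 ^ 2

lemma nsq_nonneg (x : Fin 3 → ℝ) : 0 ≤ nsq x := by unfold nsq; positivity

lemma continuous_nsq : Continuous nsq := by unfold nsq; fun_prop

/-- The point over `x` on the hyperboloid `t² - |x|² = R`. -/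
def hyp (R : ℝ) (x : Fin 3 → ℝ) : Fin 4 → ℝ := Fin.cons (Real.sqrt (R + nsq x)) x

/-- The word in the boosts which is empty for `i = 0` and `Ω_{0i}` otherwise. -/
def boostWord (i : Fin 4) : List (Fin 10) := Fin.cases [] (fun k => [boostIdx k]) i

lemma opIter_append {α γ : Type*} (F : α → γ → γ) (L M : List α) (u : γ) :
    opIter F (L ++ M) u = opIter F L (opIter F M u) := by
  induction L with
  | nil => rfl
  | cons i L ih => exact congrArg (F i) ih

lemma enorm_le_lintegral_deriv {φ φ' : ℝ → ℝ} (h : ∀ ξ, HasDerivAt φ (φ' ξ) ξ)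
    (hc : Continuous φ') (r : ℝ) :
    ENNReal.ofReal r * ‖φ 0‖ₑ ≤
      ∫⁻ ξ in Set.Icc 0 r, (‖φ ξ‖ₑ + ENNReal.ofReal r * ‖φ' ξ‖ₑ) := by
  have hφ : Continuous φ := continuous_iff_continuousAt.2 fun ξ => (h ξ).continuousAt
  have h1 : ∀ ξ ∈ Set.Icc 0 r, ‖φ 0‖ₑ ≤ ‖φ ξ‖ₑ + ∫⁻ ξ in Set.Icc 0 r, ‖φ' ξ‖ₑ := by
    intro ξ hξ
    have hF := intervalIntegral.integral_eq_sub_of_hasDerivAt (f := φ) (f' := φ') (a := 0) (b := ξ)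
      (fun x _ => h x) (hc.intervalIntegrable _ _)
    have e : φ 0 = φ ξ - ∫ x in (0:ℝ)..ξ, φ' x := by rw [hF]; ring
    calc ‖φ 0‖ₑ = ‖φ ξ - ∫ x in (0:ℝ)..ξ, φ' x‖ₑ := by rw [← e]
      _ ≤ ‖φ ξ‖ₑ + ‖∫ x in (0:ℝ)..ξ, φ' x‖ₑ := enorm_sub_le
      _ ≤ _ := by
          gcongr
          rw [intervalIntegral.integral_of_le hξ.1]
          refine (enorm_integral_le_lintegral_enorm _).trans (lintegral_mono_set ?_)
          exact fun x hx => ⟨hx.1.le, hx.2.trans hξ.2⟩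
  calc ENNReal.ofReal r * ‖φ 0‖ₑ = ∫⁻ _ξ in Set.Icc 0 r, ‖φ 0‖ₑ := by
        rw [setLIntegral_const, Real.volume_Icc, sub_zero, mul_comm]
    _ ≤ ∫⁻ ξ in Set.Icc 0 r, (‖φ ξ‖ₑ + ∫⁻ ξ in Set.Icc 0 r, ‖φ' ξ‖ₑ) :=
        setLIntegral_mono_ae' measurableSet_Icc (Filter.Eventually.of_forall h1)
    _ = _ := by
        rw [lintegral_add_left hφ.enorm.measurable, lintegral_add_left hφ.enorm.measurable,
          setLIntegral_const, Real.volume_Icc, sub_zero,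
          lintegral_const_mul' _ _ ENNReal.ofReal_ne_top, mul_comm]

lemma hasDerivAt_hyp {g : (Fin 4 → ℝ) → ℝ} (hg : ContDiff ℝ (⊤ : ℕ∞) g) {R : ℝ} (hR : 0 < R)
    (x b : Fin 3 → ℝ) (ξ : ℝ) :
    HasDerivAt (fun ξ : ℝ => g (hyp R (x - ξ • b)))
      (-(∑ k, b k * GammaField (boostIdx k) g (hyp R (x - ξ • b))) /
        Real.sqrt (R + nsq (x - ξ • b))) ξ := by
  set x' := x - ξ • b with hx'
  have hpos : 0 < R + nsq x' := by linarith [nsq_nonneg x']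
  have hk : ∀ k, HasDerivAt (fun ξ : ℝ => (x - ξ • b) k) (-(b k)) ξ := by
    intro k
    simpa using ((hasDerivAt_id ξ).mul_const (b k)).const_sub (x k)
  have hn : HasDerivAt (fun ξ : ℝ => R + nsq (x - ξ • b))
      (-2 * (b 0 * x' 0 + b 1 * x' 1 + b 2 * x' 2)) ξ := by
    have := ((((hk 0).pow 2).add ((hk 1).pow 2)).add ((hk 2).pow 2)).const_add R
    refine this.congr_deriv ?_
    simp [hx']; ring
  have hs := hn.sqrt hpos.ne'
  have hv : HasDerivAt (fun ξ : ℝ => hyp R (x - ξ • b))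
      (Fin.cons (-2 * (b 0 * x' 0 + b 1 * x' 1 + b 2 * x' 2) / (2 * Real.sqrt (R + nsq x')))
        (fun k => -(b k))) ξ := by
    rw [hasDerivAt_pi]
    intro i
    refine Fin.cases ?_ (fun k => ?_) i
    · simpa [hyp] using hs
    · simpa [hyp] using hk k
  have hcomp := (smooth_differentiable hg (hyp R x')).hasFDerivAt.comp_hasDerivAt ξ hv
  rw [fderiv_eq_sum_pd] at hcomp
  refine hcomp.congr_deriv ?_
  have hsq : Real.sqrt (R + nsq x') ≠ 0 := (Real.sqrt_pos.2 hpos).ne'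
  have z0 : hyp R x' 0 = Real.sqrt (R + nsq x') := rfl
  have zk : ∀ k : Fin 3, hyp R x' k.succ = x' k := fun k => rfl
  rw [Fin.sum_univ_succ]
  simp only [GammaField_boost, rotOp, Fin.cons_zero, Fin.cons_succ, zk, z0, Fin.sum_univ_three]
  field_simp
  ring

lemma contDiff_hyp {g : (Fin 4 → ℝ) → ℝ} (hg : ContDiff ℝ (⊤ : ℕ∞) g) {R : ℝ} (hR : 0 < R)
    (x b : Fin 3 → ℝ) : ContDiff ℝ (⊤ : ℕ∞) (fun ξ : ℝ => g (hyp R (x - ξ • b))) := by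
  have hk : ∀ k, ContDiff ℝ (⊤ : ℕ∞) (fun ξ : ℝ => (x - ξ • b) k) := fun k =>
    contDiff_const.sub (contDiff_id.mul contDiff_const)
  refine hg.comp (contDiff_pi.2 fun i => ?_)
  refine Fin.cases ?_ (fun k => ?_) i
  · change ContDiff ℝ (⊤ : ℕ∞) (fun ξ : ℝ => Real.sqrt (R + nsq (x - ξ • b)))
    refine ContDiff.sqrt ?_ fun ξ => by linarith [nsq_nonneg (x - ξ • b)]
    exact contDiff_const.add ((((hk 0).pow 2).add ((hk 1).pow 2)).add ((hk 2).pow 2))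
  · exact hk k

lemma hyp_step {g : (Fin 4 → ℝ) → ℝ} (hg : ContDiff ℝ (⊤ : ℕ∞) g) {R r : ℝ} (hR : 0 < R)
    (hr : 0 < r) {x b : Fin 3 → ℝ} (hb : ∀ k, |b k| ≤ 2)
    (hτ : ∀ ξ ∈ Set.Icc 0 r, (2 * r) ^ 2 ≤ R + nsq (x - ξ • b)) :
    ENNReal.ofReal r * ‖g (hyp R x)‖ₑ ≤ ∫⁻ ξ in Set.Icc 0 r,
      ∑ i, ‖opIter GammaField (boostWord i) g (hyp R (x - ξ • b))‖ₑ := by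
  have hd := hasDerivAt_hyp hg hR x b
  have hder : deriv (fun ξ : ℝ => g (hyp R (x - ξ • b))) = _ := funext fun ξ => (hd ξ).deriv
  have hc := (contDiff_hyp hg hR x b).continuous_deriv (by norm_cast)
  rw [hder] at hc
  have h := enorm_le_lintegral_deriv hd hc r
  simp only [zero_smul, sub_zero] at h
  refine h.trans (setLIntegral_mono_ae' measurableSet_Icc
    (Filter.Eventually.of_forall fun ξ hξ => ?_))
  rw [Fin.sum_univ_succ]
  refine add_le_add (le_of_eq rfl) ?_
  set z := hyp R (x - ξ • b)
  set τ := Real.sqrt (R + nsq (x - ξ • b))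
  have hτ1 : 2 * r ≤ τ := Real.le_sqrt_of_sq_le (hτ ξ hξ)
  have hτ0 : 0 < τ := by linarith
  change ENNReal.ofReal r * ‖_‖ₑ ≤ ∑ k, ‖GammaField (boostIdx k) g z‖ₑ
  simp only [← ofReal_norm]
  rw [← ENNReal.ofReal_mul hr.le, ← ENNReal.ofReal_sum_of_nonneg (fun _ _ => norm_nonneg _)]
  refine ENNReal.ofReal_le_ofReal ?_
  rw [norm_div, norm_neg, Real.norm_of_nonneg hτ0.le, ← mul_div_assoc, div_le_iff₀ hτ0]
  have h1 : ‖∑ k, b k * GammaField (boostIdx k) g z‖ ≤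
      2 * ∑ k, ‖GammaField (boostIdx k) g z‖ := by
    rw [Finset.mul_sum]
    refine (norm_sum_le _ _).trans (Finset.sum_le_sum fun k _ => ?_)
    rw [norm_mul]
    exact mul_le_mul_of_nonneg_right (hb k) (norm_nonneg _)
  have h0 : 0 ≤ ∑ k, ‖GammaField (boostIdx k) g z‖ := Finset.sum_nonneg fun _ _ => norm_nonneg _
  calc r * ‖∑ k, b k * GammaField (boostIdx k) g z‖ ≤
      r * (2 * ∑ k, ‖GammaField (boostIdx k) g z‖) := mul_le_mul_of_nonneg_left h1 hr.le
    _ = (∑ k, ‖GammaField (boostIdx k) g z‖) * (2 * r) := by ring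
    _ ≤ _ := mul_le_mul_of_nonneg_left hτ1 h0

/-- The sum of the absolute values of all products of at most three boosts applied to `f`. -/
def boostSum (f : (Fin 4 → ℝ) → ℝ) (z : Fin 4 → ℝ) : ENNReal :=
  ∑ i, ∑ j, ∑ k, ‖opIter GammaField (boostWord k ++ (boostWord j ++ boostWord i)) f z‖ₑ

lemma measurable_boostSum {f : (Fin 4 → ℝ) → ℝ} (hf : ContDiff ℝ (⊤ : ℕ∞) f) :
    Measurable (boostSum f) := by
  unfold boostSum
  refine Finset.measurable_sum _ fun i _ => Finset.measurable_sum _ fun j _ =>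
    Finset.measurable_sum _ fun k _ => ?_
  exact (smooth_opIter hf _).continuous.enorm.measurable

lemma continuous_hyp (R : ℝ) : Continuous (hyp R) := by
  refine continuous_pi fun i => Fin.cases ?_ (fun k => ?_) i
  · exact Real.continuous_sqrt.comp (continuous_const.add continuous_nsq)
  · exact continuous_apply k

lemma lintegral_fin_three {G : (Fin 3 → ℝ) → ENNReal} (hG : Measurable G) :
    ∫⁻ z, G z = ∫⁻ a : ℝ, ∫⁻ b : ℝ, ∫⁻ c : ℝ, G ![a, b, c] := by
  have hcons : ∀ (n : ℕ) (a : ℝ), Measurable (fun v : Fin n → ℝ => (Fin.cons a v : Fin (n+1) → ℝ)) :=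
    fun n a => measurable_pi_lambda _ fun i =>
      Fin.cases measurable_const (fun k => measurable_pi_apply k) i
  rw [lintegral_fin_cons hG]
  refine lintegral_congr fun a => ?_
  have h1 := hG.comp (hcons 2 a)
  refine (lintegral_fin_cons (n := 1) h1).trans (lintegral_congr fun b => ?_)
  have h2 := h1.comp (hcons 1 b)
  refine (lintegral_fin_cons (n := 0) h2).trans (lintegral_congr fun c => ?_)
  simp only [lintegral_unique, volume_pi, Measure.pi_univ]
  simp only [Finset.univ_eq_empty, Finset.prod_empty, mul_one]
  refine congrArg G (funext fun i => ?_)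
  fin_cases i <;> rfl

/-- The directions used in the Sobolev inequality: the columns have entries `ε k` and `2 * ε k`. -/
def coneMat (ε : Fin 3 → ℝ) : Matrix (Fin 3) (Fin 3) ℝ :=
  Matrix.of fun k j => ε k * (if k = j then 2 else 1)

lemma abs_det_coneMat {ε : Fin 3 → ℝ} (hε : ∀ k, |ε k| = 1) : |(coneMat ε).det| = 4 := by
  have : (coneMat ε).det = ε 0 * ε 1 * ε 2 * 4 := by
    rw [Matrix.det_fin_three]; simp [coneMat]; ring
  rw [this]; simp [abs_mul, hε]

lemma lintegral_coneMat {ε : Fin 3 → ℝ} (hε : ∀ k, |ε k| = 1) {G : (Fin 3 → ℝ) → ENNReal}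
    (hG : Measurable G) (x : Fin 3 → ℝ) :
    ∫⁻ ξ, G (x - (coneMat ε).mulVec ξ) ≤ ∫⁻ x', G x' := by
  have hd : (coneMat ε).det ≠ 0 := by
    intro h; have := abs_det_coneMat hε; rw [h] at this; norm_num at this
  have hm : Measurable (Matrix.toLin' (coneMat ε)) :=
    (LinearMap.continuous_of_finiteDimensional (Matrix.toLin' (coneMat ε))).measurable
  have h := Real.map_matrix_volume_pi_eq_smul_volume_pi hd
  have hG' : Measurable fun v => G (x - v) := hG.comp (measurable_const.sub measurable_id)
  have h2 : ∫⁻ ξ, G (x - (coneMat ε).mulVec ξ) =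
      ∫⁻ v, G (x - v) ∂(Measure.map (Matrix.toLin' (coneMat ε)) volume) := by
    rw [lintegral_map hG' hm]; rfl
  rw [h2, h, lintegral_smul_measure, lintegral_sub_left_eq_self, abs_inv, abs_det_coneMat hε]
  rw [smul_eq_mul]
  refine mul_le_of_le_one_left zero_le ?_
  rw [ENNReal.ofReal_le_one]; norm_num

/-- The Sobolev inequality on the hyperboloid `t² - |x|² = R`. -/
lemma hyp_sobolev {f : (Fin 4 → ℝ) → ℝ} (hf : ContDiff ℝ (⊤ : ℕ∞) f) {R r : ℝ} (hR : 0 < R)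
    (hr : 0 < r) {ε : Fin 3 → ℝ} (hε : ∀ k, |ε k| = 1) {x : Fin 3 → ℝ} {E : Set (Fin 3 → ℝ)}
    (hE : MeasurableSet E)
    (hcube : ∀ ξ : Fin 3 → ℝ, (∀ j, ξ j ∈ Set.Icc 0 r) → x - (coneMat ε).mulVec ξ ∈ E)
    (hτ : ∀ x' ∈ E, (2 * r) ^ 2 ≤ R + nsq x') :
    ENNReal.ofReal r ^ 3 * ‖f (hyp R x)‖ₑ ≤ ∫⁻ x' in E, boostSum f (hyp R x') := by
  set b : Fin 3 → Fin 3 → ℝ := fun j k => ε k * (if k = j then 2 else 1) with hbdef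
  have hb : ∀ j k, |b j k| ≤ 2 := by
    intro j k
    rw [hbdef, abs_mul, hε]; split_ifs <;> norm_num
  have hr0 : (0:ℝ) ∈ Set.Icc 0 r := ⟨le_rfl, hr.le⟩
  have hmv : ∀ p q s : ℝ, x - (coneMat ε).mulVec ![p, q, s] = x - p • b 0 - q • b 1 - s • b 2 := by
    intro p q s
    ext k
    fin_cases k <;> simp [coneMat, hbdef, Matrix.vecHead, Matrix.vecTail] <;> ring
  have hmem : ∀ p ∈ Set.Icc 0 r, ∀ q ∈ Set.Icc 0 r, ∀ s ∈ Set.Icc 0 r,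
      x - p • b 0 - q • b 1 - s • b 2 ∈ E := by
    intro p hp q hq s hs
    rw [← hmv]
    refine hcube _ fun j => ?_
    fin_cases j <;> simpa using ‹_›
  have s1 := fun (g : (Fin 4 → ℝ) → ℝ) (hg : ContDiff ℝ (⊤ : ℕ∞) g) =>
    hyp_step hg hR hr (hb 0) (x := x) fun p hp => hτ _ (by simpa using hmem p hp 0 hr0 0 hr0)
  have s2 := fun (g : (Fin 4 → ℝ) → ℝ) (hg : ContDiff ℝ (⊤ : ℕ∞) g) p (hp : p ∈ Set.Icc 0 r) =>
    hyp_step hg hR hr (hb 1) (x := x - p • b 0)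
      fun q hq => hτ _ (by simpa using hmem p hp q hq 0 hr0)
  have s3 := fun (g : (Fin 4 → ℝ) → ℝ) (hg : ContDiff ℝ (⊤ : ℕ∞) g) p (hp : p ∈ Set.Icc 0 r)
      q (hq : q ∈ Set.Icc 0 r) =>
    hyp_step hg hR hr (hb 2) (x := x - p • b 0 - q • b 1) fun s hs => hτ _ (hmem p hp q hq s hs)
  have hmeas : ∀ (g : (Fin 4 → ℝ) → ℝ), ContDiff ℝ (⊤ : ℕ∞) g → ∀ (y d : Fin 3 → ℝ),
      Measurable fun ξ : ℝ => ‖g (hyp R (y - ξ • d))‖ₑ := by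
    intro g hg y d
    exact (hg.continuous.comp ((continuous_hyp R).comp (by fun_prop))).enorm.measurable
  have key : ENNReal.ofReal r ^ 3 * ‖f (hyp R x)‖ₑ ≤ ∫⁻ p in Set.Icc 0 r, ∫⁻ q in Set.Icc 0 r,
      ∫⁻ s in Set.Icc 0 r, boostSum f (hyp R (x - (coneMat ε).mulVec ![p, q, s])) := by
    have hrt : ENNReal.ofReal r ≠ ⊤ := ENNReal.ofReal_ne_top
    calc ENNReal.ofReal r ^ 3 * ‖f (hyp R x)‖ₑ
        = ENNReal.ofReal r ^ 2 * (ENNReal.ofReal r * ‖f (hyp R x)‖ₑ) := by ring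
      _ ≤ ENNReal.ofReal r ^ 2 * ∫⁻ p in Set.Icc 0 r,
            ∑ i, ‖opIter GammaField (boostWord i) f (hyp R (x - p • b 0))‖ₑ := by
          gcongr; exact s1 f hf
      _ = ∫⁻ p in Set.Icc 0 r, ENNReal.ofReal r * ∑ i, (ENNReal.ofReal r *
            ‖opIter GammaField (boostWord i) f (hyp R (x - p • b 0))‖ₑ) := by
          rw [← lintegral_const_mul' _ _ (ENNReal.pow_ne_top hrt)]
          refine lintegral_congr fun p => ?_
          rw [← Finset.mul_sum]; ring
      _ ≤ _ := ?_
    refine setLIntegral_mono_ae' measurableSet_Icc (Filter.Eventually.of_forall fun p hp => ?_)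
    calc ENNReal.ofReal r * ∑ i, (ENNReal.ofReal r *
            ‖opIter GammaField (boostWord i) f (hyp R (x - p • b 0))‖ₑ)
        ≤ ENNReal.ofReal r * ∑ i, ∫⁻ q in Set.Icc 0 r, ∑ j, ‖opIter GammaField (boostWord j)
            (opIter GammaField (boostWord i) f) (hyp R (x - p • b 0 - q • b 1))‖ₑ := by
          gcongr with i
          exact s2 _ (smooth_opIter hf _) p hp
      _ = ∫⁻ q in Set.Icc 0 r, ∑ i, ∑ j, (ENNReal.ofReal r * ‖opIter GammaField (boostWord j)
            (opIter GammaField (boostWord i) f) (hyp R (x - p • b 0 - q • b 1))‖ₑ) := by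
          rw [← lintegral_finsetSum _ fun i _ => Finset.measurable_sum _ fun j _ =>
            hmeas _ (smooth_opIter (smooth_opIter hf _) _) _ _, ← lintegral_const_mul' _ _ hrt]
          refine lintegral_congr fun p => ?_
          simp only [Finset.mul_sum]
      _ ≤ _ := ?_
    refine setLIntegral_mono_ae' measurableSet_Icc (Filter.Eventually.of_forall fun q hq => ?_)
    calc _ ≤ ∑ i, ∑ j, ∫⁻ s in Set.Icc 0 r, ∑ k, ‖opIter GammaField (boostWord k)
            (opIter GammaField (boostWord j) (opIter GammaField (boostWord i) f))
            (hyp R (x - p • b 0 - q • b 1 - s • b 2))‖ₑ := by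
          gcongr with i _ j
          exact s3 _ (smooth_opIter (smooth_opIter hf _) _) p hp q hq
      _ = _ := by
          have hm3 : ∀ i j, Measurable fun s : ℝ => ∑ k, ‖opIter GammaField (boostWord k)
            (opIter GammaField (boostWord j) (opIter GammaField (boostWord i) f))
            (hyp R (x - p • b 0 - q • b 1 - s • b 2))‖ₑ := fun i j =>
            Finset.measurable_sum _ fun k _ =>
              hmeas _ (smooth_opIter (smooth_opIter (smooth_opIter hf _) _) _) _ _
          simp_rw [← lintegral_finsetSum _ fun j _ => hm3 _ j]
          rw [← lintegral_finsetSum _ fun i _ => Finset.measurable_sum _ fun j _ => hm3 i j]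
          refine lintegral_congr fun s => ?_
          rw [hmv]
          simp only [boostSum, opIter_append]
  refine key.trans ?_
  set H : (Fin 3 → ℝ) → ENNReal := E.indicator fun x' => boostSum f (hyp R x') with hH
  have hHm : Measurable H :=
    ((measurable_boostSum hf).comp (continuous_hyp R).measurable).indicator hE
  have hmvc : Continuous fun ξ : Fin 3 → ℝ => x - (coneMat ε).mulVec ξ :=
    continuous_const.sub (LinearMap.continuous_of_finiteDimensional (Matrix.toLin' (coneMat ε)))
  calc _ ≤ ∫⁻ p : ℝ, ∫⁻ q : ℝ, ∫⁻ s : ℝ, H (x - (coneMat ε).mulVec ![p, q, s]) := by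
        refine le_trans (setLIntegral_mono_ae' measurableSet_Icc
          (Filter.Eventually.of_forall fun p hp => ?_)) (setLIntegral_le_lintegral (Set.Icc 0 r) _)
        refine le_trans (setLIntegral_mono_ae' measurableSet_Icc
          (Filter.Eventually.of_forall fun q hq => ?_)) (setLIntegral_le_lintegral (Set.Icc 0 r) _)
        refine le_trans (setLIntegral_mono_ae' measurableSet_Icc
          (Filter.Eventually.of_forall fun s hs => ?_)) (setLIntegral_le_lintegral (Set.Icc 0 r) _)
        rw [hH, Set.indicator_of_mem]
        rw [hmv]; exact hmem p hp q hq s hs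
    _ = ∫⁻ ξ, H (x - (coneMat ε).mulVec ξ) :=
        (lintegral_fin_three (hHm.comp hmvc.measurable)).symm
    _ ≤ ∫⁻ x', H x' := lintegral_coneMat hε hHm x
    _ = _ := lintegral_indicator hE _

/-- The square of the (enlarged) radius on which the Sobolev inequality is applied. -/
def sobQ (y : Fin 3 → ℝ) (t s : ℝ) : ℝ := s ^ 2 * (nsq y + 1 - s ^ 2 / t ^ 2)

/-- The region on which the Sobolev inequality is applied. -/
def sobReg (c : ℝ) (y : Fin 3 → ℝ) (t s : ℝ) : Set (Fin 3 → ℝ) :=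
  {x | nsq x ≤ sobQ y t s ∧ s ^ 2 ≤ 4 * (c ^ 2 * s ^ 2 + nsq x)}

lemma measurableSet_sobReg (c : ℝ) (y : Fin 3 → ℝ) (t s : ℝ) : MeasurableSet (sobReg c y t s) :=
  (measurableSet_le continuous_nsq.measurable measurable_const).inter
    (measurableSet_le measurable_const
      (measurable_const.mul (measurable_const.add continuous_nsq.measurable)))

lemma sobReg_arith {a0 a1 a2 p0 p1 p2 r s S N q : ℝ} (ha0 : 0 ≤ a0) (ha1 : 0 ≤ a1) (ha2 : 0 ≤ a2)
    (hp0 : 0 ≤ p0) (hp1 : 0 ≤ p1) (hp2 : 0 ≤ p2) (hr0 : p0 ≤ r) (hr1 : p1 ≤ r) (hr2 : p2 ≤ r)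
    (hr : 14400 * r ^ 2 = q) (hq : q = N ^ 2 + S) (hN : 0 ≤ N) (hNa : N ^ 2 = a0 ^ 2 + a1 ^ 2 + a2 ^ 2)
    (hS : 0 ≤ S) (hs : 0 ≤ s) (hNs : N ≤ s) (hSs : S ≤ s ^ 2) :
    (a0 - (p0 + p1 + p2) - p0) ^ 2 + (a1 - (p0 + p1 + p2) - p1) ^ 2 +
      (a2 - (p0 + p1 + p2) - p2) ^ 2 ≤ q ∧
    N ^ 2 ≤ (a0 - (p0 + p1 + p2) - p0) ^ 2 + (a1 - (p0 + p1 + p2) - p1) ^ 2 +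
      (a2 - (p0 + p1 + p2) - p2) ^ 2 + s ^ 2 / 2 := by
  obtain ⟨X, hX⟩ : ∃ X, X = p0 + p1 + p2 := ⟨_, rfl⟩
  rw [← hX]
  have hX0 : 0 ≤ X := by linarith
  have hXr : X ≤ 3 * r := by linarith
  have hr0' : 0 ≤ r := hp0.trans hr0
  have hNle : N ≤ a0 + a1 + a2 := by
    refine le_of_sq_le_sq ?_ (by positivity)
    nlinarith [mul_nonneg ha0 ha1, mul_nonneg ha0 ha2, mul_nonneg ha1 ha2]
  have hleN : a0 + a1 + a2 ≤ 2 * N := by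
    refine le_of_sq_le_sq ?_ (by positivity)
    nlinarith [sq_nonneg (a0 - a1), sq_nonneg (a0 - a2), sq_nonneg (a1 - a2)]
  have e : (a0 - X - p0) ^ 2 + (a1 - X - p1) ^ 2 + (a2 - X - p2) ^ 2 =
      N ^ 2 - 2 * ((a0 + a1 + a2) * X + (a0 * p0 + a1 * p1 + a2 * p2)) +
        (5 * X ^ 2 + (p0 ^ 2 + p1 ^ 2 + p2 ^ 2)) := by
    rw [hNa, hX]; ring
  have hX2 : X ^ 2 ≤ 9 * r ^ 2 := by nlinarith
  have hpp : p0 ^ 2 + p1 ^ 2 + p2 ^ 2 ≤ X ^ 2 := by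
    rw [hX]; nlinarith [mul_nonneg hp0 hp1, mul_nonneg hp0 hp2, mul_nonneg hp1 hp2]
  have hap : 0 ≤ a0 * p0 + a1 * p1 + a2 * p2 := by positivity
  have hap2 : a0 * p0 + a1 * p1 + a2 * p2 ≤ (a0 + a1 + a2) * X := by
    rw [hX]
    nlinarith [mul_nonneg ha0 hp1, mul_nonneg ha0 hp2, mul_nonneg ha1 hp0, mul_nonneg ha1 hp2,
      mul_nonneg ha2 hp0, mul_nonneg ha2 hp1]
  have hNX : N * X ≤ (a0 + a1 + a2) * X := mul_le_mul_of_nonneg_right hNle hX0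
  have hNX2 : (a0 + a1 + a2) * X ≤ 2 * N * X := mul_le_mul_of_nonneg_right hleN hX0
  rw [e]
  constructor
  · rcases le_total (3 * X) N with h | h
    · have h3 := mul_le_mul_of_nonneg_right h hX0
      have h4 : 3 * X * X = 3 * X ^ 2 := by ring
      linarith
    · have h3 := mul_nonneg hN hX0
      have h4 := pow_le_pow_left₀ hN h 2
      have h5 : (3 * X) ^ 2 = 9 * X ^ 2 := by ring
      linarith [sq_nonneg X]
  · have h1 : N * X ≤ s * X := mul_le_mul_of_nonneg_right hNs hX0
    have h2 : r ≤ s / 80 := by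
      have hNs2 : N ^ 2 ≤ s ^ 2 := pow_le_pow_left₀ hN hNs 2
      refine le_of_sq_le_sq ?_ (by positivity)
      rw [div_pow]; linarith [sq_nonneg s]
    have h3 : s * X ≤ s * (3 * s / 80) := mul_le_mul_of_nonneg_left (by linarith) hs
    have h4 : s * (3 * s / 80) = 3 / 80 * s ^ 2 := by ring
    linarith [sq_nonneg s, sq_nonneg X, sq_nonneg p0, sq_nonneg p1, sq_nonneg p2]

lemma sobQ_pos {y : Fin 3 → ℝ} {t s : ℝ} (hs : 0 < s) (hst : s < t) : 0 < sobQ y t s := by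
  have : s ^ 2 / t ^ 2 < 1 := by
    rw [div_lt_one (by nlinarith)]; nlinarith
  unfold sobQ
  have := nsq_nonneg y
  apply mul_pos (by positivity); linarith

lemma ray_eq_hyp {c : ℝ} {y : Fin 3 → ℝ} (hcy : c ^ 2 = 1 - nsq y) {s : ℝ} (hs : 0 ≤ s) :
    ray y s = hyp (c ^ 2 * s ^ 2) (s • y) := by
  have : c ^ 2 * s ^ 2 + nsq (s • y) = s ^ 2 := by
    rw [hcy]; simp only [nsq, Pi.smul_apply, smul_eq_mul]; ring
  ext i
  refine Fin.cases ?_ (fun k => ?_) i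
  · simp [ray, hyp, this, Real.sqrt_sq hs]
  · simp [ray, hyp]

lemma ray_sobolev {f : (Fin 4 → ℝ) → ℝ} (hf : ContDiff ℝ (⊤ : ℕ∞) f) {c : ℝ} {y : Fin 3 → ℝ}
    (hc : 0 < c) (hcy : c ^ 2 = 1 - nsq y) {t s : ℝ} (hs : 0 < s) (hst : s < t) :
    ENNReal.ofReal (Real.sqrt (sobQ y t s) / 120) ^ 3 * ‖f (ray y s)‖ₑ ≤
      ∫⁻ x in sobReg c y t s, boostSum f (hyp (c ^ 2 * s ^ 2) x) := by
  have hq := sobQ_pos (y := y) hs hst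
  have hr : 0 < Real.sqrt (sobQ y t s) / 120 := by positivity
  have hr2 : 14400 * (Real.sqrt (sobQ y t s) / 120) ^ 2 = sobQ y t s := by
    rw [div_pow, Real.sq_sqrt hq.le]; ring
  set ε : Fin 3 → ℝ := fun k => if 0 ≤ y k then 1 else -1 with hεd
  have hε : ∀ k, |ε k| = 1 := by intro k; rw [hεd]; dsimp only; split_ifs <;> simp
  have hεs : ∀ k, ε k ^ 2 = 1 := fun k => by rw [← sq_abs, hε]; norm_num
  have hεy : ∀ k, y k = ε k * |y k| := by
    intro k; rw [hεd]; dsimp only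
    split_ifs with h
    · rw [abs_of_nonneg h, one_mul]
    · rw [abs_of_neg (not_le.1 h)]; ring
  have ht2 : 0 < t ^ 2 := by nlinarith
  have hst1 : s ^ 2 / t ^ 2 ≤ 1 := by rw [div_le_one ht2]; nlinarith
  have hst0 : 0 ≤ s ^ 2 / t ^ 2 := by positivity
  have hN : Real.sqrt (nsq y) ^ 2 = nsq y := Real.sq_sqrt (nsq_nonneg y)
  have hy1 : Real.sqrt (nsq y) ≤ 1 := by
    rw [Real.sqrt_le_one]; nlinarith [sq_nonneg c]
  rw [ray_eq_hyp hcy hs.le]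
  refine hyp_sobolev hf (by positivity) hr hε (measurableSet_sobReg c y t s) ?_ ?_
  · intro ξ hξ
    obtain ⟨h1, h2⟩ := sobReg_arith (a0 := s * |y 0|) (a1 := s * |y 1|) (a2 := s * |y 2|)
      (p0 := ξ 0) (p1 := ξ 1) (p2 := ξ 2) (r := Real.sqrt (sobQ y t s) / 120) (s := s)
      (S := s ^ 2 * (1 - s ^ 2 / t ^ 2)) (N := s * Real.sqrt (nsq y)) (q := sobQ y t s)
      (by positivity) (by positivity) (by positivity) (hξ 0).1 (hξ 1).1 (hξ 2).1
      (hξ 0).2 (hξ 1).2 (hξ 2).2 hr2 (by rw [mul_pow, hN]; unfold sobQ; ring) (by positivity)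
      (by rw [mul_pow, hN]; simp only [nsq, mul_pow, sq_abs]; ring)
      (mul_nonneg (by positivity) (by linarith)) hs.le (by nlinarith) (by nlinarith [sq_nonneg s])
    have hk : nsq (s • y - (coneMat ε).mulVec ξ) =
        (s * |y 0| - (ξ 0 + ξ 1 + ξ 2) - ξ 0) ^ 2 + (s * |y 1| - (ξ 0 + ξ 1 + ξ 2) - ξ 1) ^ 2 +
        (s * |y 2| - (ξ 0 + ξ 1 + ξ 2) - ξ 2) ^ 2 := by
      have hc : ∀ k, (s • y - (coneMat ε).mulVec ξ) k =
          ε k * (s * |y k| - (ξ 0 + ξ 1 + ξ 2) - ξ k) := by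
        intro k
        have : (s • y - (coneMat ε).mulVec ξ) k = s * y k - (coneMat ε).mulVec ξ k := rfl
        rw [this, hεy k, abs_mul, hε, abs_abs]
        fin_cases k <;>
          simp [Matrix.mulVec, dotProduct, Fin.sum_univ_three, coneMat] <;> ring
      simp only [nsq, hc, mul_pow, hεs, one_mul]
    rw [← hk] at h1 h2
    refine ⟨h1, ?_⟩
    rw [mul_pow, hN] at h2
    have : c ^ 2 * s ^ 2 = s ^ 2 - s ^ 2 * nsq y := by rw [hcy]; ring
    nlinarith
  · rintro x ⟨-, hx⟩
    have : sobQ y t s ≤ 2 * s ^ 2 := by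
      unfold sobQ; nlinarith [sq_nonneg s, sq_nonneg c]
    nlinarith

/-- The kernel dominating the weight in the Sobolev inequality. -/
def sobKer (c t τ : ℝ) (x : Fin 3 → ℝ) : ENNReal :=
  if 1 / 2 ≤ c ^ 2 then
    ENNReal.ofReal ((Real.sqrt ((τ ^ 2 * (1 - τ / t) + nsq x) / 4))⁻¹ ^ 3)
  else if τ ^ 2 * (1 - 4 * c ^ 2) ≤ nsq x ∧ nsq x ≤ τ ^ 2 then
    ENNReal.ofReal ((τ / 2)⁻¹ ^ 3) else 0

lemma measurable_sobKer (c t : ℝ) :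
    Measurable fun p : ℝ × (Fin 3 → ℝ) => sobKer c t p.1 p.2 := by
  have hn : Measurable fun p : ℝ × (Fin 3 → ℝ) => nsq p.2 := continuous_nsq.measurable.comp measurable_snd
  unfold sobKer
  split_ifs
  · fun_prop
  · refine Measurable.ite ?_ (by fun_prop) measurable_const
    exact (measurableSet_le (by fun_prop) hn).inter (measurableSet_le hn (by fun_prop))

section region

variable {c : ℝ} {y : Fin 3 → ℝ} {t s : ℝ} {x : Fin 3 → ℝ}

lemma sobReg_le (hcy : c ^ 2 = 1 - nsq y) (hx : x ∈ sobReg c y t s) :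
    c ^ 2 * s ^ 2 + nsq x ≤ s ^ 2 * (2 - s ^ 2 / t ^ 2) := by
  have := hx.1
  rw [hcy]; unfold sobQ at this; linarith

lemma sobReg_tau (hcy : c ^ 2 = 1 - nsq y) (hs : 0 < s) (hst : s < t)
    (hx : x ∈ sobReg c y t s) :
    s / 2 ≤ Real.sqrt (c ^ 2 * s ^ 2 + nsq x) ∧ Real.sqrt (c ^ 2 * s ^ 2 + nsq x) ≤ 2 * s ∧
      Real.sqrt (c ^ 2 * s ^ 2 + nsq x) < t := by
  have h1 := sobReg_le hcy hx
  have ht : 0 < t := hs.trans hst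
  have hq : s ^ 2 * (s ^ 2 / t ^ 2) = (s ^ 2 / t) ^ 2 := by field_simp
  have hlt : s ^ 2 / t < t := by rw [div_lt_iff₀ ht]; nlinarith
  refine ⟨Real.le_sqrt_of_sq_le ?_, ?_, ?_⟩
  · have := hx.2; rw [div_pow]; linarith
  · rw [Real.sqrt_le_left (by positivity)]
    nlinarith [sq_nonneg (s ^ 2 / t), sq_nonneg s]
  · rw [Real.sqrt_lt' ht]
    have e : (t - s ^ 2 / t) ^ 2 = t ^ 2 - 2 * s ^ 2 + (s ^ 2 / t) ^ 2 := by
      field_simp; ring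
    have : 0 < (t - s ^ 2 / t) ^ 2 := by apply pow_pos; linarith
    linarith

lemma inv_sqrt_sobQ_le (hc : 0 < c) (hcy : c ^ 2 = 1 - nsq y) (hs : 0 < s) (hst : s < t)
    (hx : x ∈ sobReg c y t s) :
    ENNReal.ofReal ((Real.sqrt (sobQ y t s))⁻¹ ^ 3) ≤
      sobKer c t (Real.sqrt (c ^ 2 * s ^ 2 + nsq x)) x := by
  obtain ⟨h1, h2, h3⟩ := sobReg_tau hcy hs hst hx
  have hT : Real.sqrt (c ^ 2 * s ^ 2 + nsq x) ^ 2 = c ^ 2 * s ^ 2 + nsq x :=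
    Real.sq_sqrt (by have := nsq_nonneg x; positivity)
  have hT2 := sobReg_le hcy hx
  have hxr := hx.2
  set τ := Real.sqrt (c ^ 2 * s ^ 2 + nsq x)
  have hτ : 0 < τ := by linarith
  have ht : 0 < t := hs.trans hst
  have hy0 := nsq_nonneg y
  have hst0 : 0 ≤ s ^ 2 / t ^ 2 := by positivity
  have hst1 : s ^ 2 / t ^ 2 ≤ 1 := by rw [div_le_one (by positivity)]; nlinarith
  have hτt : τ / t < 1 := by rw [div_lt_one ht]; exact h3
  have hτt0 : 0 < τ / t := by positivity
  have hx0 := nsq_nonneg x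
  have hT3 : τ ^ 2 ≤ 2 * s ^ 2 := by nlinarith [sq_nonneg s]
  unfold sobKer
  split_ifs with hc2 hsh
  · refine ENNReal.ofReal_le_ofReal (pow_le_pow_left₀ (by positivity) (inv_anti₀ ?_ ?_) 3)
    · apply Real.sqrt_pos.2
      have : 0 < τ ^ 2 * (1 - τ / t) := mul_pos (by positivity) (by linarith)
      linarith
    · apply Real.sqrt_le_sqrt
      have hkey : s ^ 2 / t ^ 2 ≤ τ / t + nsq y := by
        have : s ^ 2 / t ^ 2 ≤ (τ / t) ^ 2 + s ^ 2 / t ^ 2 * nsq y := by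
          rw [div_pow, ← sub_nonneg]
          have : τ ^ 2 / t ^ 2 + s ^ 2 / t ^ 2 * nsq y - s ^ 2 / t ^ 2 = nsq x / t ^ 2 := by
            rw [hT, hcy]; field_simp; ring
          rw [this]; positivity
        nlinarith
      have hq1 : s ^ 2 * (1 - τ / t) ≤ sobQ y t s := by
        unfold sobQ
        exact mul_le_mul_of_nonneg_left (by linarith) (by positivity)
      have hq2 := hx.1
      nlinarith [mul_le_mul_of_nonneg_right hT3 (by linarith : 0 ≤ 1 - τ / t)]
  · refine ENNReal.ofReal_le_ofReal (pow_le_pow_left₀ (by positivity) (inv_anti₀ (by positivity) ?_) 3)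
    apply Real.le_sqrt_of_sq_le
    unfold sobQ
    have : 1 / 2 ≤ nsq y + 1 - s ^ 2 / t ^ 2 := by linarith
    nlinarith [mul_le_mul_of_nonneg_left this (sq_nonneg s)]
  · exfalso
    apply hsh
    rw [hT]
    have : 0 ≤ c ^ 2 := by positivity
    exact ⟨by nlinarith, by nlinarith [sq_nonneg s]⟩

end region

lemma lintegral_inv_add_sq {A : ℝ} (hA : 0 < A) :
    ∫⁻ u : ℝ, ENNReal.ofReal ((A + u ^ 2)⁻¹) = ENNReal.ofReal (Real.pi * (Real.sqrt A)⁻¹) := by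
  have hsA := Real.sqrt_pos.2 hA
  have e : ∀ u : ℝ, (A + u ^ 2)⁻¹ = A⁻¹ * (1 + ((Real.sqrt A)⁻¹ * u) ^ 2)⁻¹ := by
    intro u
    rw [mul_pow, inv_pow, Real.sq_sqrt hA.le, ← mul_inv]
    congr 1; field_simp
  have hi : Integrable fun u : ℝ => (A + u ^ 2)⁻¹ := by
    simp only [e]
    exact (integrable_inv_one_add_sq.comp_mul_left' (inv_ne_zero hsA.ne')).const_mul _
  rw [← ofReal_integral_eq_lintegral_ofReal hi
    (Filter.Eventually.of_forall fun u => by positivity)]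
  congr 1
  simp only [e, integral_const_mul]
  rw [Measure.integral_comp_mul_left (fun v : ℝ => (1 + v ^ 2)⁻¹), integral_univ_inv_one_add_sq,
    inv_inv, abs_of_pos hsA, smul_eq_mul]
  have : A⁻¹ = (Real.sqrt A)⁻¹ ^ 2 := by rw [inv_pow, Real.sq_sqrt hA.le]
  rw [this]; field_simp

lemma lintegral_inv_add_nsq {A : ℝ} (hA : 0 < A) :
    ∫⁻ x : Fin 3 → ℝ, ENNReal.ofReal ((A + nsq x)⁻¹ ^ 3) ≤
      ENNReal.ofReal ((Real.pi * (Real.sqrt A)⁻¹) ^ 3) := by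
  have hm : Measurable fun x : Fin 3 → ℝ => ENNReal.ofReal ((A + nsq x)⁻¹ ^ 3) := by
    have := continuous_nsq.measurable
    fun_prop
  rw [lintegral_fin_three hm]
  have hle : ∀ a b c : ℝ, ENNReal.ofReal ((A + nsq ![a, b, c])⁻¹ ^ 3) ≤
      ENNReal.ofReal ((A + a ^ 2)⁻¹) * (ENNReal.ofReal ((A + b ^ 2)⁻¹) *
        ENNReal.ofReal ((A + c ^ 2)⁻¹)) := by
    intro a b c
    rw [← ENNReal.ofReal_mul (by positivity), ← ENNReal.ofReal_mul (by positivity)]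
    refine ENNReal.ofReal_le_ofReal ?_
    have hn : nsq ![a, b, c] = a ^ 2 + b ^ 2 + c ^ 2 := by simp [nsq]
    have h0 : (A + nsq ![a, b, c])⁻¹ ^ 3 = (A + nsq ![a, b, c])⁻¹ *
      ((A + nsq ![a, b, c])⁻¹ * (A + nsq ![a, b, c])⁻¹) := by ring
    rw [h0, hn]
    gcongr
    all_goals nlinarith [sq_nonneg a, sq_nonneg b, sq_nonneg c]
  refine (lintegral_mono fun a => lintegral_mono fun b => lintegral_mono fun c => hle a b c).trans ?_
  have h1 := lintegral_inv_add_sq hA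
  have hm1 : Measurable fun u : ℝ => ENNReal.ofReal ((A + u ^ 2)⁻¹) := by fun_prop
  simp only [lintegral_const_mul' _ _ ENNReal.ofReal_ne_top, lintegral_mul_const _ hm1, h1]
  rw [← ENNReal.ofReal_mul (by positivity), ← ENNReal.ofReal_mul (by positivity)]
  apply le_of_eq; congr 1; ring

open scoped Pointwise in
lemma volume_nsq_le {ρ : ℝ} (hρ : 0 < ρ) : volume {x : Fin 3 → ℝ | nsq x ≤ ρ ^ 2} =
    ENNReal.ofReal (ρ ^ 3) * volume {x : Fin 3 → ℝ | nsq x ≤ 1} := by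
  have e : {x : Fin 3 → ℝ | nsq x ≤ ρ ^ 2} = ρ • {x : Fin 3 → ℝ | nsq x ≤ 1} := by
    ext x
    rw [Set.mem_smul_set_iff_inv_smul_mem₀ hρ.ne']
    have : nsq (ρ⁻¹ • x) = nsq x / ρ ^ 2 := by
      simp only [nsq, Pi.smul_apply, smul_eq_mul]; field_simp
    simp only [Set.mem_ofPred_eq, this, div_le_one (by positivity : 0 < ρ ^ 2)]
  rw [e, Measure.addHaar_smul]
  simp [abs_of_pos hρ]

lemma volume_nsq_le_one : volume {x : Fin 3 → ℝ | nsq x ≤ 1} ≤ ENNReal.ofReal 8 := by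
  have h : {x : Fin 3 → ℝ | nsq x ≤ 1} ⊆ Set.Icc (fun _ => -1) (fun _ => 1) := by
    intro x hx
    have hx : x 0 ^ 2 + x 1 ^ 2 + x 2 ^ 2 ≤ 1 := hx
    have : ∀ k, |x k| ≤ 1 := by
      intro k
      rw [← sq_le_one_iff_abs_le_one]
      have h3 : ∑ j, x j ^ 2 ≤ 1 := by rw [Fin.sum_univ_three]; exact hx
      exact (Finset.single_le_sum (f := fun j => x j ^ 2) (fun j _ => sq_nonneg _)
        (Finset.mem_univ k)).trans h3
    exact ⟨fun k => (abs_le.1 (this k)).1, fun k => (abs_le.1 (this k)).2⟩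
  refine (measure_mono h).trans ?_
  rw [Real.volume_Icc_pi]
  simp only [Finset.prod_const, Finset.card_univ, Fintype.card_fin]
  rw [← ENNReal.ofReal_pow (by norm_num)]; norm_num

lemma volume_shell {c τ : ℝ} (hc : 0 < c) (hτ : 0 < τ) :
    volume {x : Fin 3 → ℝ | τ ^ 2 * (1 - 4 * c ^ 2) ≤ nsq x ∧ nsq x ≤ τ ^ 2} ≤
      ENNReal.ofReal (96 * c ^ 2 * τ ^ 3) := by
  have hV := volume_nsq_le_one
  set V := volume {x : Fin 3 → ℝ | nsq x ≤ 1}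
  have hτ3 : 0 < τ ^ 3 := by positivity
  rcases le_or_gt 1 (4 * c ^ 2) with h | h
  · refine (measure_mono (t := {x | nsq x ≤ τ ^ 2}) fun x hx => hx.2).trans ?_
    rw [volume_nsq_le hτ]
    refine (mul_le_mul_right hV _).trans ?_
    rw [← ENNReal.ofReal_mul hτ3.le]
    exact ENNReal.ofReal_le_ofReal (by nlinarith)
  · obtain ⟨u, hu⟩ : ∃ u, u = 1 - 4 * c ^ 2 := ⟨_, rfl⟩
    have hc2 : 0 < c ^ 2 := by positivity
    have hu0 : 0 < u := by linarith
    have hu1 : u < 1 := by linarith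
    have hsub : {x : Fin 3 → ℝ | τ ^ 2 * (1 - 4 * c ^ 2) ≤ nsq x ∧ nsq x ≤ τ ^ 2} ⊆
        {x | nsq x ≤ τ ^ 2} \ {x | nsq x ≤ (τ * u) ^ 2} := by
      rintro x ⟨h1, h2⟩
      refine ⟨h2, fun h3 => ?_⟩
      rw [← hu] at h1
      have h3 : nsq x ≤ (τ * u) ^ 2 := h3
      have : τ ^ 2 * u ^ 2 < τ ^ 2 * u := mul_lt_mul_of_pos_left (by nlinarith) (by positivity)
      rw [mul_pow] at h3; linarith
    refine (measure_mono hsub).trans ?_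
    have hVt : V ≠ ⊤ := (hV.trans_lt ENNReal.ofReal_lt_top).ne
    have hmeas : MeasurableSet {x : Fin 3 → ℝ | nsq x ≤ (τ * u) ^ 2} :=
      measurableSet_le continuous_nsq.measurable measurable_const
    have hsub2 : {x : Fin 3 → ℝ | nsq x ≤ (τ * u) ^ 2} ⊆ {x | nsq x ≤ τ ^ 2} := by
      intro x hx
      have h2 : (τ * u) ^ 2 ≤ τ ^ 2 := pow_le_pow_left₀ (by positivity) (by nlinarith) 2
      have hx : nsq x ≤ (τ * u) ^ 2 := hx
      exact hx.trans h2
    rw [measure_sdiff hsub2 hmeas.nullMeasurableSet, volume_nsq_le hτ,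
      volume_nsq_le (by positivity : 0 < τ * u)]
    · rw [← ENNReal.sub_mul (fun _ _ => hVt), ← ENNReal.ofReal_sub _ (by positivity)]
      refine (mul_le_mul_right hV _).trans ?_
      have h3 : τ ^ 3 - (τ * u) ^ 3 ≤ τ ^ 3 * (12 * c ^ 2) := by
        have : 1 - u ^ 3 ≤ 12 * c ^ 2 := by
          have : 12 * c ^ 2 = 3 * (1 - u) := by rw [hu]; ring
          rw [this]; nlinarith [sq_nonneg (1 - u), mul_nonneg hu0.le (sq_nonneg (1 - u))]
        have e : τ ^ 3 - (τ * u) ^ 3 = τ ^ 3 * (1 - u ^ 3) := by ring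
        rw [e]; exact mul_le_mul_of_nonneg_left this hτ3.le
      rw [← ENNReal.ofReal_mul' (by norm_num)]
      exact ENNReal.ofReal_le_ofReal (by linarith)
    · rw [volume_nsq_le (by positivity : 0 < τ * u)]
      exact ENNReal.mul_ne_top ENNReal.ofReal_ne_top hVt

lemma rpow_neg_three_quarters_sq {p : ℝ} (hp : 0 < p) :
    (p ^ (-(3:ℝ) / 4)) ^ 2 = (Real.sqrt p)⁻¹ ^ 3 := by
  rw [Real.sqrt_eq_rpow, ← Real.rpow_neg hp.le, ← Real.rpow_natCast, ← Real.rpow_natCast,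
    ← Real.rpow_mul hp.le, ← Real.rpow_mul hp.le]
  norm_num

lemma lintegral_sobKer_sq {c t τ : ℝ} (hc : 0 < c) (hτ : 0 < τ) (hτt : τ < t) :
    ∫⁻ x, sobKer c t τ x ^ 2 ≤
      ENNReal.ofReal ((80 * c * (Real.sqrt τ)⁻¹ ^ 3 * (1 - τ / t) ^ (-(3:ℝ) / 4)) ^ 2) := by
  have ht : 0 < t := hτ.trans hτt
  have hp : 0 < 1 - τ / t := by
    have : τ / t < 1 := by rw [div_lt_one ht]; exact hτt
    linarith
  set p := 1 - τ / t with hpd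
  have hp1 : p ≤ 1 := by have : 0 < τ / t := by positivity
                         linarith
  have hR : (80 * c * (Real.sqrt τ)⁻¹ ^ 3 * p ^ (-(3:ℝ) / 4)) ^ 2 =
      6400 * c ^ 2 * τ⁻¹ ^ 3 * (Real.sqrt p)⁻¹ ^ 3 := by
    have : ((Real.sqrt τ)⁻¹ ^ 3) ^ 2 = τ⁻¹ ^ 3 := by
      rw [← pow_mul, mul_comm 3 2, pow_mul, inv_pow, Real.sq_sqrt hτ.le]
    rw [mul_pow, rpow_neg_three_quarters_sq hp, mul_pow, this, mul_pow]; norm_num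
  rw [hR]
  by_cases hc2 : 1 / 2 ≤ c ^ 2
  · have hA : 0 < τ ^ 2 * p := by positivity
    have e : ∀ x, sobKer c t τ x ^ 2 =
        ENNReal.ofReal 64 * ENNReal.ofReal ((τ ^ 2 * p + nsq x)⁻¹ ^ 3) := by
      intro x
      have h0 : 0 < τ ^ 2 * p + nsq x := by linarith [nsq_nonneg x]
      rw [sobKer, if_pos hc2, ← ENNReal.ofReal_pow (by positivity),
        ← ENNReal.ofReal_mul (by norm_num), ← hpd]
      congr 1
      rw [← pow_mul, mul_comm 3 2, pow_mul, inv_pow, Real.sq_sqrt (by positivity)]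
      field_simp; norm_num
    simp only [e]
    rw [lintegral_const_mul' _ _ ENNReal.ofReal_ne_top]
    refine (mul_le_mul_right (lintegral_inv_add_nsq hA) _).trans ?_
    rw [← ENNReal.ofReal_mul (by norm_num)]
    refine ENNReal.ofReal_le_ofReal ?_
    rw [Real.sqrt_mul (by positivity), Real.sqrt_sq hτ.le, mul_inv, mul_pow, mul_pow]
    have hpi : Real.pi ^ 3 ≤ 50 := by
      have h1 := Real.pi_lt_d2
      calc Real.pi ^ 3 ≤ 3.15 ^ 3 := pow_le_pow_left₀ Real.pi_pos.le h1.le 3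
        _ ≤ 50 := by norm_num
    have hX : 0 ≤ τ⁻¹ ^ 3 * (Real.sqrt p)⁻¹ ^ 3 := by positivity
    have h64 : 64 * Real.pi ^ 3 ≤ 6400 * c ^ 2 := by linarith
    calc 64 * (Real.pi ^ 3 * (τ⁻¹ ^ 3 * (Real.sqrt p)⁻¹ ^ 3)) =
        64 * Real.pi ^ 3 * (τ⁻¹ ^ 3 * (Real.sqrt p)⁻¹ ^ 3) := by ring
      _ ≤ 6400 * c ^ 2 * (τ⁻¹ ^ 3 * (Real.sqrt p)⁻¹ ^ 3) := mul_le_mul_of_nonneg_right h64 hX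
      _ = _ := by ring
  · have e : ∀ x, sobKer c t τ x ^ 2 =
        {x : Fin 3 → ℝ | τ ^ 2 * (1 - 4 * c ^ 2) ≤ nsq x ∧ nsq x ≤ τ ^ 2}.indicator
          (fun _ => ENNReal.ofReal (64 * (τ⁻¹ ^ 3) ^ 2)) x := by
      intro x
      rw [sobKer, if_neg hc2]
      by_cases hx : τ ^ 2 * (1 - 4 * c ^ 2) ≤ nsq x ∧ nsq x ≤ τ ^ 2
      · rw [if_pos hx, Set.indicator_of_mem (by exact hx), ← ENNReal.ofReal_pow (by positivity)]
        congr 1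
        field_simp; norm_num
      · rw [if_neg hx, Set.indicator_of_notMem (by exact hx)]; simp
    simp only [e]
    have hms : MeasurableSet
        {x : Fin 3 → ℝ | τ ^ 2 * (1 - 4 * c ^ 2) ≤ nsq x ∧ nsq x ≤ τ ^ 2} :=
      (measurableSet_le measurable_const continuous_nsq.measurable).inter
        (measurableSet_le continuous_nsq.measurable measurable_const)
    rw [lintegral_indicator_const hms]
    refine (mul_le_mul_right (volume_shell hc hτ) _).trans ?_
    rw [← ENNReal.ofReal_mul (by positivity)]
    refine ENNReal.ofReal_le_ofReal ?_
    have h1 : 1 ≤ (Real.sqrt p)⁻¹ ^ 3 :=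
      one_le_pow₀ ((one_le_inv₀ (Real.sqrt_pos.2 hp)).2 (Real.sqrt_le_one.2 hp1))
    have h2 : 64 * (τ⁻¹ ^ 3) ^ 2 * (96 * c ^ 2 * τ ^ 3) = 6144 * c ^ 2 * τ⁻¹ ^ 3 := by
      field_simp; norm_num
    rw [h2]
    have h3 : 6144 * c ^ 2 * τ⁻¹ ^ 3 ≤ 6400 * c ^ 2 * τ⁻¹ ^ 3 := by gcongr; norm_num
    exact h3.trans (le_mul_of_one_le_right (by positivity) h1)

/-- The sum of the `L²` norms of all products of at most three boosts applied to `f`. -/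
def boostNorm (f : (Fin 4 → ℝ) → ℝ) (τ : ℝ) : ENNReal :=
  ∑ i, ∑ j, ∑ k, ENNReal.ofReal
    (L2x (opIter GammaField (boostWord k ++ (boostWord j ++ boostWord i)) f) τ)

lemma lintegral_mul_boostSum_le {B : ℝ} (hB : 0 < B) {f : (Fin 4 → ℝ) → ℝ}
    (hf : ContDiff ℝ (⊤ : ℕ∞) f) (h : ConeSupp B f) {τ D : ℝ} (hD : 0 ≤ D)
    {K : (Fin 3 → ℝ) → ENNReal} (hKm : Measurable K)
    (hK : ∫⁻ x, K x ^ 2 ≤ ENNReal.ofReal (D ^ 2)) :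
    ∫⁻ x, K x * boostSum f (Fin.cons τ x) ≤ ENNReal.ofReal D * boostNorm f τ := by
  have hK : (∫⁻ x, K x ^ (2:ℝ)) ^ (1 / (2:ℝ)) ≤ ENNReal.ofReal D := by
    simp only [ENNReal.rpow_two]
    refine (ENNReal.rpow_le_rpow hK (by norm_num)).trans ?_
    rw [ENNReal.ofReal_rpow_of_nonneg (by positivity) (by norm_num), ← Real.sqrt_eq_rpow,
      Real.sqrt_sq hD]
  have hone : ∀ L, ∫⁻ x, K x * ‖opIter GammaField L f (Fin.cons τ x)‖ₑ ≤
        ENNReal.ofReal D * ENNReal.ofReal (L2x (opIter GammaField L f) τ) := by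
    intro L
    have hg := (smooth_opIter hf L).continuous
    have hgm : AEMeasurable (fun x : Fin 3 → ℝ => ‖opIter GammaField L f (Fin.cons τ x)‖ₑ)
      volume := (hg.comp (continuous_cons_right τ)).enorm.measurable.aemeasurable
    have := ENNReal.lintegral_mul_le_Lp_mul_Lq (volume : Measure (Fin 3 → ℝ))
      (Real.HolderConjugate.two_two) hKm.aemeasurable hgm
    rw [(ConeSupp.opIter hf h L).lintegral_sq hB hg τ] at this
    exact this.trans (mul_le_mul_left hK _)
  have hgm : ∀ L, Measurable (fun x : Fin 3 → ℝ =>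
      K x * ‖opIter GammaField L f (Fin.cons τ x)‖ₑ) := fun L =>
    hKm.mul ((smooth_opIter hf L).continuous.comp (continuous_cons_right τ)).enorm.measurable
  simp only [boostSum, boostNorm, Finset.mul_sum]
  rw [lintegral_finsetSum _ fun i _ => Finset.measurable_sum _ fun j _ =>
    Finset.measurable_sum _ fun k _ => hgm _]
  refine Finset.sum_le_sum fun i _ => ?_
  rw [lintegral_finsetSum _ fun j _ => Finset.measurable_sum _ fun k _ => hgm _]
  refine Finset.sum_le_sum fun j _ => ?_
  rw [lintegral_finsetSum _ fun k _ => hgm _]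
  exact Finset.sum_le_sum fun k _ => hone _

lemma lintegral_hyperbolic_time_le {c : ℝ} (hc : 0 < c) {n : ℝ} (hn : 0 ≤ n) (φ : ℝ → ENNReal) :
    ∫⁻ s in Set.Ioi (0:ℝ), ENNReal.ofReal (c ^ 2 * s / Real.sqrt (c ^ 2 * s ^ 2 + n)) *
      φ (Real.sqrt (c ^ 2 * s ^ 2 + n)) ≤ ∫⁻ τ, φ τ := by
  have hpos : ∀ s ∈ Set.Ioi (0:ℝ), 0 < c ^ 2 * s ^ 2 + n := fun s hs => by
    have : 0 < s := hs
    positivity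
  have hd : ∀ s ∈ Set.Ioi (0:ℝ), HasDerivWithinAt (fun s => Real.sqrt (c ^ 2 * s ^ 2 + n))
      (c ^ 2 * s / Real.sqrt (c ^ 2 * s ^ 2 + n)) (Set.Ioi 0) s := by
    intro s hs
    have h1 : HasDerivAt (fun s : ℝ => c ^ 2 * s ^ 2 + n) (c ^ 2 * (2 * s)) s := by
      simpa using (((hasDerivAt_id s).pow 2).const_mul (c ^ 2)).add_const n
    have h2 := (h1.sqrt (hpos s hs).ne').hasDerivWithinAt (s := Set.Ioi 0)
    refine h2.congr_deriv ?_
    have := (Real.sqrt_pos.2 (hpos s hs)).ne'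
    field_simp
  have hinj : Set.InjOn (fun s : ℝ => Real.sqrt (c ^ 2 * s ^ 2 + n)) (Set.Ioi 0) := by
    intro s hs s' hs' he
    have h1 := (Real.sqrt_inj (hpos s hs).le (hpos s' hs').le).1 he
    have h2 : s ^ 2 = s' ^ 2 := by
      have : c ^ 2 ≠ 0 := by positivity
      exact mul_left_cancel₀ this (by linarith)
    exact (pow_left_inj₀ (le_of_lt hs) (le_of_lt hs') two_ne_zero).1 h2
  have := lintegral_image_eq_lintegral_abs_deriv_mul measurableSet_Ioi hd hinj φ
  refine le_trans (le_of_eq ?_) (this.symm.le.trans (setLIntegral_le_lintegral _ _))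
  refine setLIntegral_congr_fun measurableSet_Ioi fun s hs => ?_
  have hs0 : 0 < s := hs
  rw [abs_of_nonneg (by positivity)]

lemma rpow_three_halves {s : ℝ} (hs : 0 ≤ s) : s ^ ((3:ℝ) / 2) = Real.sqrt s ^ 3 := by
  rw [Real.sqrt_eq_rpow, ← Real.rpow_natCast, ← Real.rpow_mul hs]; norm_num

lemma sob_weight_le {s τ c q m : ℝ} (a : ℕ) (hs : 0 < s) (hc : 0 < c) (h1 : s / 2 ≤ τ)
    (h2 : τ ≤ 2 * s) (hq : 0 < q) (hm : m = (Real.sqrt q)⁻¹ ^ 3) :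
    s ^ ((3:ℝ) / 2) * s⁻¹ ^ a * c * (Real.sqrt q / 120)⁻¹ ^ 3 ≤
      120 ^ 3 * 6 * 2 ^ a * (c ^ 2 * s / τ) * (Real.sqrt τ ^ 3 * τ⁻¹ ^ a * c⁻¹) * m := by
  have hτ : 0 < τ := by linarith
  rw [rpow_three_halves hs.le, hm]
  have e1 : (Real.sqrt q / 120)⁻¹ ^ 3 = 120 ^ 3 * (Real.sqrt q)⁻¹ ^ 3 := by
    rw [inv_div, div_pow, inv_pow]; ring
  rw [e1]
  have h3 : Real.sqrt s ^ 3 ≤ 3 * Real.sqrt τ ^ 3 := by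
    have : Real.sqrt s ≤ 1.42 * Real.sqrt τ := by
      rw [Real.sqrt_le_left (by positivity), mul_pow, Real.sq_sqrt hτ.le]; linarith
    calc Real.sqrt s ^ 3 ≤ (1.42 * Real.sqrt τ) ^ 3 := pow_le_pow_left₀ (Real.sqrt_nonneg _) this 3
      _ ≤ _ := by rw [mul_pow]; gcongr; norm_num
  have h4 : s⁻¹ ^ a ≤ 2 ^ a * τ⁻¹ ^ a := by
    rw [← mul_pow]
    refine pow_le_pow_left₀ (by positivity) ?_ a
    rw [inv_le_iff_one_le_mul₀ hs]
    rw [mul_comm, ← mul_assoc, ← div_eq_mul_inv, le_div_iff₀ hτ]; linarith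
  have h5 : c ≤ 2 * (c ^ 2 * s / τ) * c⁻¹ := by
    have : 2 * (c ^ 2 * s / τ) * c⁻¹ = c * (2 * s / τ) := by field_simp
    rw [this]
    refine le_mul_of_one_le_right hc.le ?_
    rw [le_div_iff₀ hτ]; linarith
  calc Real.sqrt s ^ 3 * s⁻¹ ^ a * c * (120 ^ 3 * (Real.sqrt q)⁻¹ ^ 3)
      ≤ 3 * Real.sqrt τ ^ 3 * (2 ^ a * τ⁻¹ ^ a) * (2 * (c ^ 2 * s / τ) * c⁻¹) *
        (120 ^ 3 * (Real.sqrt q)⁻¹ ^ 3) := by gcongr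
    _ = _ := by ring

lemma ray_weight_le {f : (Fin 4 → ℝ) → ℝ} (hf : ContDiff ℝ (⊤ : ℕ∞) f) {c : ℝ} {y : Fin 3 → ℝ}
    (hc : 0 < c) (hcy : c ^ 2 = 1 - nsq y) (a : ℕ) {s₀ t s : ℝ} (hs₀ : 0 < s₀)
    (hs : s ∈ Set.Ioo s₀ t) :
    ENNReal.ofReal (s ^ ((3:ℝ) / 2) * s⁻¹ ^ a * c) * ‖f (ray y s)‖ₑ ≤
      ENNReal.ofReal (120 ^ 3 * 6 * 2 ^ a) * ∫⁻ x,
        ENNReal.ofReal (c ^ 2 * s / Real.sqrt (c ^ 2 * s ^ 2 + nsq x)) *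
        (Set.Ioo (s₀ / 2) t).indicator (fun τ => ENNReal.ofReal (Real.sqrt τ ^ 3 * τ⁻¹ ^ a * c⁻¹) *
          (sobKer c t τ x * boostSum f (Fin.cons τ x))) (Real.sqrt (c ^ 2 * s ^ 2 + nsq x)) := by
  have hs0 : 0 < s := hs₀.trans hs.1
  have hq := sobQ_pos (y := y) hs0 hs.2
  have hr : 0 < Real.sqrt (sobQ y t s) / 120 := by positivity
  have hsob := ray_sobolev hf hc hcy hs0 hs.2
  have hr3 : ENNReal.ofReal (Real.sqrt (sobQ y t s) / 120) ^ 3 =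
      ENNReal.ofReal ((Real.sqrt (sobQ y t s) / 120) ^ 3) := (ENNReal.ofReal_pow hr.le 3).symm
  rw [hr3] at hsob
  have h1 : ‖f (ray y s)‖ₑ ≤ ENNReal.ofReal ((Real.sqrt (sobQ y t s) / 120)⁻¹ ^ 3) *
      ∫⁻ x in sobReg c y t s, boostSum f (hyp (c ^ 2 * s ^ 2) x) := by
    refine le_trans (le_of_eq ?_) (mul_le_mul_right hsob _)
    rw [← mul_assoc, ← ENNReal.ofReal_mul (by positivity), ← mul_pow, inv_mul_cancel₀ hr.ne',
      one_pow, ENNReal.ofReal_one, one_mul]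
  refine (mul_le_mul_right h1 _).trans ?_
  rw [← mul_assoc, ← ENNReal.ofReal_mul (by positivity),
    ← lintegral_const_mul' _ _ ENNReal.ofReal_ne_top,
    ← lintegral_const_mul' _ _ ENNReal.ofReal_ne_top]
  refine le_trans (setLIntegral_mono_ae' (measurableSet_sobReg c y t s)
    (Filter.Eventually.of_forall fun x hx => ?_)) (setLIntegral_le_lintegral _ _)
  obtain ⟨hτ1, hτ2, hτ3⟩ := sobReg_tau hcy hs0 hs.2 hx
  have hker := inv_sqrt_sobQ_le hc hcy hs0 hs.2 hx
  have hh : hyp (c ^ 2 * s ^ 2) x = Fin.cons (Real.sqrt (c ^ 2 * s ^ 2 + nsq x)) x := rfl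
  rw [hh]
  generalize Real.sqrt (c ^ 2 * s ^ 2 + nsq x) = τ at *
  have hτ0 : 0 < τ := by linarith
  have hτm : τ ∈ Set.Ioo (s₀ / 2) t := ⟨by linarith [hs.1], hτ3⟩
  rw [Set.indicator_of_mem hτm]
  have hw := sob_weight_le a hs0 hc hτ1 hτ2 hq rfl
  calc _ ≤ ENNReal.ofReal (120 ^ 3 * 6 * 2 ^ a * (c ^ 2 * s / τ) *
        (Real.sqrt τ ^ 3 * τ⁻¹ ^ a * c⁻¹) * (Real.sqrt (sobQ y t s))⁻¹ ^ 3) *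
          boostSum f (Fin.cons τ x) :=
        mul_le_mul_left (ENNReal.ofReal_le_ofReal hw) _
    _ = ENNReal.ofReal (120 ^ 3 * 6 * 2 ^ a) * (ENNReal.ofReal (c ^ 2 * s / τ) *
        (ENNReal.ofReal (Real.sqrt τ ^ 3 * τ⁻¹ ^ a * c⁻¹) *
          (ENNReal.ofReal ((Real.sqrt (sobQ y t s))⁻¹ ^ 3) * boostSum f (Fin.cons τ x)))) := by
        rw [ENNReal.ofReal_mul (by positivity), ENNReal.ofReal_mul (by positivity),
          ENNReal.ofReal_mul (by positivity)]
        ring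
    _ ≤ _ := by gcongr

/-- Weighted integrals along a ray are bounded by weighted integrals of `L²` norms. -/
lemma lintegral_ray_le {B : ℝ} (hB : 0 < B) {f : (Fin 4 → ℝ) → ℝ} (hf : ContDiff ℝ (⊤ : ℕ∞) f)
    (h : ConeSupp B f) {c : ℝ} {y : Fin 3 → ℝ} (hc : 0 < c) (hcy : c ^ 2 = 1 - nsq y) (a : ℕ)
    {s₀ t : ℝ} (hs₀ : 0 < s₀) :
    ∫⁻ s in Set.Ioo s₀ t, ENNReal.ofReal (s ^ ((3:ℝ) / 2) * s⁻¹ ^ a * c) * ‖f (ray y s)‖ₑ ≤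
      ENNReal.ofReal (120 ^ 3 * 480 * 2 ^ a) * ∫⁻ τ in Set.Ioo (s₀ / 2) t,
        ENNReal.ofReal (τ⁻¹ ^ a * (1 - τ / t) ^ (-(3:ℝ) / 4)) * boostNorm f τ := by
  set Φ : ℝ → (Fin 3 → ℝ) → ENNReal := fun τ x => (Set.Ioo (s₀ / 2) t).indicator
    (fun τ => ENNReal.ofReal (Real.sqrt τ ^ 3 * τ⁻¹ ^ a * c⁻¹) *
      (sobKer c t τ x * boostSum f (Fin.cons τ x))) τ with hΦ
  have hcons : Continuous fun p : ℝ × (Fin 3 → ℝ) => (Fin.cons p.1 p.2 : Fin 4 → ℝ) :=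
    continuous_pi fun i => Fin.cases continuous_fst
      (fun k => (continuous_apply k).comp continuous_snd) i
  have hΦm : Measurable fun p : ℝ × (Fin 3 → ℝ) => Φ p.1 p.2 := by
    have h1 : Measurable fun p : ℝ × (Fin 3 → ℝ) =>
        ENNReal.ofReal (Real.sqrt p.1 ^ 3 * p.1⁻¹ ^ a * c⁻¹) *
        (sobKer c t p.1 p.2 * boostSum f (Fin.cons p.1 p.2)) :=
      Measurable.mul (by fun_prop) ((measurable_sobKer c t).mul
        ((measurable_boostSum hf).comp hcons.measurable))
    exact h1.indicator (measurable_fst measurableSet_Ioo)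
  have hτm : Measurable fun p : ℝ × (Fin 3 → ℝ) => Real.sqrt (c ^ 2 * p.1 ^ 2 + nsq p.2) := by
    have hn : Measurable fun p : ℝ × (Fin 3 → ℝ) => nsq p.2 :=
      continuous_nsq.measurable.comp measurable_snd
    fun_prop
  have hJm : Measurable fun p : ℝ × (Fin 3 → ℝ) =>
      ENNReal.ofReal (c ^ 2 * p.1 / Real.sqrt (c ^ 2 * p.1 ^ 2 + nsq p.2)) *
        Φ (Real.sqrt (c ^ 2 * p.1 ^ 2 + nsq p.2)) p.2 :=
    Measurable.mul (by fun_prop) (hΦm.comp (hτm.prodMk measurable_snd))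
  have hsub : Set.Ioo s₀ t ⊆ Set.Ioi 0 := fun s hs => hs₀.trans hs.1
  calc _ ≤ ∫⁻ s in Set.Ioo s₀ t, ENNReal.ofReal (120 ^ 3 * 6 * 2 ^ a) * ∫⁻ x,
          ENNReal.ofReal (c ^ 2 * s / Real.sqrt (c ^ 2 * s ^ 2 + nsq x)) *
            Φ (Real.sqrt (c ^ 2 * s ^ 2 + nsq x)) x :=
        setLIntegral_mono_ae' measurableSet_Ioo (Filter.Eventually.of_forall fun s hs =>
          ray_weight_le hf hc hcy a hs₀ hs)
    _ = ENNReal.ofReal (120 ^ 3 * 6 * 2 ^ a) * ∫⁻ s in Set.Ioo s₀ t, ∫⁻ x,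
          ENNReal.ofReal (c ^ 2 * s / Real.sqrt (c ^ 2 * s ^ 2 + nsq x)) *
            Φ (Real.sqrt (c ^ 2 * s ^ 2 + nsq x)) x :=
        lintegral_const_mul' _ _ ENNReal.ofReal_ne_top
    _ ≤ ENNReal.ofReal (120 ^ 3 * 6 * 2 ^ a) * ∫⁻ s in Set.Ioi 0, ∫⁻ x,
          ENNReal.ofReal (c ^ 2 * s / Real.sqrt (c ^ 2 * s ^ 2 + nsq x)) *
            Φ (Real.sqrt (c ^ 2 * s ^ 2 + nsq x)) x := by
        gcongr
    _ = ENNReal.ofReal (120 ^ 3 * 6 * 2 ^ a) * ∫⁻ x, ∫⁻ s in Set.Ioi 0,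
          ENNReal.ofReal (c ^ 2 * s / Real.sqrt (c ^ 2 * s ^ 2 + nsq x)) *
            Φ (Real.sqrt (c ^ 2 * s ^ 2 + nsq x)) x := by
        rw [lintegral_lintegral_swap hJm.aemeasurable]
    _ ≤ ENNReal.ofReal (120 ^ 3 * 6 * 2 ^ a) * ∫⁻ x, ∫⁻ τ, Φ τ x := by
        refine mul_le_mul_right (lintegral_mono fun x => ?_) _
        exact lintegral_hyperbolic_time_le hc (nsq_nonneg x) fun τ => Φ τ x
    _ = ENNReal.ofReal (120 ^ 3 * 6 * 2 ^ a) * ∫⁻ τ, ∫⁻ x, Φ τ x := by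
        rw [← lintegral_lintegral_swap (f := Φ) hΦm.aemeasurable]
    _ ≤ ENNReal.ofReal (120 ^ 3 * 6 * 2 ^ a) * ∫⁻ τ in Set.Ioo (s₀ / 2) t,
          ENNReal.ofReal 80 * (ENNReal.ofReal (τ⁻¹ ^ a * (1 - τ / t) ^ (-(3:ℝ) / 4)) *
            boostNorm f τ) := by
        refine mul_le_mul_right ?_ _
        rw [← lintegral_indicator measurableSet_Ioo]
        refine lintegral_mono fun τ => ?_
        by_cases hτ : τ ∈ Set.Ioo (s₀ / 2) t
        · have hτ0 : 0 < τ := by linarith [hτ.1]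
          simp only [hΦ, Set.indicator_of_mem hτ]
          rw [lintegral_const_mul' _ _ ENNReal.ofReal_ne_top]
          have hp : 0 < 1 - τ / t := by
            have : τ / t < 1 := by rw [div_lt_one (hτ0.trans hτ.2)]; exact hτ.2
            linarith
          have hKm : Measurable (sobKer c t τ) :=
            Measurable.of_uncurry_left (f := sobKer c t) (measurable_sobKer c t)
          have hD : 0 ≤ 80 * c * (Real.sqrt τ)⁻¹ ^ 3 * (1 - τ / t) ^ (-(3:ℝ) / 4) := by positivity
          have hCS := lintegral_mul_boostSum_le hB hf h (τ := τ) hD hKm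
            (lintegral_sobKer_sq hc hτ0 hτ.2)
          refine (mul_le_mul_right hCS _).trans (le_of_eq ?_)
          rw [← mul_assoc, ← mul_assoc, ← ENNReal.ofReal_mul (by positivity),
            ← ENNReal.ofReal_mul (by norm_num)]
          congr 2
          have := (Real.sqrt_pos.2 hτ0).ne'
          field_simp
        · simp only [hΦ, Set.indicator_of_notMem hτ, lintegral_zero, le_refl]
    _ = _ := by
        rw [lintegral_const_mul' _ _ ENNReal.ofReal_ne_top, ← mul_assoc,
          ← ENNReal.ofReal_mul (by positivity)]
        congr 2; ring

/-! ### Conclusion -/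

lemma measurable_L2x {f : (Fin 4 → ℝ) → ℝ} (hf : Continuous f) : Measurable (L2x f) := by
  have hcons : Continuous fun p : ℝ × (Fin 3 → ℝ) => (Fin.cons p.1 p.2 : Fin 4 → ℝ) :=
    continuous_pi fun i => Fin.cases continuous_fst
      (fun k => (continuous_apply k).comp continuous_snd) i
  have hsm : StronglyMeasurable
      (Function.uncurry fun (τ : ℝ) (x : Fin 3 → ℝ) => f (Fin.cons τ x) ^ 2) :=
    ((hf.comp hcons).pow 2).stronglyMeasurable
  have h := hsm.integral_prod_right (ν := (volume : Measure (Fin 3 → ℝ)))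
  exact h.measurable.sqrt

lemma ConeSupp.L2x_eq_zero {B : ℝ} {f : (Fin 4 → ℝ) → ℝ} (h : ConeSupp B f) {τ : ℝ}
    (hτ : τ ≤ 2 * B) : L2x f τ = 0 := by
  have : ∀ x : Fin 3 → ℝ, f (Fin.cons τ x) = 0 := fun x => h _ (Or.inl (by simpa using hτ))
  simp [L2x, this]

lemma length_boostWord_le (i : Fin 4) : (boostWord i).length ≤ 1 := by
  refine Fin.cases ?_ (fun k => ?_) i <;> simp [boostWord]

lemma length_boostWord_append_le (i j k : Fin 4) :
    (boostWord k ++ (boostWord j ++ boostWord i)).length ≤ 3 := by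
  have := length_boostWord_le i
  have := length_boostWord_le j
  have := length_boostWord_le k
  simp only [List.length_append]; omega

lemma boostNorm_le {f : (Fin 4 → ℝ) → ℝ} {τ K : ℝ}
    (hK : ∀ L : List (Fin 10), L.length ≤ 3 → L2x (opIter GammaField L f) τ ≤ K) :
    boostNorm f τ ≤ ENNReal.ofReal (64 * K) := by
  have h : boostNorm f τ ≤ ∑ _i : Fin 4, ∑ _j : Fin 4, ∑ _k : Fin 4, ENNReal.ofReal K :=
    Finset.sum_le_sum fun i _ => Finset.sum_le_sum fun j _ => Finset.sum_le_sum fun k _ =>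
      ENNReal.ofReal_le_ofReal (hK _ (length_boostWord_append_le i j k))
  refine h.trans (le_of_eq ?_)
  rw [ENNReal.ofReal_mul (by norm_num)]
  simp only [Finset.sum_const, Finset.card_univ, Fintype.card_fin, nsmul_eq_mul]
  rw [← mul_assoc, ← mul_assoc]
  norm_num

lemma lintegral_weight_boostNorm_le {B : ℝ} (hB : 0 < B) {f : (Fin 4 → ℝ) → ℝ}
    (hf : ContDiff ℝ (⊤ : ℕ∞) f) (h : ConeSupp B f) {t M : ℝ}
    (hM : ∀ L : List (Fin 10), L.length ≤ 3 → dyadic (L2x (opIter GammaField L f)) B t ≤ M)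
    (σ : ℝ) :
    ∫⁻ τ in Set.Ioo σ t, ENNReal.ofReal ((1 - τ / t) ^ (-(3:ℝ) / 4)) * boostNorm f τ ≤
      ENNReal.ofReal (1024 * M) := by
  have hone : ∀ L : List (Fin 10), L.length ≤ 3 → ∫⁻ τ in Set.Ioo σ t,
      ENNReal.ofReal ((1 - τ / t) ^ (-(3:ℝ) / 4)) *
        ENNReal.ofReal (L2x (opIter GammaField L f) τ) ≤ ENNReal.ofReal (16 * M) := by
    intro L hL
    have hs := ConeSupp.opIter hf h L
    obtain ⟨K, -, hK⟩ := hs.L2x_le hB (smooth_opIter hf L).continuous t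
    refine le_trans ?_ ((lintegral_weight_le_dyadic (L2x_nonneg _) hB hK).trans
      (ENNReal.ofReal_le_ofReal (by linarith [hM L hL])))
    rw [← lintegral_indicator measurableSet_Ioo, ← lintegral_indicator measurableSet_Ioo]
    refine lintegral_mono fun τ => ?_
    by_cases hτ : τ ∈ Set.Ioo σ t
    · rw [Set.indicator_of_mem hτ]
      rcases le_or_gt τ (2 * B) with h2 | h2
      · simp [hs.L2x_eq_zero h2]
      · have hτ' : τ ∈ Set.Ioo (2 * B) t := ⟨h2, hτ.2⟩
        rw [Set.indicator_of_mem hτ']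
    · rw [Set.indicator_of_notMem hτ]; exact zero_le
  have hm : ∀ L, Measurable fun τ => ENNReal.ofReal ((1 - τ / t) ^ (-(3:ℝ) / 4)) *
      ENNReal.ofReal (L2x (opIter GammaField L f) τ) := by
    intro L
    have := measurable_L2x (smooth_opIter hf L).continuous
    fun_prop
  simp only [boostNorm, Finset.mul_sum]
  rw [lintegral_finsetSum _ fun i _ => Finset.measurable_sum _ fun j _ =>
    Finset.measurable_sum _ fun k _ => hm _]
  have h64 : ∑ _i : Fin 4, ∑ _j : Fin 4, ∑ _k : Fin 4, ENNReal.ofReal (16 * M) =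
      ENNReal.ofReal (1024 * M) := by
    rw [ENNReal.ofReal_mul (by norm_num), ENNReal.ofReal_mul (by norm_num)]
    simp only [Finset.sum_const, Finset.card_univ, Fintype.card_fin, nsmul_eq_mul]
    rw [← mul_assoc, ← mul_assoc, ← mul_assoc]
    norm_num
  rw [← h64]
  refine Finset.sum_le_sum fun i _ => ?_
  rw [lintegral_finsetSum _ fun j _ => Finset.measurable_sum _ fun k _ => hm _]
  refine Finset.sum_le_sum fun j _ => ?_
  rw [lintegral_finsetSum _ fun k _ => hm _]
  exact Finset.sum_le_sum fun k _ => hone _ (length_boostWord_append_le i j k)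

/-- The words in the vector fields occurring in `hyperTerm`. -/
def hyperWord : Fin 7 → List (Fin 10) := ![[], [4, 4], [5, 5], [6, 6], [7, 7], [8, 8], [9, 9]]

lemma length_hyperWord_le (i : Fin 7) : (hyperWord i).length ≤ 2 := by
  fin_cases i <;> simp [hyperWord]

lemma enorm_hyperTerm_le (w : (Fin 4 → ℝ) → ℝ) (z : Fin 4 → ℝ) :
    ‖hyperTerm w z‖ₑ ≤ ∑ i, ‖opIter GammaField (hyperWord i) w z‖ₑ := by
  simp only [← ofReal_norm]
  rw [← ENNReal.ofReal_sum_of_nonneg (fun _ _ => norm_nonneg _)]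
  refine ENNReal.ofReal_le_ofReal ?_
  rw [Fin.sum_univ_seven]
  change |(GammaField 7 (GammaField 7 w) z + GammaField 8 (GammaField 8 w) z
    + GammaField 9 (GammaField 9 w) z) - (GammaField 4 (GammaField 4 w) z
    + GammaField 5 (GammaField 5 w) z + GammaField 6 (GammaField 6 w) z) + 3 / 4 * w z| ≤
    |w z| + |GammaField 4 (GammaField 4 w) z| + |GammaField 5 (GammaField 5 w) z| +
    |GammaField 6 (GammaField 6 w) z| + |GammaField 7 (GammaField 7 w) z| +
    |GammaField 8 (GammaField 8 w) z| + |GammaField 9 (GammaField 9 w) z|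
  generalize GammaField 4 (GammaField 4 w) z = a4
  generalize GammaField 5 (GammaField 5 w) z = a5
  generalize GammaField 6 (GammaField 6 w) z = a6
  generalize GammaField 7 (GammaField 7 w) z = a7
  generalize GammaField 8 (GammaField 8 w) z = a8
  generalize GammaField 9 (GammaField 9 w) z = a9
  generalize w z = a
  have := abs_nonneg a
  rw [abs_le]
  constructor <;>
  linarith [le_abs_self a, le_abs_self a4, le_abs_self a5, le_abs_self a6, le_abs_self a7,
    le_abs_self a8, le_abs_self a9, neg_abs_le a, neg_abs_le a4, neg_abs_le a5, neg_abs_le a6,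
    neg_abs_le a7, neg_abs_le a8, neg_abs_le a9]

lemma dyadic_le_sum {F : (Fin 4 → ℝ) → ℝ} (B t : ℝ) {L : List (Fin 10)} (hL : L.length ≤ 5) :
    dyadic (L2x (opIter GammaField L F)) B t ≤ ∑ n ∈ Finset.range 6, ∑ σ : Fin n → Fin 10,
      dyadic (L2x (opIter GammaField (List.ofFn σ) F)) B t := by
  have h0 : ∀ (n : ℕ) (σ : Fin n → Fin 10),
      0 ≤ dyadic (L2x (opIter GammaField (List.ofFn σ) F)) B t := fun n σ =>
    dyadic_nonneg (L2x_nonneg _) B t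
  calc dyadic (L2x (opIter GammaField L F)) B t
      = dyadic (L2x (opIter GammaField (List.ofFn L.get) F)) B t := by rw [List.ofFn_get]
    _ ≤ ∑ σ : Fin L.length → Fin 10, dyadic (L2x (opIter GammaField (List.ofFn σ) F)) B t :=
        Finset.single_le_sum (f := fun σ : Fin L.length → Fin 10 =>
          dyadic (L2x (opIter GammaField (List.ofFn σ) F)) B t) (fun σ _ => h0 _ σ)
          (Finset.mem_univ _)
    _ ≤ _ := Finset.single_le_sum (f := fun n => ∑ σ : Fin n → Fin 10,
          dyadic (L2x (opIter GammaField (List.ofFn σ) F)) B t)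
          (fun n _ => Finset.sum_nonneg fun σ _ => h0 n σ)
          (Finset.mem_range.2 (by omega))

lemma L2x_opIter_le {μ B t M : ℝ} (hμ : 1 ≤ μ) (hB : 0 < B) {w : (Fin 4 → ℝ) → ℝ}
    (hw : ContDiff ℝ (⊤ : ℕ∞) w) (h : ConeSupp B w) (hM0 : 0 ≤ M) {L : List (Fin 10)}
    (hM : dyadic (L2x (opIter GammaField L (KG μ w))) B t ≤ M) {τ : ℝ} (hτ : τ ≤ t) :
    L2x (opIter GammaField L w) τ ≤ 32 * M := by
  have hs := ConeSupp.opIter hw h L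
  rcases le_or_gt τ (2 * B) with h2 | h2
  · rw [hs.L2x_eq_zero h2]; positivity
  have hF := smooth_KG hw μ
  obtain ⟨K, -, hK⟩ := (ConeSupp.opIter hF (coneSupp_KG hw h) L).L2x_le hB
    (smooth_opIter hF L).continuous t
  have hint := lintegral_le_dyadic (L2x_nonneg _) hB hK
  rw [← KG_opIter hw] at hint hM
  have := L2x_le_of_lintegral_KG hμ hB (smooth_opIter hw L) hs (K := 16 * M) (by positivity)
    (hint.trans (ENNReal.ofReal_le_ofReal (by linarith))) ⟨h2.le, hτ⟩
  linarith

/-- The decay estimate along rays, with an explicit constant. -/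
lemma decay_ray {μ B t c M : ℝ} (hμ : 1 ≤ μ) (hB : 0 < B) {w : (Fin 4 → ℝ) → ℝ}
    (hw : ContDiff ℝ (⊤ : ℕ∞) w) (h : ConeSupp B w) {y : Fin 3 → ℝ} (hc : 0 < c)
    (hcy : c ^ 2 = 1 - nsq y) (ht : 2 * B ≤ t) (hM0 : 0 ≤ M)
    (hM : ∀ L : List (Fin 10), L.length ≤ 5 →
      dyadic (L2x (opIter GammaField L (KG μ w))) B t ≤ M) :
    t ^ ((3:ℝ) / 2) * |w (ray y t)| ≤
      120 ^ 3 * 480 * (1024 + 7 * 4 * 2048 * 36 / B) * M := by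
  have hF := smooth_KG hw μ
  have hs₀ : 0 < B / c ^ 2 := by positivity
  have hsource : ∫⁻ s in Set.Ioo (B / c ^ 2) t, ENNReal.ofReal (s ^ ((3:ℝ) / 2) * c) *
      ‖KG μ w (ray y s)‖ₑ ≤ ENNReal.ofReal (120 ^ 3 * 480 * 1024 * M) := by
    have h1 := lintegral_ray_le hB hF (coneSupp_KG hw h) hc hcy 0 hs₀ (t := t)
    simp only [pow_zero, mul_one, one_mul] at h1
    refine h1.trans ((mul_le_mul_right (lintegral_weight_boostNorm_le hB hF (coneSupp_KG hw h)
      (fun L hL => hM L (by omega)) _) _).trans (le_of_eq ?_))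
    rw [← ENNReal.ofReal_mul (by norm_num)]
    congr 1; ring
  have hword : ∀ W : List (Fin 10), W.length ≤ 2 → ∫⁻ s in Set.Ioo (B / c ^ 2) t,
      ENNReal.ofReal (s ^ ((3:ℝ) / 2) * s⁻¹ ^ 2 * c) * ‖opIter GammaField W w (ray y s)‖ₑ ≤
        ENNReal.ofReal (120 ^ 3 * 480 * 4 * 2048 * 36 * M * c ^ 2 / B) := by
    intro W hW
    refine (lintegral_ray_le hB (smooth_opIter hw W) (ConeSupp.opIter hw h W) hc hcy 2 hs₀
      (t := t)).trans ?_
    have hN : ∀ τ ∈ Set.Ioo (B / c ^ 2 / 2) t,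
        ENNReal.ofReal (τ⁻¹ ^ 2 * (1 - τ / t) ^ (-(3:ℝ) / 4)) *
          boostNorm (opIter GammaField W w) τ ≤
        ENNReal.ofReal (τ⁻¹ ^ 2 * (1 - τ / t) ^ (-(3:ℝ) / 4)) *
          ENNReal.ofReal (64 * (32 * M)) := by
      intro τ hτ
      refine mul_le_mul_right (boostNorm_le fun L hL => ?_) _
      rw [← opIter_append]
      exact L2x_opIter_le hμ hB hw h hM0 (hM _ (by rw [List.length_append]; omega)) hτ.2.le
    refine (mul_le_mul_right (setLIntegral_mono_ae' measurableSet_Ioo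
      (Filter.Eventually.of_forall hN)) _).trans ?_
    rw [lintegral_mul_const' _ _ ENNReal.ofReal_ne_top]
    refine (mul_le_mul_right (mul_le_mul_left
      (lintegral_weight_inv_sq (half_pos hs₀)) _) _).trans (le_of_eq ?_)
    rw [← ENNReal.ofReal_mul (by positivity), ← ENNReal.ofReal_mul (by positivity)]
    congr 1
    field_simp; ring
  have hhyper : ∫⁻ s in Set.Ioo (B / c ^ 2) t,
      ENNReal.ofReal (s ^ ((3:ℝ) / 2) * s⁻¹ ^ 2 * c) * ‖hyperTerm w (ray y s)‖ₑ ≤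
        ENNReal.ofReal (7 * (120 ^ 3 * 480 * 4 * 2048 * 36 * M * c ^ 2 / B)) := by
    have hm : ∀ W, Measurable fun s => ENNReal.ofReal (s ^ ((3:ℝ) / 2) * s⁻¹ ^ 2 * c) *
        ‖opIter GammaField W w (ray y s)‖ₑ := fun W =>
      Measurable.mul (by fun_prop)
        ((smooth_opIter hw W).continuous.comp (continuous_ray y)).enorm.measurable
    calc _ ≤ ∫⁻ s in Set.Ioo (B / c ^ 2) t, ∑ i,
          ENNReal.ofReal (s ^ ((3:ℝ) / 2) * s⁻¹ ^ 2 * c) *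
            ‖opIter GammaField (hyperWord i) w (ray y s)‖ₑ := by
          refine lintegral_mono fun s => ?_
          rw [← Finset.mul_sum]
          exact mul_le_mul_right (enorm_hyperTerm_le w _) _
      _ = ∑ i, ∫⁻ s in Set.Ioo (B / c ^ 2) t,
          ENNReal.ofReal (s ^ ((3:ℝ) / 2) * s⁻¹ ^ 2 * c) *
            ‖opIter GammaField (hyperWord i) w (ray y s)‖ₑ :=
          lintegral_finsetSum _ fun i _ => hm _
      _ ≤ ∑ _i : Fin 7, ENNReal.ofReal (120 ^ 3 * 480 * 4 * 2048 * 36 * M * c ^ 2 / B) :=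
          Finset.sum_le_sum fun i _ => hword _ (length_hyperWord_le i)
      _ = _ := by
          rw [ENNReal.ofReal_mul (by norm_num)]
          simp only [Finset.sum_const, Finset.card_univ, Fintype.card_fin, nsmul_eq_mul]
          norm_num
  have hfin := (ray_bound hμ hB hw h hc hcy ht).trans
    (add_le_add hsource (mul_le_mul_right hhyper _))
  rw [← ENNReal.ofReal_mul (by positivity), ← ENNReal.ofReal_add (by positivity) (by positivity),
    ENNReal.ofReal_le_ofReal_iff (by positivity)] at hfin
  refine hfin.trans (le_of_eq ?_)
  field_simp

/-- decay estimate for Klein–Gordon equations: fix `B > 0`.  There is a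
constant `C`, independent of `μ ≥ 1`, such that if `w ∈ C^∞(ℝ×ℝ³)` satisfies `w(t,x)=0` for
`t ≤ 2B` and `(□+μ²)w(t,x)=0` for `|x| > t-B`, then for all `t ≥ 2B`,
`(1+t)^{3/2} sup_x |w(t,x)| ≤ C Σ_{|α|≤5} Σ_k sup_{τ∈[2^{k-1},2^{k+1}]∩[2B,t]} 2^k ‖Γ^α (□+μ²)w(τ,·)‖₂`. -/
theorem stmt11 (B : ℝ) (hB : 0 < B) :
    ∃ C : ℝ, 0 < C ∧
      ∀ μ : ℝ, 1 ≤ μ →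
        ∀ w : (Fin 4 → ℝ) → ℝ, ContDiff ℝ (⊤ : ℕ∞) w →
          (∀ z : Fin 4 → ℝ, z 0 ≤ 2*B → w z = 0) →
          (∀ z : Fin 4 → ℝ, rad z > z 0 - B → Box w z + μ^2 * w z = 0) →
          ∀ t : ℝ, 2*B ≤ t → ∀ x : Fin 3 → ℝ,
            (1 + t) ^ ((3:ℝ)/2) * |w (Fin.cons t x)| ≤
              C * ∑ n ∈ Finset.range 6, ∑ σ : Fin n → Fin 10,
                dyadic (L2x (opIter GammaField (List.ofFn σ)
                  (fun z => Box w z + μ^2 * w z))) B t := by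
  refine ⟨(1 + 1 / (2 * B)) ^ ((3:ℝ) / 2) *
    (120 ^ 3 * 480 * (1024 + 7 * 4 * 2048 * 36 / B)), by positivity, ?_⟩
  intro μ hμ w hw h0 hF t ht x
  have h : ConeSupp B w := coneSupp_of_KG hμ hw h0 hF
  have ht0 : 0 < t := by linarith
  have hL : ∀ L : List (Fin 10), L.length ≤ 5 →
      dyadic (L2x (opIter GammaField L (KG μ w))) B t ≤ _ := fun L hL =>
    dyadic_le_sum (F := KG μ w) B t hL
  change _ ≤ _ * ∑ n ∈ Finset.range 6, ∑ σ : Fin n → Fin 10,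
    dyadic (L2x (opIter GammaField (List.ofFn σ) (KG μ w))) B t
  have hM0 := (dyadic_nonneg (L2x_nonneg _) B t).trans (hL [] (by simp))
  revert hL hM0
  generalize (∑ n ∈ Finset.range 6, ∑ σ : Fin n → Fin 10,
    dyadic (L2x (opIter GammaField (List.ofFn σ) (KG μ w))) B t) = M
  intro hL hM0
  by_cases hx : t - B < rad (Fin.cons t x)
  · rw [h _ (Or.inr hx), abs_zero, mul_zero]
    positivity
  have hrad : rad (Fin.cons t x) = Real.sqrt (nsq x) := rfl
  have hxt : nsq x < t ^ 2 := by
    rw [← Real.sqrt_lt' ht0, ← hrad]; linarith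
  have hny : nsq (t⁻¹ • x) = nsq x / t ^ 2 := by
    simp only [nsq, Pi.smul_apply, smul_eq_mul]; field_simp
  have hy1 : 0 < 1 - nsq (t⁻¹ • x) := by
    rw [hny, sub_pos, div_lt_one (by positivity)]; exact hxt
  have hray : ray (t⁻¹ • x) t = Fin.cons t x := by
    ext i
    refine Fin.cases ?_ (fun k => ?_) i
    · simp [ray]
    · simp [ray, ht0.ne']
  have key := decay_ray hμ hB hw h (Real.sqrt_pos.2 hy1) (Real.sq_sqrt hy1.le) ht hM0 hL
  rw [hray] at key
  have h1 : (1 + t) ^ ((3:ℝ) / 2) ≤ (1 + 1 / (2 * B)) ^ ((3:ℝ) / 2) * t ^ ((3:ℝ) / 2) := by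
    rw [← Real.mul_rpow (by positivity) ht0.le]
    refine Real.rpow_le_rpow (by positivity) ?_ (by norm_num)
    have : 1 ≤ 1 / (2 * B) * t := by
      rw [one_div, inv_mul_eq_div, le_div_iff₀ (by positivity)]; linarith
    linarith
  calc (1 + t) ^ ((3:ℝ) / 2) * |w (Fin.cons t x)|
      ≤ (1 + 1 / (2 * B)) ^ ((3:ℝ) / 2) * t ^ ((3:ℝ) / 2) * |w (Fin.cons t x)| :=
        mul_le_mul_of_nonneg_right h1 (abs_nonneg _)
    _ = (1 + 1 / (2 * B)) ^ ((3:ℝ) / 2) * (t ^ ((3:ℝ) / 2) * |w (Fin.cons t x)|) := by ring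
    _ ≤ (1 + 1 / (2 * B)) ^ ((3:ℝ) / 2) *
        (120 ^ 3 * 480 * (1024 + 7 * 4 * 2048 * 36 / B) * M) :=
        mul_le_mul_of_nonneg_left key (by positivity)
    _ = _ := by ring
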